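/- Let S be a connected analytic submanifold of ℝ^{n−1} and let P ∈ ℝ[x₁,…,x_{n−1};x_n] have degree d_n in x_n. Assume P never nullifies on S, and that the discriminant Disc^{d_n}_{x_n}(P) is not the zero polynomial and is order-invariant on S. Then for each s ∈ S there exists a connected neighbourhood N_s of s in S such that P is projectively delineable on N_s and H^{d_n}(P) is order-invariant on each projective P-section over N_s. -/

import Mathlib

noncomputable section

open Polynomial Finset

/-- The real projective line `ℝP¹`: the quotient of `ℝ² ∖ {0}` by proportionality. -/
abbrev RP1 : Type := Projectivization ℝ (Fin 2 → ℝ)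

/-- The quotient topology on the real projective line. -/
instance : TopologicalSpace RP1 :=
  inferInstanceAs (TopologicalSpace (Quotient (projectivizationSetoid ℝ (Fin 2 → ℝ))))

/-- Homogenization of a univariate real polynomial with respect to the degree `d`,
as a binary form (an element of `ℝ[x,y]`, homogeneous of degree `d` when `P.natDegree ≤ d`):
`H^d(P)(x,y) = ∑_{k=0}^d c_k x^k y^(d-k)`. -/
def homog (d : ℕ) (P : Polynomial ℝ) : MvPolynomial (Fin 2) ℝ :=
  ∑ k ∈ Finset.range (d + 1),
    MvPolynomial.C (P.coeff k) * MvPolynomial.X 0 ^ k * MvPolynomial.X 1 ^ (d - k)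

/-- The pull-back `ι_M^{*}` of a binary form `g` along the parametrized line
`ι_M : x ↦ M (x,1)ᵀ`, i.e. the univariate polynomial `g(m₁₁ x + m₁₂, m₂₁ x + m₂₂)`.
For `M = 1` this is the standard pull-back `ι^{*d} g = g(x, 1)`. -/
def pullM (M : Matrix (Fin 2) (Fin 2) ℝ) (g : MvPolynomial (Fin 2) ℝ) : Polynomial ℝ :=
  MvPolynomial.eval₂ Polynomial.C
    ![Polynomial.C (M 0 0) * Polynomial.X + Polynomial.C (M 0 1),
      Polynomial.C (M 1 0) * Polynomial.X + Polynomial.C (M 1 1)] g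

/-- Right composition `R_M g = g ∘ M` of a binary form with a linear map of `ℝ²`. -/
def compM (M : Matrix (Fin 2) (Fin 2) ℝ) (g : MvPolynomial (Fin 2) ℝ) : MvPolynomial (Fin 2) ℝ :=
  MvPolynomial.eval₂ MvPolynomial.C
    (fun i => ∑ j, MvPolynomial.C (M i j) * MvPolynomial.X j) g

/-- The operator `A^{*d} P = ι_A^{*d} (H^d P)`, i.e.
`A^{*d}P(x) = ∑_{k=0}^d c_k (a₁₁x+a₁₂)^k (a₂₁x+a₂₂)^{d-k}` for `P = ∑ c_k x^k`. -/
def AstarU (d : ℕ) (M : Matrix (Fin 2) (Fin 2) ℝ) (P : Polynomial ℝ) : Polynomial ℝ :=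
  pullM M (homog d P)

/-- The Sylvester matrix of `P` and `Q` with respect to the fixed degrees `p` and `q`
(padding with zero coefficients as if `deg P = p` and `deg Q = q`). -/
def sylvester {R : Type*} [CommRing R] (p q : ℕ) (P Q : Polynomial R) :
    Matrix (Fin (p + q)) (Fin (p + q)) R := fun i j =>
  if (i : ℕ) < q then
    (if (i : ℕ) ≤ (j : ℕ) ∧ (j : ℕ) ≤ (i : ℕ) + p then P.coeff (p + (i : ℕ) - (j : ℕ)) else 0)
  else
    (if (i : ℕ) - q ≤ (j : ℕ) ∧ (j : ℕ) ≤ (i : ℕ) then Q.coeff (q + ((i : ℕ) - q) - (j : ℕ)) else 0)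

/-- The resultant `Res^{p,q}(P,Q)` with respect to the fixed degrees `p` and `q`:
the determinant of the corresponding Sylvester matrix. -/
def resFixed {R : Type*} [CommRing R] (p q : ℕ) (P Q : Polynomial R) : R :=
  (sylvester p q P Q).det

/-- The discriminant `Disc^p(P)` of `P` with respect to the fixed degree `p`: the resultant
(with respect to degrees `(p-1, p-1)`) of the pull-backs of the two partial derivatives
`F_x`, `F_y` of the binary form `F = H^p(P)`; these pull-backs are `P'` and `p·P − x·P'`. -/
def discFixed {R : Type*} [CommRing R] (p : ℕ) (P : Polynomial R) : R :=
  (-1) ^ (p * (p - 1) / 2) *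
    resFixed (p - 1) (p - 1) (Polynomial.derivative P)
      (Polynomial.C (p : R) * P - Polynomial.X * Polynomial.derivative P)

/-- Evaluation `E_x` of a polynomial in `x₁,…,x_m;x_n` at `x ∈ ℝ^m` in its first `m`
variables, giving a univariate real polynomial in `x_n`. -/
def evalP {m : ℕ} (P : Polynomial (MvPolynomial (Fin m) ℝ)) (x : Fin m → ℝ) : Polynomial ℝ :=
  P.map (MvPolynomial.eval x : MvPolynomial (Fin m) ℝ →+* ℝ)

/-- The operator `A^{*d}` acting on the last variable of a polynomial in `x₁,…,x_m;x_n`: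
`A^{*d}P(x,x_n) = ∑_{k=0}^d c_k(x) (a₁₁x_n+a₁₂)^k (a₂₁x_n+a₂₂)^{d-k}`. -/
def AstarPoly {m : ℕ} (d : ℕ) (M : Matrix (Fin 2) (Fin 2) ℝ)
    (P : Polynomial (MvPolynomial (Fin m) ℝ)) : Polynomial (MvPolynomial (Fin m) ℝ) :=
  ∑ k ∈ Finset.range (d + 1),
    Polynomial.C (P.coeff k) *
      (Polynomial.C (MvPolynomial.C (M 0 0)) * Polynomial.X
        + Polynomial.C (MvPolynomial.C (M 0 1))) ^ k *
      (Polynomial.C (MvPolynomial.C (M 1 0)) * Polynomial.X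
        + Polynomial.C (MvPolynomial.C (M 1 1))) ^ (d - k)

/-- The order of a (polynomial) function at a point: the smallest `k` such that some
partial derivative of total order `k` does not vanish at the point, i.e. the smallest `k`
with `iteratedFDeriv ℝ k f v ≠ 0`; it is `⊤` if all derivatives vanish. -/
def ordAt {E : Type*} [NormedAddCommGroup E] [NormedSpace ℝ E] (f : E → ℝ) (v : E) : ℕ∞ :=
  sInf {k : ℕ∞ | ∃ n : ℕ, k = n ∧ iteratedFDeriv ℝ n f v ≠ 0}

/-- A function is order-invariant on a set if it has the same order at every point of the set. -/
def OrderInvariantOn {E : Type*} [NormedAddCommGroup E] [NormedSpace ℝ E]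
    (f : E → ℝ) (S : Set E) : Prop :=
  ∀ x ∈ S, ∀ y ∈ S, ordAt f x = ordAt f y

/-- `(v 0 : v 1)` is a projective root of the binary form `g` of multiplicity (exactly) `mult`:
in the factorization of `g`, the linear form vanishing on the line through `v` occurs with
exponent `mult`. -/
def HasProjRootOfMult (g : MvPolynomial (Fin 2) ℝ) (v : Fin 2 → ℝ) (mult : ℕ) : Prop :=
  ∃ h : MvPolynomial (Fin 2) ℝ,
    g = (MvPolynomial.C (v 1) * MvPolynomial.X 0 - MvPolynomial.C (v 0) * MvPolynomial.X 1) ^ mult * h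
      ∧ MvPolynomial.eval v h ≠ 0

/-- The projective zero set `Z_{ℝP¹}(P,S)` of `P` over `S`, with respect to the degree `d`
in the last variable: the set of `(x, (x_n : y))` with `x ∈ S` and `H^d(P)(x,(x_n,y)) = 0`. -/
def ZProj {m : ℕ} (d : ℕ) (P : Polynomial (MvPolynomial (Fin m) ℝ)) (S : Set (Fin m → ℝ)) :
    Set ((Fin m → ℝ) × RP1) :=
  {p | p.1 ∈ S ∧ ∃ (v : Fin 2 → ℝ) (hv : v ≠ 0),
    Projectivization.mk ℝ v hv = p.2 ∧ MvPolynomial.eval v (homog d (evalP P p.1)) = 0}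

/-- `θ` is a (finite) system of real root functions for `P` on `S`: continuous functions with
pairwise disjoint graphs whose union is `Z_ℝ(P,S)`, each of constant positive multiplicity. -/
def IsRealRootFunctions {m : ℕ} (P : Polynomial (MvPolynomial (Fin m) ℝ)) (S : Set (Fin m → ℝ))
    {k : ℕ} (θ : Fin k → (Fin m → ℝ) → ℝ) : Prop :=
  (∀ l, ContinuousOn (θ l) S) ∧
  (∀ x ∈ S, ∀ l l' : Fin k, l ≠ l' → θ l x ≠ θ l' x) ∧
  (∀ x ∈ S, ∀ t : ℝ, (evalP P x).eval t = 0 ↔ ∃ l, θ l x = t) ∧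
  (∀ l : Fin k, ∃ mult : ℕ, 0 < mult ∧ ∀ x ∈ S, (evalP P x).rootMultiplicity (θ l x) = mult)

/-- `P` is delineable on `S`. -/
def Delineable {m : ℕ} (P : Polynomial (MvPolynomial (Fin m) ℝ)) (S : Set (Fin m → ℝ)) : Prop :=
  ∃ (k : ℕ) (θ : Fin k → (Fin m → ℝ) → ℝ), IsRealRootFunctions P S θ

/-- `θ` is a (finite) system of projective root functions for `P` on `S` with respect to the
degree `d` in the last variable: continuous functions into `ℝP¹` with pairwise disjoint graphs
whose union is `Z_{ℝP¹}(P,S)`, each of constant positive multiplicity. -/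
def IsProjRootFunctions {m : ℕ} (d : ℕ) (P : Polynomial (MvPolynomial (Fin m) ℝ))
    (S : Set (Fin m → ℝ)) {k : ℕ} (θ : Fin k → (Fin m → ℝ) → RP1) : Prop :=
  (∀ l, ContinuousOn (θ l) S) ∧
  (∀ x ∈ S, ∀ l l' : Fin k, l ≠ l' → θ l x ≠ θ l' x) ∧
  (∀ x ∈ S, ∀ (v : Fin 2 → ℝ) (hv : v ≠ 0),
    (MvPolynomial.eval v (homog d (evalP P x)) = 0 ↔ ∃ l, θ l x = Projectivization.mk ℝ v hv)) ∧
  (∀ l : Fin k, ∃ mult : ℕ, 0 < mult ∧ ∀ x ∈ S, ∀ (v : Fin 2 → ℝ) (hv : v ≠ 0),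
    θ l x = Projectivization.mk ℝ v hv → HasProjRootOfMult (homog d (evalP P x)) v mult)

/-- `P` is projectively delineable on `S` (with respect to the degree `d` in the last variable). -/
def ProjDelineable {m : ℕ} (d : ℕ) (P : Polynomial (MvPolynomial (Fin m) ℝ))
    (S : Set (Fin m → ℝ)) : Prop :=
  ∃ (k : ℕ) (θ : Fin k → (Fin m → ℝ) → RP1), IsProjRootFunctions d P S θ

/-- `S` is an analytic submanifold of `ℝ^m`: around each of its points, in suitable
real-analytic coordinates, `S` is an open piece of a linear subspace. -/
def IsAnalyticSubmanifold {m : ℕ} (S : Set (Fin m → ℝ)) : Prop :=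
  ∀ s ∈ S, ∃ (U V : Set (Fin m → ℝ)) (φ ψ : (Fin m → ℝ) → (Fin m → ℝ))
      (L : Submodule ℝ (Fin m → ℝ)),
    IsOpen U ∧ IsOpen V ∧ s ∈ U ∧
    AnalyticOnNhd ℝ φ U ∧ AnalyticOnNhd ℝ ψ V ∧
    Set.MapsTo φ U V ∧ Set.MapsTo ψ V U ∧
    Set.EqOn (ψ ∘ φ) id U ∧ Set.EqOn (φ ∘ ψ) id V ∧
    φ '' (U ∩ S) = V ∩ (L : Set (Fin m → ℝ))

end


namespace LPD
open Polynomial Filter Topology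

/-- a monic complex polynomial which is small at `α` has a root close to `α`. -/
lemma exists_root_near (q : ℂ[X]) (d : ℕ) (hm : q.Monic) (hd : q.natDegree = d) (hd0 : d ≠ 0)
    (α : ℂ) (r : ℝ) (hr : 0 < r) (h : ‖q.eval α‖ < r ^ d) : ∃ z, q.eval z = 0 ∧ ‖z - α‖ < r := by
  by_contra hcon
  push Not at hcon
  have hs := IsAlgClosed.splits q
  have h1 : q.eval α = (q.roots.map (fun z => α - z)).prod := by
    conv_lhs => rw [hs.eq_prod_roots_of_monic hm]
    simp [eval_multiset_prod, Multiset.map_map]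
  have hcard : q.roots.card = d := by rw [← hd]; exact hs.natDegree_eq_card_roots.symm
  have h2 : r ^ d ≤ ‖q.eval α‖ := by
    have h3 : ‖(q.roots.map (fun z => α - z)).prod‖ = (q.roots.map (fun z => ‖α - z‖)).prod := by
      have := map_multiset_prod (normHom : ℂ →*₀ ℝ) (q.roots.map (fun z => α - z))
      rw [Multiset.map_map] at this
      exact this
    rw [h1, h3, ← hcard]
    have : (q.roots.map (fun _ : ℂ => r)).prod ≤ (q.roots.map (fun z => ‖α - z‖)).prod := by
      apply Multiset.prod_map_le_prod_map₀
      · intro i hi; exact hr.le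
      · intro i hi
        rw [norm_sub_rev]
        exact hcon i (by simpa [hm.ne_zero] using hi)
    simpa using this
  linarith

lemma eventually_root_near {A : Type*} (l : Filter A) (q : A → ℂ[X]) (d : ℕ)
    (hm : ∀ᶠ y in l, (q y).Monic ∧ (q y).natDegree = d) (hd0 : d ≠ 0) (α : ℂ)
    (ht : Tendsto (fun y => (q y).eval α) l (𝓝 0)) (r : ℝ) (hr : 0 < r) :
    ∀ᶠ y in l, ∃ z, (q y).eval z = 0 ∧ ‖z - α‖ < r := by
  have h1 : ∀ᶠ y in l, ‖(q y).eval α‖ < r ^ d := by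
    have := ht.norm
    simp only [norm_zero] at this
    exact this.eventually (gt_mem_nhds (by positivity))
  filter_upwards [hm, h1] with y h2 h3
  exact exists_root_near (q y) d h2.1 h2.2 hd0 α r hr h3

/-- a finite set of points has disjoint balls of a uniform radius -/
lemma exists_sep_radius (s : Finset ℂ) : ∃ r : ℝ, 0 < r ∧ ∀ a ∈ s, ∀ b ∈ s, a ≠ b →
    ∀ z, ‖z - a‖ < r → ‖z - b‖ < r → False := by
  have : ∃ r : ℝ, 0 < r ∧ ∀ a ∈ s, ∀ b ∈ s, a ≠ b → 2 * r ≤ ‖a - b‖ := by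
    have h : ∀ p : ℂ × ℂ, ∃ r : ℝ, 0 < r ∧ (p.1 ≠ p.2 → 2 * r ≤ ‖p.1 - p.2‖) := by
      intro p
      by_cases hp : p.1 = p.2
      · exact ⟨1, one_pos, fun h => absurd hp h⟩
      · exact ⟨‖p.1 - p.2‖ / 2, by have := norm_pos_iff.2 (sub_ne_zero.2 hp); positivity, fun _ => by linarith⟩
    choose f hf hf' using h
    by_cases hs : s.Nonempty
    · obtain ⟨p, hp, hmin⟩ := (s ×ˢ s).exists_min_image f (hs.product hs)
      refine ⟨f p, hf p, fun a ha b hb hab => ?_⟩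
      have h1 := hmin (a, b) (Finset.mk_mem_product ha hb)
      have := hf' (a, b) hab
      simp only at this
      linarith
    · refine ⟨1, one_pos, fun a ha => ?_⟩
      exact absurd ⟨a, ha⟩ hs
  obtain ⟨r, hr, h⟩ := this
  refine ⟨r, hr, fun a ha b hb hab z h1 h2 => ?_⟩
  have := h a ha b hb hab
  have h3 : ‖a - b‖ ≤ ‖z - a‖ + ‖z - b‖ := by
    have := norm_sub_le (z - b) (z - a)
    have h4 : a - b = (z - b) - (z - a) := by ring
    rw [h4]; linarith
  linarith

lemma local_roots {A : Type*} [TopologicalSpace A] (q : A → ℂ[X]) (d : ℕ) (hd0 : d ≠ 0)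
    (hm : ∀ y, (q y).Monic ∧ (q y).natDegree = d) (hs : ∀ y, (q y).roots.Nodup)
    (hc : ∀ z, Continuous fun y => (q y).eval z) (y0 : A) :
    ∃ (U : Set A) (α : Fin d → ℂ) (r : ℝ), IsOpen U ∧ y0 ∈ U ∧
      (∀ i j, i ≠ j → ∀ z, ‖z - α i‖ < r → ‖z - α j‖ < r → False) ∧
      ∀ y ∈ U, ∃ ρ : Fin d → ℂ, (∀ i, ‖ρ i - α i‖ < r) ∧ ∀ z, (q y).eval z = 0 ↔ ∃ i, z = ρ i := by
  have hcard : (q y0).roots.toFinset.card = d := by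
    rw [Multiset.toFinset_card_of_nodup (hs y0), ← (hm y0).2]
    exact (IsAlgClosed.splits _).natDegree_eq_card_roots.symm
  let e := (Finset.equivFinOfCardEq hcard).symm
  obtain ⟨r, hr, hsep⟩ := exists_sep_radius (q y0).roots.toFinset
  have hev : ∀ᶠ y in 𝓝 y0, ∀ i : Fin d, ∃ z, (q y).eval z = 0 ∧ ‖z - (e i : ℂ)‖ < r := by
    rw [eventually_all]
    intro i
    apply eventually_root_near (𝓝 y0) q d (Eventually.of_forall hm) hd0 _ _ r hr
    have h1 := (hc (e i)).tendsto y0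
    have h2 : (q y0).eval (e i : ℂ) = 0 := by
      have := (e i).2
      rw [Multiset.mem_toFinset, mem_roots (hm y0).1.ne_zero] at this
      exact this
    rwa [h2] at h1
  obtain ⟨U, hU, hUo, hyU⟩ := eventually_nhds_iff.1 hev
  have hdis : ∀ i j, i ≠ j → ∀ z, ‖z - (e i : ℂ)‖ < r → ‖z - (e j : ℂ)‖ < r → False := by
    intro i j hij z
    apply hsep _ (e i).2 _ (e j).2
    intro h
    exact hij (e.injective (Subtype.ext h))
  refine ⟨U, fun i => e i, r, hUo, hyU, hdis, fun y hy => ?_⟩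
  choose ρ h1 h2 using hU y hy
  refine ⟨ρ, h2, fun z => ⟨fun hz => ?_, ?_⟩⟩
  · have hinj : Function.Injective ρ := by
      intro i j hij
      by_contra hne
      exact hdis i j hne (ρ i) (h2 i) (by rw [hij]; exact h2 j)
    have hsub : Finset.univ.image ρ ⊆ (q y).roots.toFinset := by
      intro z hz
      simp only [Finset.mem_image, Finset.mem_univ, true_and] at hz
      obtain ⟨i, rfl⟩ := hz
      rw [Multiset.mem_toFinset, mem_roots (hm y).1.ne_zero]
      exact h1 i
    have heq := Finset.eq_of_subset_of_card_le hsub (by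
      rw [Finset.card_image_of_injective _ hinj, Finset.card_fin]
      refine (Multiset.toFinset_card_le _).trans ((card_roots' _).trans (hm y).2.le))
    have : z ∈ Finset.univ.image ρ := by
      rw [heq, Multiset.mem_toFinset, mem_roots (hm y).1.ne_zero]
      exact hz
    simp only [Finset.mem_image, Finset.mem_univ, true_and] at this
    obtain ⟨i, hi⟩ := this
    exact ⟨i, hi.symm⟩
  · rintro ⟨i, rfl⟩; exact h1 i

lemma isCoveringMap_roots {A : Type*} [TopologicalSpace A] (q : A → ℂ[X]) (d : ℕ) (hd0 : d ≠ 0)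
    (hm : ∀ y, (q y).Monic ∧ (q y).natDegree = d) (hs : ∀ y, (q y).roots.Nodup)
    (hc : ∀ z, Continuous fun y => (q y).eval z) :
    IsCoveringMap (fun e : {p : A × ℂ // (q p.1).eval p.2 = 0} => e.1.1) := by
  intro y0
  obtain ⟨U, α, r, hU, hyU, hdis, hρ⟩ := local_roots q d hd0 hm hs hc y0
  choose! ρ h1 h2 using hρ
  set f := (fun e : {p : A × ℂ // (q p.1).eval p.2 = 0} => e.1.1) with hf
  have hcont : ∀ i, ContinuousOn (fun y => ρ y i) U := by
    intro i y hy
    rw [ContinuousWithinAt, Metric.tendsto_nhds]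
    intro ε hε
    set r' := min ε (r - ‖ρ y i - α i‖) with hr'
    have hr'0 : 0 < r' := lt_min hε (by linarith [h1 y hy i])
    have := eventually_root_near (𝓝 y) q d (Eventually.of_forall hm) hd0 (ρ y i) (by
      have h3 := (hc (ρ y i)).tendsto y
      rwa [(h2 y hy (ρ y i)).2 ⟨i, rfl⟩] at h3) r' hr'0
    filter_upwards [mem_nhdsWithin_of_mem_nhds this, self_mem_nhdsWithin] with y' h3 hy'
    obtain ⟨z, hz, hzr⟩ := h3
    obtain ⟨j, rfl⟩ := (h2 y' hy' z).1 hz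
    have hji : j = i := by
      by_contra hne
      refine hdis j i hne _ (h1 y' hy' j) ?_
      have := norm_sub_le_norm_sub_add_norm_sub (ρ y' j) (ρ y i) (α i)
      have := min_le_right ε (r - ‖ρ y i - α i‖)
      linarith
    subst hji
    rw [dist_eq_norm]
    exact hzr.trans_le (min_le_left _ _)
  have hidx : ∀ e : f ⁻¹' U, ∃ i, e.1.1.2 = ρ e.1.1.1 i := fun e =>
    (h2 _ e.2 _).1 e.1.2
  choose idx hidx using hidx
  have hidx' : ∀ (e : f ⁻¹' U) i, ‖e.1.1.2 - α i‖ < r → idx e = i := by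
    intro e i hi
    by_contra hne
    refine hdis _ _ hne _ ?_ hi
    rw [hidx e]
    exact h1 _ e.2 _
  have hev : IsEvenlyCovered f y0 (Fin d) := by
    refine ⟨inferInstance, U, hyU, hU, hU.preimage (by fun_prop),
      { toFun := fun e => (⟨f e.1, e.2⟩, idx e)
        invFun := fun p => ⟨⟨(p.1.1, ρ p.1.1 p.2), (h2 _ p.1.2 _).2 ⟨p.2, rfl⟩⟩, p.1.2⟩
        left_inv := ?_
        right_inv := ?_
        continuous_toFun := ?_
        continuous_invFun := ?_ }, ?_⟩
    · intro e
      apply Subtype.ext; apply Subtype.ext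
      exact Prod.ext rfl (hidx e).symm
    · rintro ⟨⟨y, hy⟩, i⟩
      refine Prod.ext rfl ?_
      apply hidx'
      exact h1 y hy i
    · refine Continuous.prodMk (by fun_prop) ?_
      rw [continuous_discrete_rng]
      intro i
      have : idx ⁻¹' {i} = {e : f ⁻¹' U | ‖e.1.1.2 - α i‖ < r} := by
        ext e
        simp only [Set.mem_preimage, Set.mem_singleton_iff, Set.mem_ofPred_eq]
        constructor
        · rintro rfl
          rw [hidx e]; exact h1 _ e.2 _
        · exact hidx' e i
      rw [this]
      exact isOpen_lt (by fun_prop) continuous_const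
    · apply Continuous.subtype_mk
      apply Continuous.subtype_mk
      refine Continuous.prodMk (by fun_prop) ?_
      rw [continuous_prod_of_discrete_right]
      intro i
      exact (hcont i).domRestrict
    · intro e; rfl
  exact hev.to_isEvenlyCovered_preimage

lemma exists_root_functions {A : Type*} [TopologicalSpace A] [SimplyConnectedSpace A]
    [LocallyPathConnectedSpace A] (q : A → ℂ[X]) (d : ℕ)
    (hm : ∀ y, (q y).Monic ∧ (q y).natDegree = d) (hs : ∀ y, (q y).roots.Nodup)
    (hc : ∀ z, Continuous fun y => (q y).eval z) :
    ∃ Z : Fin d → A → ℂ, (∀ i, Continuous (Z i)) ∧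
      ∀ y, q y = ∏ i, (X - C (Z i y)) := by
  rcases eq_or_ne d 0 with rfl | hd0
  · refine ⟨fun _ _ => 0, fun i => i.elim0, fun y => ?_⟩
    simp only [Finset.univ_eq_empty, Finset.prod_empty]
    exact (hm y).1.natDegree_eq_zero.1 (hm y).2
  have cov := isCoveringMap_roots q d hd0 hm hs hc
  obtain ⟨y0⟩ : Nonempty A := inferInstance
  have hcard : (q y0).roots.toFinset.card = d := by
    rw [Multiset.toFinset_card_of_nodup (hs y0), ← (hm y0).2]
    exact (IsAlgClosed.splits _).natDegree_eq_card_roots.symm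
  let e := (Finset.equivFinOfCardEq hcard).symm
  have he : ∀ i, (q y0).eval (e i : ℂ) = 0 := by
    intro i
    have := (e i).2
    rw [Multiset.mem_toFinset, mem_roots (hm y0).1.ne_zero] at this
    exact this
  have hl := fun i => (cov.existsUnique_continuousMap_lifts (ContinuousMap.id A) y0
    ⟨(y0, e i), he i⟩ rfl).exists
  choose F hF1 hF2 using hl
  have hF3 : ∀ i y, (F i y).1.1 = y := fun i y => congrFun (hF2 i) y
  have hroot : ∀ i y, (q y).eval (F i y).1.2 = 0 := by
    intro i y
    have := (F i y).2
    rwa [hF3] at this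
  have hinj : ∀ y, Function.Injective (fun i => (F i y).1.2) := by
    intro y i j hij
    have h1 : F i y = F j y := by
      apply Subtype.ext
      exact Prod.ext ((hF3 i y).trans (hF3 j y).symm) hij
    have h2 := cov.eq_of_comp_eq (F i).continuous (F j).continuous
      ((hF2 i).trans (hF2 j).symm) y h1
    have h3 := congrFun h2 y0
    rw [hF1, hF1] at h3
    exact e.injective (Subtype.ext (congrArg (fun t => t.1.2) h3))
  refine ⟨fun i y => (F i y).1.2, fun i => by fun_prop, fun y => ?_⟩
  have hsub : Finset.univ.image (fun i => (F i y).1.2) ⊆ (q y).roots.toFinset := by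
    intro z hz
    simp only [Finset.mem_image, Finset.mem_univ, true_and] at hz
    obtain ⟨i, rfl⟩ := hz
    rw [Multiset.mem_toFinset, mem_roots (hm y).1.ne_zero]
    exact hroot i y
  have heq := Finset.eq_of_subset_of_card_le hsub (by
    rw [Finset.card_image_of_injective _ (hinj y), Finset.card_fin]
    refine (Multiset.toFinset_card_le _).trans ((card_roots' _).trans (hm y).2.le))
  conv_lhs => rw [(IsAlgClosed.splits (q y)).eq_prod_roots_of_monic (hm y).1]
  have h4 : (q y).roots = (Finset.univ.image (fun i => (F i y).1.2)).val := by
    rw [heq, Multiset.toFinset_val, (hs y).dedup]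
  rw [h4, Finset.image_val_of_injOn (hinj y).injOn]
  rw [Multiset.map_map]
  rfl

end LPD


namespace LPD
open Polynomial Filter Topology

lemma hasDerivAt_mul_of_zero {G K : ℂ → ℂ} {g w0 : ℂ} (hG : HasDerivAt G g w0) (h0 : G w0 = 0)
    (hK : ContinuousAt K w0) : HasDerivAt (fun w => G w * K w) (g * K w0) w0 := by
  rw [hasDerivAt_iff_tendsto_slope] at hG ⊢
  have h1 : Tendsto K (𝓝[≠] w0) (𝓝 (K w0)) := hK.tendsto.mono_left nhdsWithin_le_nhds
  refine (hG.mul h1).congr fun w => ?_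
  simp only [slope_def_field, h0]
  ring

lemma eval_prod_roots {d : ℕ} (Z : Fin d → ℂ) (z : ℂ) :
    (∏ i, (X - C (Z i))).eval z = ∏ i, (z - Z i) := by
  simp [eval_prod]

lemma root_differentiableOn {d : ℕ} (H : Set ℂ) (hH : IsOpen H) (c : ℂ → ℂ[X]) (Z : Fin d → ℂ → ℂ)
    (hZ : ∀ i, ContinuousOn (Z i) H) (hc : ∀ w ∈ H, c w = ∏ i, (X - C (Z i w)))
    (hd : ∀ z, DifferentiableOn ℂ (fun w => (c w).eval z) H)
    (hinj : ∀ w ∈ H, Function.Injective (fun i => Z i w)) (i : Fin d) :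
    DifferentiableOn ℂ (Z i) H := by
  intro w0 hw0
  have hn : H ∈ 𝓝 w0 := hH.mem_nhds hw0
  set z0 := Z i w0 with hz0
  have hG : DifferentiableAt ℂ (fun w => (c w).eval z0) w0 := (hd z0).differentiableAt hn
  have hG0 : (c w0).eval z0 = 0 := by
    rw [hc w0 hw0, eval_prod_roots]
    exact Finset.prod_eq_zero (Finset.mem_univ i) (by simp [hz0])
  set R : ℂ → ℂ := fun w => ∏ j ∈ Finset.univ.erase i, (z0 - Z j w) with hR
  have hRc : ContinuousAt R w0 := by
    apply tendsto_finsetProd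
    intro j _
    exact tendsto_const_nhds.sub ((hZ j).continuousAt hn)
  have hR0 : R w0 ≠ 0 := by
    rw [hR]
    simp only
    rw [Finset.prod_ne_zero_iff]
    intro j hj h
    have : i = j := hinj w0 hw0 (sub_eq_zero.1 h)
    exact (Finset.ne_of_mem_erase hj) this.symm
  have h1 := hasDerivAt_mul_of_zero hG.hasDerivAt hG0 (hRc.inv₀ hR0)
  have h2 := h1.const_sub z0
  have h3 : Z i =ᶠ[𝓝 w0] fun w => z0 - (c w).eval z0 * (R w)⁻¹ := by
    filter_upwards [hn, hRc.eventually_ne hR0] with w hw hRw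
    rw [hc w hw, eval_prod_roots, ← Finset.mul_prod_erase _ _ (Finset.mem_univ i)]
    change _ = z0 - (z0 - Z i w) * R w * (R w)⁻¹
    field_simp
    ring
  exact (h2.congr_of_eventuallyEq h3).differentiableAt.differentiableWithinAt

lemma root_bound (q : ℂ[X]) (d : ℕ) (hm : q.Monic) (hd : q.natDegree = d) (z : ℂ)
    (hz : q.eval z = 0) : ‖z‖ ≤ 1 + ∑ k ∈ Finset.range d, ‖q.coeff k‖ := by
  have hS : 0 ≤ ∑ k ∈ Finset.range d, ‖q.coeff k‖ := Finset.sum_nonneg fun _ _ => norm_nonneg _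
  by_contra hcon
  push Not at hcon
  have h1 : 1 < ‖z‖ := by linarith
  rw [eval_eq_sum_range, hd, Finset.sum_range_succ, ← hd, hm.coeff_natDegree, hd, one_mul] at hz
  have hz2 : z ^ d = - ∑ k ∈ Finset.range d, q.coeff k * z ^ k := by linear_combination hz
  rcases Nat.eq_zero_or_pos d with h0 | h0
  · subst h0; simp at hz2
  have h2 : ‖z‖ ^ d ≤ (∑ k ∈ Finset.range d, ‖q.coeff k‖) * ‖z‖ ^ (d - 1) := by
    rw [← norm_pow, hz2, norm_neg, Finset.sum_mul]
    refine (norm_sum_le _ _).trans (Finset.sum_le_sum fun k hk => ?_)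
    rw [norm_mul, norm_pow]
    gcongr
    · exact h1.le
    · have := Finset.mem_range.1 hk; omega
  have h3 : ‖z‖ ^ d = ‖z‖ * ‖z‖ ^ (d - 1) := by
    rw [← pow_succ']; congr 1; omega
  rw [h3] at h2
  have := le_of_mul_le_mul_right h2 (by positivity)
  linarith

lemma unique_index {A : Type*} [TopologicalSpace A] [PreconnectedSpace A] [Nonempty A] {d : ℕ}
    (Z : Fin d → A → ℂ) (hZ : ∀ i, Continuous (Z i))
    (hinj : ∀ y, Function.Injective (fun i => Z i y)) (g : A → ℂ) (hg : Continuous g)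
    (h : ∀ y, ∃ i, g y = Z i y) : ∃ i, ∀ y, g y = Z i y := by
  obtain ⟨y0⟩ : Nonempty A := inferInstance
  obtain ⟨i, hi⟩ := h y0
  have hcl : ∀ j, IsClosed {y | g y = Z j y} := fun j => isClosed_eq hg (hZ j)
  have hop : IsOpen {y | g y = Z i y} := by
    rw [← isClosed_compl_iff]
    have : {y | g y = Z i y}ᶜ = ⋃ j ∈ (Finset.univ.erase i : Finset (Fin d)), {y | g y = Z j y} := by
      ext y
      simp only [Set.mem_compl_iff, Set.mem_ofPred_eq, Finset.mem_erase, Finset.mem_univ, and_true,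
        Set.mem_iUnion, exists_prop]
      constructor
      · intro hne
        obtain ⟨j, hj⟩ := h y
        exact ⟨j, fun hji => hne (hji ▸ hj), hj⟩
      · rintro ⟨j, hji, hj⟩ hyi
        exact hji (hinj y (hj.symm.trans hyi))
    rw [this]
    exact isClosed_biUnion_finset fun j _ => hcl j
  have := IsClopen.eq_univ ⟨hcl i, hop⟩ ⟨y0, hi⟩
  exact ⟨i, fun y => by have h1 : y ∈ {y | g y = Z i y} := by rw [this]; trivial
                        exact h1⟩

lemma inj_of_nodup {d : ℕ} (q : ℂ[X]) (Z : Fin d → ℂ) (h : q = ∏ i, (X - C (Z i)))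
    (hs : q.roots.Nodup) : Function.Injective Z := by
  have h1 : q.roots = Finset.univ.val.map Z := by
    rw [h, Polynomial.roots_prod _ _ (Finset.prod_ne_zero_iff.2 fun i _ => X_sub_C_ne_zero _)]
    simp only [roots_X_sub_C, Multiset.bind_singleton]
  rw [h1] at hs
  intro i j hij
  exact Multiset.inj_on_of_nodup_map hs i (Finset.mem_univ_val i) j (Finset.mem_univ_val j) hij

/-- root functions on the (log of) the punctured disc -/
lemma log_roots (q : ℝ → ℂ → ℂ[X]) (d : ℕ) (ε : ℝ) (hε : 0 < ε)
    (hm : ∀ x t, ‖t‖ < ε → (q x t).Monic ∧ (q x t).natDegree = d)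
    (hs : ∀ x t, t ≠ 0 → ‖t‖ < ε → (q x t).roots.Nodup)
    (hcoef : ∀ k, ContinuousOn (fun y : ℝ × ℂ => (q y.1 y.2).coeff k) {y | ‖y.2‖ < ε})
    (hdiff : ∀ k x, DifferentiableOn ℂ (fun t => (q x t).coeff k) {t | ‖t‖ < ε}) :
    ∃ (Z : Fin d → ℝ × ℂ → ℂ) (σ : Equiv.Perm (Fin d)),
      (∀ i, ContinuousOn (Z i) {y | y.2.re < Real.log ε}) ∧
      (∀ i x, DifferentiableOn ℂ (fun w => Z i (x, w)) {w | w.re < Real.log ε}) ∧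
      (∀ x w, w.re < Real.log ε → q x (Complex.exp w) = ∏ i, (X - C (Z i (x, w)))) ∧
      (∀ i x w, w.re < Real.log ε →
        Z i (x, w + 2 * Real.pi * Complex.I) = Z (σ i) (x, w)) := by
  set U : Set (ℝ × ℂ) := {y | y.2.re < Real.log ε} with hU
  have hUc : Convex ℝ U := by
    have : U = (Complex.reLm ∘ₗ LinearMap.snd ℝ ℝ ℂ) ⁻¹' Set.Iio (Real.log ε) := rfl
    rw [this]
    exact (convex_Iio _).linear_preimage _
  have hUo : IsOpen U := isOpen_lt (by fun_prop) continuous_const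
  have hUne : U.Nonempty := ⟨(0, ((Real.log ε - 1 : ℝ) : ℂ)), by simp [hU]⟩
  have hexp : ∀ w : ℂ, w.re < Real.log ε → ‖Complex.exp w‖ < ε := by
    intro w hw
    rw [Complex.norm_exp]
    exact (Real.lt_log_iff_exp_lt hε).1 hw
  have := hUc.contractibleSpace hUne
  have : LocallyPathConnectedSpace U := hUc.locallyPathConnectedSpace
  have : Nonempty U := hUne.to_subtype
  have hev : ∀ x t z, ‖t‖ < ε → (q x t).eval z = ∑ k ∈ Finset.range (d + 1), (q x t).coeff k * z ^ k := by
    intro x t z ht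
    rw [eval_eq_sum_range, (hm x t ht).2]
  have hc1 : ∀ z, ContinuousOn (fun y : ℝ × ℂ => (q y.1 (Complex.exp y.2)).eval z) U := by
    intro z
    have h1 : ContinuousOn (fun y : ℝ × ℂ => ∑ k ∈ Finset.range (d + 1),
        (q y.1 (Complex.exp y.2)).coeff k * z ^ k) U := by
      apply continuousOn_finsetSum
      intro k _
      refine ContinuousOn.mul ?_ continuousOn_const
      exact (hcoef k).comp (f := fun y : ℝ × ℂ => (y.1, Complex.exp y.2))
        (by fun_prop) (fun y hy => hexp _ hy)
    exact h1.congr fun y hy => hev _ _ _ (hexp _ hy)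
  obtain ⟨Z0, hZ0c, hZ0⟩ := exists_root_functions (A := U)
    (fun y => q y.1.1 (Complex.exp y.1.2)) d (fun y => hm _ _ (hexp _ y.2))
    (fun y => hs _ _ (Complex.exp_ne_zero _) (hexp _ y.2))
    (fun z => (hc1 z).domRestrict)
  have hinj0 : ∀ y, Function.Injective (fun i => Z0 i y) := fun y =>
    inj_of_nodup _ _ (hZ0 y) (hs _ _ (Complex.exp_ne_zero _) (hexp _ y.2))
  classical
  set Z : Fin d → ℝ × ℂ → ℂ := fun i y => if h : y ∈ U then Z0 i ⟨y, h⟩ else 0 with hZdef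
  have hZ : ∀ i (y : U), Z i y = Z0 i y := by
    intro i y
    simp only [hZdef, dif_pos y.2]
  have hZc : ∀ i, ContinuousOn (Z i) U := by
    intro i
    rw [continuousOn_iff_continuous_domRestrict]
    convert hZ0c i using 1
    ext y; exact hZ i y
  have hZp : ∀ x w, w.re < Real.log ε → q x (Complex.exp w) = ∏ i, (X - C (Z i (x, w))) := by
    intro x w hw
    have := hZ0 ⟨(x, w), hw⟩
    simp only at this
    rw [this]
    refine Finset.prod_congr rfl fun i _ => ?_
    rw [← hZ]
  have hinj : ∀ x w, w.re < Real.log ε → Function.Injective (fun i => Z i (x, w)) := by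
    intro x w hw
    exact inj_of_nodup _ _ (hZp x w hw) (hs _ _ (Complex.exp_ne_zero _) (hexp _ hw))
  have hsh : ∀ y : U, (y.1.1, y.1.2 + 2 * Real.pi * Complex.I) ∈ U := by
    intro y
    have := y.2
    simp only [hU, Set.mem_ofPred_eq] at this ⊢
    simpa using this
  have hσ : ∀ i, ∃ j, ∀ y : U, Z i (y.1.1, y.1.2 + 2 * Real.pi * Complex.I) = Z0 j y := by
    intro i
    apply unique_index Z0 hZ0c hinj0
    · exact (hZc i).comp_continuous (by fun_prop) hsh
    · intro y
      have h1 := hZp y.1.1 (y.1.2 + 2 * Real.pi * Complex.I) (hsh y)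
      have h2 := hZ0 y
      rw [Complex.exp_add, Complex.exp_two_pi_mul_I, mul_one, h2] at h1
      have h3 := congrArg (eval (Z i (y.1.1, y.1.2 + 2 * Real.pi * Complex.I))) h1
      rw [eval_prod_roots, eval_prod_roots] at h3
      have h4 := h3.trans (Finset.prod_eq_zero (Finset.mem_univ i) (sub_self _))
      obtain ⟨j, -, hj⟩ := Finset.prod_eq_zero_iff.1 h4
      exact ⟨j, sub_eq_zero.1 hj⟩
  choose σ hσ using hσ
  have hσinj : Function.Injective σ := by
    intro i j hij
    obtain ⟨y⟩ : Nonempty U := inferInstance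
    have h1 := hσ i y
    rw [hij, ← hσ j y] at h1
    exact hinj y.1.1 (y.1.2 + 2 * Real.pi * Complex.I) (hsh y) h1
  refine ⟨Z, Equiv.ofBijective σ (Finite.injective_iff_bijective.1 hσinj), hZc, ?_, hZp, ?_⟩
  · intro i x
    refine root_differentiableOn {w | w.re < Real.log ε} (isOpen_lt (by fun_prop) continuous_const)
      (fun w => q x (Complex.exp w)) (fun i w => Z i (x, w)) ?_ (fun w hw => hZp x w hw) ?_
      (fun w hw => hinj x w hw) i
    · intro j
      exact (hZc j).comp (f := fun w : ℂ => (x, w)) (by fun_prop) (fun w hw => hw)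
    · intro z
      have h1 : DifferentiableOn ℂ (fun w => ∑ k ∈ Finset.range (d + 1),
          (q x (Complex.exp w)).coeff k * z ^ k) {w | w.re < Real.log ε} := by
        apply DifferentiableOn.fun_sum
        intro k _
        refine DifferentiableOn.mul_const ?_ _
        exact (hdiff k x).comp (f := fun w => Complex.exp w)
          (Complex.differentiable_exp.differentiableOn) (fun w hw => hexp _ hw)
      exact h1.congr fun w hw => hev _ _ _ (hexp _ hw)
  · intro i x w hw
    have := hσ i ⟨(x, w), hw⟩
    rw [← hZ] at this
    exact this

end LPD


namespace LPD
open Polynomial Filter Topology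

lemma puiseux (q : ℝ → ℂ → ℂ[X]) (d : ℕ) (ε : ℝ) (hε : 0 < ε)
    (hm : ∀ x t, ‖t‖ < ε → (q x t).Monic ∧ (q x t).natDegree = d)
    (hs : ∀ x t, t ≠ 0 → ‖t‖ < ε → (q x t).roots.Nodup)
    (hcoef : ∀ k, ContinuousOn (fun y : ℝ × ℂ => (q y.1 y.2).coeff k) {y | ‖y.2‖ < ε})
    (hdiff : ∀ k x, DifferentiableOn ℂ (fun t => (q x t).coeff k) {t | ‖t‖ < ε}) :
    ∃ (N : ℕ) (δ : ℝ) (Z : Fin d → ℝ → ℂ → ℂ) (σ : Equiv.Perm (Fin d)),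
      0 < N ∧ 0 < δ ∧ δ ≤ 1 ∧ δ ≤ ε ∧
      (∀ x τ, ‖τ‖ < δ → q x (τ ^ N) = ∏ i, (X - C (Z i x τ))) ∧
      (∀ i x, DifferentiableOn ℂ (Z i x) (Metric.ball 0 δ)) ∧
      (∀ i, ContinuousOn (fun y : ℝ × ℂ => Z i y.1 y.2) {y | y.2 ≠ 0 ∧ ‖y.2‖ < δ}) ∧
      (∀ i x τ, ‖τ‖ < δ → Z i x (Complex.exp (2 * Real.pi * Complex.I / N) * τ) = Z (σ i) x τ) := by
  obtain ⟨Z, σ, hZc, hZd, hZp, hZσ⟩ := log_roots q d ε hε hm hs hcoef hdiff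
  set N := orderOf σ with hN
  have hN0 : 0 < N := orderOf_pos σ
  have hNC : (N : ℂ) ≠ 0 := by exact_mod_cast hN0.ne'
  set δ := min 1 (ε / 2) with hδ
  have hδ0 : 0 < δ := lt_min one_pos (half_pos hε)
  have hδ1 : δ ≤ 1 := min_le_left _ _
  have hδ2 : δ ≤ ε / 2 := min_le_right _ _
  have hδ3 : δ ≤ ε := by linarith
  have hre : ∀ u : ℂ, ‖Complex.exp u‖ < δ → ((N : ℂ) * u).re < Real.log ε := by
    intro u hu
    rw [Complex.norm_exp] at hu
    have h1 : u.re < Real.log δ := (Real.lt_log_iff_exp_lt hδ0).2 hu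
    have h2 : Real.log δ ≤ 0 := Real.log_nonpos hδ0.le hδ1
    have h3 : Real.log δ ≤ Real.log ε := Real.log_le_log hδ0 hδ3
    have h4 : (1 : ℝ) ≤ N := by exact_mod_cast hN0
    have h5 : ((N : ℂ) * u).re = N * u.re := by simp
    rw [h5]
    nlinarith
  have hpow : ∀ (k : ℕ) i x w, w.re < Real.log ε →
      Z i (x, w + k * (2 * Real.pi * Complex.I)) = Z ((σ ^ k) i) (x, w) := by
    intro k
    induction k with
    | zero => intro i x w hw; simp
    | succ k ih =>
      intro i x w hw
      have h1 : w + ((k + 1 : ℕ) : ℂ) * (2 * Real.pi * Complex.I) =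
        (w + k * (2 * Real.pi * Complex.I)) + 2 * Real.pi * Complex.I := by push_cast; ring
      have h2 : (w + k * (2 * Real.pi * Complex.I)).re < Real.log ε := by simpa using hw
      rw [h1, hZσ i x _ h2, ih _ _ _ hw, pow_succ, Equiv.Perm.mul_apply]
  have hperN : ∀ (k : ℕ) i x w, w.re < Real.log ε →
      Z i (x, w + k * (N * (2 * Real.pi * Complex.I))) = Z i (x, w) := by
    intro k i x w hw
    have := hpow (N * k) i x w hw
    rw [pow_mul, hN, pow_orderOf_eq_one, one_pow, Equiv.Perm.one_apply] at this
    rw [← this]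
    congr 3
    push_cast; ring
  have hper : ∀ (n : ℤ) i x w, w.re < Real.log ε →
      Z i (x, w + n * (N * (2 * Real.pi * Complex.I))) = Z i (x, w) := by
    intro n i x w hw
    obtain ⟨k, rfl | rfl⟩ := n.eq_nat_or_neg
    · exact_mod_cast hperN k i x w hw
    · have := hperN k i x (w + ((-(k : ℤ) : ℤ) : ℂ) * (N * (2 * Real.pi * Complex.I))) (by simpa using hw)
      rw [← this]
      congr 2
      push_cast; ring
  set W : Fin d → ℝ → ℂ → ℂ := fun i x τ => Z i (x, N * Complex.log τ) with hW
  have hWu : ∀ i x u, ‖Complex.exp u‖ < δ → W i x (Complex.exp u) = Z i (x, N * u) := by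
    intro i x u hu
    obtain ⟨n, hn⟩ := Complex.exp_eq_exp_iff_exists_int.1
      (Complex.exp_log (Complex.exp_ne_zero u))
    simp only [hW]
    rw [hn, ← hper n i x (N * u) (hre u hu)]
    congr 2
    ring
  -- local branch
  have hbr : ∀ τ0 : ℂ, τ0 ≠ 0 → ∃ L : ℂ → ℂ, DifferentiableAt ℂ L τ0 ∧ ∀ τ, τ ≠ 0 → Complex.exp (L τ) = τ := by
    intro τ0 h0
    refine ⟨fun τ => Complex.log (τ / τ0) + Complex.log τ0, ?_, ?_⟩
    · refine DifferentiableAt.add_const _ ?_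
      refine DifferentiableAt.clog (by fun_prop) ?_
      rw [div_self h0]; simp
    · intro τ hτ
      rw [Complex.exp_add, Complex.exp_log (div_ne_zero hτ h0), Complex.exp_log h0]
      field_simp
  have hUo : IsOpen {y : ℝ × ℂ | y.2.re < Real.log ε} := isOpen_lt (by fun_prop) continuous_const
  have hUo' : IsOpen {w : ℂ | w.re < Real.log ε} := isOpen_lt (by fun_prop) continuous_const
  have hWdiff : ∀ i x τ, τ ≠ 0 → ‖τ‖ < δ → DifferentiableAt ℂ (W i x) τ := by
    intro i x τ hτ hτδ
    obtain ⟨L, hL, hexp⟩ := hbr τ hτ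
    have h1 : W i x =ᶠ[𝓝 τ] fun τ' => Z i (x, N * L τ') := by
      have : {τ' : ℂ | τ' ≠ 0 ∧ ‖τ'‖ < δ} ∈ 𝓝 τ :=
        (isOpen_ne.inter (isOpen_lt continuous_norm continuous_const)).mem_nhds ⟨hτ, hτδ⟩
      filter_upwards [this] with τ' hτ'
      have h2 := hWu i x (L τ') (by rw [hexp _ hτ'.1]; exact hτ'.2)
      rwa [hexp _ hτ'.1] at h2
    refine DifferentiableAt.congr_of_eventuallyEq ?_ h1
    have h3 := hre (L τ) (by rwa [hexp _ hτ])
    exact ((hZd i x).differentiableAt (hUo'.mem_nhds h3)).comp (f := fun τ' => N * L τ') τ (by fun_prop)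
  have hWcont : ∀ i, ContinuousOn (fun y : ℝ × ℂ => W i y.1 y.2) {y | y.2 ≠ 0 ∧ ‖y.2‖ < δ} := by
    rintro i ⟨x, τ⟩ ⟨hτ, hτδ⟩
    apply ContinuousAt.continuousWithinAt
    obtain ⟨L, hL, hexp⟩ := hbr τ hτ
    simp only at hτ hτδ
    have h1 : (fun y : ℝ × ℂ => W i y.1 y.2) =ᶠ[𝓝 (x, τ)] fun y => Z i (y.1, N * L y.2) := by
      have : {y : ℝ × ℂ | y.2 ≠ 0 ∧ ‖y.2‖ < δ} ∈ 𝓝 (x, τ) :=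
        ((isOpen_ne.preimage continuous_snd).inter
          (isOpen_lt (continuous_norm.comp continuous_snd) continuous_const)).mem_nhds ⟨hτ, hτδ⟩
      filter_upwards [this] with y hτ'
      have h2 := hWu i y.1 (L y.2) (by rw [hexp _ hτ'.1]; exact hτ'.2)
      rwa [hexp _ hτ'.1] at h2
    refine ContinuousAt.congr ?_ h1.symm
    have h3 := hre (L τ) (by rwa [hexp _ hτ])
    have hLc := hL.continuousAt
    refine ContinuousAt.comp (f := fun y : ℝ × ℂ => (y.1, N * L y.2)) (g := Z i)
      ((hZc i).continuousAt (hUo.mem_nhds h3)) ?_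
    refine ContinuousAt.prodMk continuousAt_fst ?_
    exact continuousAt_const.mul (ContinuousAt.comp (f := fun y : ℝ × ℂ => y.2) (g := L) hLc continuousAt_snd)
  have hWp : ∀ x τ, τ ≠ 0 → ‖τ‖ < δ → q x (τ ^ N) = ∏ i, (X - C (W i x τ)) := by
    intro x τ hτ hτδ
    have h := hZp x (N * Complex.log τ) (hre _ (by rwa [Complex.exp_log hτ]))
    rwa [Complex.exp_nat_mul, Complex.exp_log hτ] at h
  have hpowlt : ∀ τ : ℂ, ‖τ‖ < δ → ‖τ ^ N‖ < δ := by
    intro τ h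
    rw [norm_pow]
    exact (pow_le_of_le_one (norm_nonneg _) (h.le.trans hδ1) hN0.ne').trans_lt h
  have hWb : ∀ i x, BddAbove (norm ∘ W i x '' (Metric.ball 0 δ \ {0})) := by
    intro i x
    have hcb : ∀ k, ∃ B, ∀ t : ℂ, ‖t‖ ≤ δ → ‖(q x t).coeff k‖ ≤ B := by
      intro k
      have h1 : ContinuousOn (fun t => (q x t).coeff k) (Metric.closedBall 0 δ) :=
        (hdiff k x).continuousOn.mono fun t ht => by
          simp at ht ⊢; linarith
      obtain ⟨B, hB⟩ := (isCompact_closedBall (0 : ℂ) δ).exists_bound_of_continuousOn h1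
      exact ⟨B, fun t ht => hB t (by simpa using ht)⟩
    choose B hB using hcb
    refine ⟨1 + ∑ k ∈ Finset.range d, B k, ?_⟩
    rintro _ ⟨τ, ⟨hτδ, hτ⟩, rfl⟩
    have hτ0 : τ ≠ 0 := hτ
    have hτδ' : ‖τ‖ < δ := by simpa using hτδ
    have hle := hpowlt τ hτδ'
    obtain ⟨hm1, hm2⟩ := hm x (τ ^ N) (by linarith)
    refine (root_bound _ d hm1 hm2 (W i x τ) ?_).trans ?_
    · rw [hWp x τ hτ0 hτδ', eval_prod_roots]
      exact Finset.prod_eq_zero (Finset.mem_univ i) (sub_self _)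
    · gcongr with k hk
      exact hB k _ hle.le
  set F : Fin d → ℝ → ℂ → ℂ := fun i x => Function.update (W i x) 0 (limUnder (𝓝[≠] 0) (W i x)) with hF
  have hFW : ∀ i x τ, τ ≠ 0 → F i x τ = W i x τ := by
    intro i x τ hτ
    simp only [hF]
    exact Function.update_of_ne hτ _ _
  have hFd : ∀ i x, DifferentiableOn ℂ (F i x) (Metric.ball 0 δ) := by
    intro i x
    refine Complex.differentiableOn_update_limUnder_of_bddAbove (Metric.ball_mem_nhds 0 hδ0) ?_ (hWb i x)
    rintro τ ⟨hτδ, hτ⟩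
    exact (hWdiff i x τ hτ (by simpa using hτδ)).differentiableWithinAt
  have hFc0 : ∀ i x, ContinuousAt (F i x) 0 := fun i x =>
    (hFd i x).continuousOn.continuousAt (Metric.ball_mem_nhds 0 hδ0)
  have hnear : ∀ᶠ τ : ℂ in 𝓝[≠] 0, τ ≠ 0 ∧ ‖τ‖ < δ := by
    have : Metric.ball (0 : ℂ) δ ∈ 𝓝[≠] 0 := nhdsWithin_le_nhds (Metric.ball_mem_nhds 0 hδ0)
    filter_upwards [this, self_mem_nhdsWithin] with τ h1 h2
    exact ⟨h2, by simpa using h1⟩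
  refine ⟨N, δ, F, σ, hN0, hδ0, hδ1, hδ3, ?_, hFd, ?_, ?_⟩
  · intro x τ hτδ
    by_cases hτ : τ = 0
    · subst hτ
      refine Polynomial.funext fun z => ?_
      rw [eval_prod_roots, zero_pow hN0.ne']
      have h1 : Tendsto (fun τ => ∏ i, (z - F i x τ)) (𝓝[≠] 0) (𝓝 (∏ i, (z - F i x 0))) := by
        refine tendsto_finsetProd _ fun i _ => ?_
        exact tendsto_const_nhds.sub ((hFc0 i x).tendsto.mono_left nhdsWithin_le_nhds)
      have h2 : Tendsto (fun τ : ℂ => (q x (τ ^ N)).eval z) (𝓝[≠] 0) (𝓝 ((q x 0).eval z)) := by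
        have h3 : ∀ t, ‖t‖ < ε → (q x t).eval z = ∑ k ∈ Finset.range (d + 1), (q x t).coeff k * z ^ k := by
          intro t ht
          rw [eval_eq_sum_range, (hm x t ht).2]
        rw [h3 0 (by simpa using hε)]
        have h4 : Tendsto (fun τ : ℂ => ∑ k ∈ Finset.range (d + 1), (q x (τ ^ N)).coeff k * z ^ k)
            (𝓝[≠] 0) (𝓝 (∑ k ∈ Finset.range (d + 1), (q x 0).coeff k * z ^ k)) := by
          refine tendsto_finsetSum _ fun k _ => Tendsto.mul_const _ ?_
          have h5 : ContinuousAt (fun t => (q x t).coeff k) 0 :=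
            (hdiff k x).continuousOn.continuousAt ((isOpen_lt continuous_norm continuous_const).mem_nhds
              (by simpa using hε))
          refine h5.tendsto.comp ?_
          have h6 : Tendsto (fun τ : ℂ => τ ^ N) (𝓝 0) (𝓝 (0 ^ N)) := (continuous_pow N).tendsto 0
          rw [zero_pow hN0.ne'] at h6
          exact h6.mono_left nhdsWithin_le_nhds
        refine h4.congr' ?_
        filter_upwards [hnear] with τ hτ
        rw [h3]
        exact (hpowlt τ hτ.2).trans_le hδ3
      refine tendsto_nhds_unique h2 (h1.congr' ?_)
      filter_upwards [hnear] with τ hτ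
      rw [hWp x τ hτ.1 hτ.2, eval_prod_roots]
      exact Finset.prod_congr rfl fun i _ => by rw [hFW _ _ _ hτ.1]
    · rw [hWp x τ hτ hτδ]
      exact Finset.prod_congr rfl fun i _ => by rw [hFW _ _ _ hτ]
  · intro i
    exact (hWcont i).congr fun y hy => hFW _ _ _ hy.1
  · intro i x τ hτδ
    set ω := Complex.exp (2 * Real.pi * Complex.I / N) with hω
    have hω1 : ‖ω‖ = 1 := by
      rw [hω, Complex.norm_exp]
      have : (2 * Real.pi * Complex.I / N : ℂ).re = 0 := by
        simp [Complex.div_re]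
      rw [this, Real.exp_zero]
    have hne : ∀ τ : ℂ, τ ≠ 0 → ‖τ‖ < δ → F i x (ω * τ) = F (σ i) x τ := by
      intro τ h0 h1
      rw [hFW _ _ _ h0, hFW _ _ _ (mul_ne_zero (Complex.exp_ne_zero _) h0)]
      have h2 : ω * τ = Complex.exp (2 * Real.pi * Complex.I / N + Complex.log τ) := by
        rw [Complex.exp_add, Complex.exp_log h0]
      have h3 : ‖ω * τ‖ < δ := by rw [norm_mul, hω1, one_mul]; exact h1
      have h4 := hWu i x (2 * Real.pi * Complex.I / N + Complex.log τ) (by rw [← h2]; exact h3)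
      rw [h2, h4]
      simp only [hW]
      rw [← hZσ i x _ (hre (Complex.log τ) (by rwa [Complex.exp_log h0]))]
      congr 2
      field_simp
      ring
    by_cases hτ : τ = 0
    · subst hτ
      have h1 : Tendsto (fun τ => F i x (ω * τ)) (𝓝[≠] 0) (𝓝 (F i x (ω * 0))) := by
        have h2 : ContinuousAt (fun τ => F i x (ω * τ)) 0 := by
          refine ContinuousAt.comp (g := F i x) (f := fun τ => ω * τ) ?_ (by fun_prop)
          simpa using hFc0 i x
        exact h2.tendsto.mono_left nhdsWithin_le_nhds
      refine tendsto_nhds_unique h1 ?_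
      refine ((hFc0 (σ i) x).tendsto.mono_left nhdsWithin_le_nhds).congr' ?_
      filter_upwards [hnear] with τ hτ
      exact (hne τ hτ.1 hτ.2).symm
    · exact hne τ hτ hτδ

end LPD


namespace LPD
open Polynomial Filter Topology Asymptotics

lemma max_mod (g : ℂ → ℂ) (δ r : ℝ) (hr : 0 < r) (hrδ : r < δ)
    (hd : DifferentiableOn ℂ g (Metric.ball 0 δ \ {0}))
    (hb : g =O[𝓝[≠] 0] (fun _ => (1 : ℂ))) (D : ℝ) (hD : ∀ τ : ℂ, ‖τ‖ = r → ‖g τ‖ ≤ D)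
    (τ : ℂ) (hτ : τ ≠ 0) (hτr : ‖τ‖ ≤ r) : ‖g τ‖ ≤ D := by
  have hδ : 0 < δ := hr.trans hrδ
  have h1 := Complex.differentiableOn_update_limUnder_of_isLittleO (Metric.ball_mem_nhds (0 : ℂ) hδ) hd
    (by
      have h2 : (fun z => g z - g 0) =O[𝓝[≠] 0] (fun _ => (1 : ℂ)) :=
        hb.sub (isBigO_const_const _ one_ne_zero _)
      refine h2.trans_isLittleO ?_
      rw [isLittleO_const_left]
      right
      simpa [Function.comp_def] using tendsto_norm_inv_nhdsNE_zero_atTop (α := ℂ))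
  set G := Function.update g 0 (limUnder (𝓝[≠] 0) g) with hG
  have hGg : ∀ z, z ≠ 0 → G z = g z := fun z hz => Function.update_of_ne hz _ _
  rw [← hGg τ hτ]
  refine Complex.norm_le_of_forall_mem_frontier_norm_le (U := Metric.ball (0 : ℂ) r) Metric.isBounded_ball
    ?_ ?_ ?_
  · refine (h1.mono ?_).diffContOnCl
    rw [closure_ball _ hr.ne']
    exact Metric.closedBall_subset_ball hrδ
  · intro z hz
    rw [frontier_ball _ hr.ne'] at hz
    have hz' : ‖z‖ = r := by simpa using hz
    rw [hGg z (by rintro rfl; simp at hz'; exact hr.ne hz')]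
    exact hD z hz'
  · rw [closure_ball _ hr.ne']
    simpa using hτr

lemma circle_close (g : ℝ → ℂ → ℂ) (δ r : ℝ) (hr : 0 < r) (hrδ : r < δ)
    (hc : ContinuousOn (fun y : ℝ × ℂ => g y.1 y.2) {y | y.2 ≠ 0 ∧ ‖y.2‖ < δ}) (x0 : ℝ)
    (η : ℝ) (hη : 0 < η) : ∀ᶠ x in 𝓝 x0, ∀ τ : ℂ, ‖τ‖ = r → ‖g x τ - g x0 τ‖ < η := by
  have hop : IsOpen {y : ℝ × ℂ | y.2 ≠ 0 ∧ ‖y.2‖ < δ} :=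
    (isOpen_ne.preimage continuous_snd).inter
          (isOpen_lt (continuous_norm.comp continuous_snd) continuous_const)
  have := (isCompact_sphere (0 : ℂ) r).eventually_forall_of_forall_eventually (x₀ := x0)
    (P := fun x τ => ‖g x τ - g x0 τ‖ < η) ?_
  · filter_upwards [this] with x hx τ hτ
    exact hx τ (by simpa using hτ)
  · intro τ hτ
    have hτ' : ‖τ‖ = r := by simpa using hτ
    have hmem : (x0, τ) ∈ {y : ℝ × ℂ | y.2 ≠ 0 ∧ ‖y.2‖ < δ} :=
      ⟨by rintro h; simp only at h; rw [h] at hτ'; simp at hτ'; exact hr.ne hτ', by simpa [hτ'] using hrδ⟩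
    have h1 : ContinuousAt (fun y : ℝ × ℂ => g y.1 y.2) (x0, τ) := hc.continuousAt (hop.mem_nhds hmem)
    have h2 : ContinuousAt (fun y : ℝ × ℂ => g x0 y.2) (x0, τ) := by
      refine ContinuousAt.comp (g := fun y : ℝ × ℂ => g y.1 y.2) (f := fun y : ℝ × ℂ => (x0, y.2))
        (x := (x0, τ)) h1 (by fun_prop)
    have h3 := (h1.sub h2).norm
    have h4 : ‖g x0 τ - g x0 τ‖ < η := by simpa using hη
    exact h3.eventually (gt_mem_nhds h4)

lemma bdd_closed (g : ℝ → ℂ → ℂ) (δ : ℝ) (hδ : 0 < δ)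
    (hd : ∀ x, DifferentiableOn ℂ (g x) (Metric.ball 0 δ \ {0}))
    (hc : ContinuousOn (fun y : ℝ × ℂ => g y.1 y.2) {y | y.2 ≠ 0 ∧ ‖y.2‖ < δ}) :
    IsClosed {x | g x =O[𝓝[≠] 0] (fun _ => (1 : ℂ))} := by
  rw [isClosed_iff_frequently]
  intro x0 hx0
  have hr : 0 < δ / 2 := half_pos hδ
  have hrδ : δ / 2 < δ := half_lt_self hδ
  have hop : IsOpen {y : ℝ × ℂ | y.2 ≠ 0 ∧ ‖y.2‖ < δ} :=
    (isOpen_ne.preimage continuous_snd).inter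
          (isOpen_lt (continuous_norm.comp continuous_snd) continuous_const)
  obtain ⟨B, hB⟩ := (isCompact_sphere (0 : ℂ) (δ / 2)).exists_bound_of_continuousOn (f := g x0)
    ((hd x0).continuousOn.mono (by
      intro z hz
      have hz' : ‖z‖ = δ / 2 := by simpa using hz
      refine ⟨by simpa [hz'] using hrδ, ?_⟩
      rintro h
      rw [Set.mem_singleton_iff.1 h] at hz'
      simp at hz'; exact hr.ne hz'))
  have hcl := circle_close g δ (δ / 2) hr hrδ hc x0 1 one_pos
  have hbd : ∀ τ : ℂ, τ ≠ 0 → ‖τ‖ ≤ δ / 2 → ‖g x0 τ‖ ≤ B + 1 := by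
    intro τ hτ hτr
    have hfr : ∃ᶠ x in 𝓝 x0, ‖g x τ‖ ≤ B + 1 := by
      refine (hx0.and_eventually hcl).mono ?_
      rintro x ⟨hx1, hx2⟩
      refine max_mod (g x) δ (δ / 2) hr hrδ (hd x) hx1 (B + 1) ?_ τ hτ hτr
      intro z hz
      have h1 := hx2 z hz
      have h2 := hB z (by simpa using hz)
      calc ‖g x z‖ = ‖g x0 z + (g x z - g x0 z)‖ := by congr 1; ring
        _ ≤ ‖g x0 z‖ + ‖g x z - g x0 z‖ := norm_add_le _ _
        _ ≤ B + 1 := by linarith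
    have hcx : ContinuousAt (fun x => g x τ) x0 := by
      have h1 : ContinuousAt (fun y : ℝ × ℂ => g y.1 y.2) (x0, τ) :=
        hc.continuousAt (hop.mem_nhds ⟨hτ, by simp only; linarith⟩)
      exact ContinuousAt.comp (g := fun y : ℝ × ℂ => g y.1 y.2) (f := fun x : ℝ => (x, τ))
        (x := x0) h1 (by fun_prop)
    by_contra hcon
    push Not at hcon
    have := hcx.norm.eventually (lt_mem_nhds hcon)
    exact hfr (this.mono fun x hx => not_le.2 hx)
  refine IsBigO.of_bound (B + 1) ?_
  have : Metric.ball (0 : ℂ) (δ / 2) ∈ 𝓝[≠] 0 := nhdsWithin_le_nhds (Metric.ball_mem_nhds 0 hr)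
  filter_upwards [this, self_mem_nhdsWithin] with τ h1 h2
  have h3 : ‖τ‖ < δ / 2 := by simpa using h1
  simpa using hbd τ h2 h3.le

lemma powO {a b : ℕ} (h : b ≤ a) : (fun τ : ℂ => τ ^ a) =O[𝓝[≠] 0] (fun τ => τ ^ b) := by
  rcases h.eq_or_lt with rfl | h
  · exact isBigO_refl _ _
  · exact (isLittleO_pow_pow h).isBigO.mono nhdsWithin_le_nhds

lemma not_powO {a b : ℕ} (h : (fun τ : ℂ => τ ^ a) =O[𝓝[≠] 0] (fun τ => τ ^ b)) : b ≤ a := by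
  by_contra hc
  push Not at hc
  have h1 : (fun τ : ℂ => τ ^ b) =o[𝓝[≠] 0] fun τ => τ ^ a := (isLittleO_pow_pow hc).mono nhdsWithin_le_nhds
  have h2 := h.trans_isLittleO h1
  have h3 := isLittleO_irrefl (l := 𝓝[≠] (0 : ℂ)) (f'' := fun τ : ℂ => τ ^ a) ?_
  · exact h3 h2
  · have : ∀ᶠ τ : ℂ in 𝓝[≠] 0, τ ^ a ≠ 0 := by
      filter_upwards [self_mem_nhdsWithin] with τ hτ
      exact pow_ne_zero _ hτ
    exact this.frequently

/-- exact order of an analytic germ -/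
lemma exact_order (f : ℂ → ℂ) (hf : AnalyticAt ℂ f 0) :
    (∀ᶠ τ in 𝓝 0, f τ = 0) ∨ ∃ (k : ℕ) (u : ℂ → ℂ), AnalyticAt ℂ u 0 ∧ u 0 ≠ 0 ∧
      (∀ᶠ τ in 𝓝 0, f τ = τ ^ k * u τ) ∧ f =O[𝓝[≠] 0] (fun τ => τ ^ k) ∧
      (fun τ : ℂ => τ ^ k) =O[𝓝[≠] 0] f := by
  by_cases h : ∀ᶠ τ in 𝓝 0, f τ = 0
  · exact Or.inl h
  right
  obtain ⟨k, u, hu, hu0, hfu⟩ := hf.exists_eventuallyEq_pow_smul_nonzero_iff.2 h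
  simp only [sub_zero, smul_eq_mul] at hfu
  refine ⟨k, u, hu, hu0, hfu, ?_, ?_⟩
  · have h1 : u =O[𝓝[≠] 0] (fun _ => (1 : ℂ)) :=
      (hu.continuousAt.tendsto.isBigO_one ℂ).mono nhdsWithin_le_nhds
    have h2 := (isBigO_refl (fun τ : ℂ => τ ^ k) (𝓝[≠] 0)).mul h1
    simp only [mul_one] at h2
    exact h2.congr' (EventuallyEq.symm (hfu.filter_mono nhdsWithin_le_nhds)) (EventuallyEq.refl _ _)
  · have h1 : (fun τ => (u τ)⁻¹) =O[𝓝[≠] 0] (fun _ => (1 : ℂ)) :=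
      ((hu.continuousAt.inv₀ hu0).tendsto.isBigO_one ℂ).mono nhdsWithin_le_nhds
    have h2 := (isBigO_refl f (𝓝[≠] 0)).mul h1
    simp only [mul_one] at h2
    refine h2.congr' ?_ (EventuallyEq.refl _ _)
    filter_upwards [hfu.filter_mono nhdsWithin_le_nhds,
      (hu.continuousAt.eventually_ne hu0).filter_mono nhdsWithin_le_nhds] with τ h3 h4
    rw [h3]; field_simp

lemma order_const (f : ℝ → ℂ → ℂ) (δ : ℝ) (hδ : 0 < δ)
    (hd : ∀ x, DifferentiableOn ℂ (f x) (Metric.ball 0 δ))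
    (hc : ContinuousOn (fun y : ℝ × ℂ => f y.1 y.2) {y | y.2 ≠ 0 ∧ ‖y.2‖ < δ})
    (h0 : ∀ x τ, τ ≠ 0 → ‖τ‖ < δ → f x τ ≠ 0) (n : ℕ) (x x' : ℝ)
    (h : f x =O[𝓝[≠] 0] fun τ => τ ^ n) : f x' =O[𝓝[≠] 0] fun τ => τ ^ n := by
  have han : ∀ x, AnalyticAt ℂ (f x) 0 := fun x => (hd x).analyticAt (Metric.ball_mem_nhds 0 hδ)
  have hmem : Metric.ball (0 : ℂ) δ ∈ 𝓝[≠] 0 := nhdsWithin_le_nhds (Metric.ball_mem_nhds 0 hδ)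
  have hne : ∀ x, ∀ᶠ τ in 𝓝[≠] (0 : ℂ), f x τ ≠ 0 := by
    intro x
    filter_upwards [hmem, self_mem_nhdsWithin] with τ h1 h2
    exact h0 x τ h2 (by simpa using h1)
  have hsub : Metric.ball (0 : ℂ) δ \ {0} ⊆ Metric.ball 0 δ := Set.sdiff_subset
  rcases Nat.eq_zero_or_pos n with rfl | hn
  · simpa using ((han x').continuousAt.tendsto.isBigO_one ℂ).mono nhdsWithin_le_nhds
  set A := {x | f x =O[𝓝[≠] 0] fun τ => τ ^ n} with hA
  have hA1 : A = {x | (fun τ => f x τ / τ ^ n) =O[𝓝[≠] 0] (fun _ => (1 : ℂ))} := by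
    ext x
    simp only [hA, Set.mem_ofPred_eq]
    constructor
    · intro h
      have := h.mul (isBigO_refl (fun τ : ℂ => (τ ^ n)⁻¹) (𝓝[≠] 0))
      refine this.congr' (Eventually.of_forall fun τ => by simp [div_eq_mul_inv]) ?_
      filter_upwards [self_mem_nhdsWithin] with τ hτ
      exact mul_inv_cancel₀ (pow_ne_zero _ hτ)
    · intro h
      have := h.mul (isBigO_refl (fun τ : ℂ => (τ ^ n)) (𝓝[≠] 0))
      refine this.congr' ?_ (Eventually.of_forall fun τ => by simp)
      filter_upwards [self_mem_nhdsWithin] with τ hτ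
      exact div_mul_cancel₀ _ (pow_ne_zero _ hτ)
  have hA2 : Aᶜ = {x | (fun τ => τ ^ (n - 1) / f x τ) =O[𝓝[≠] 0] (fun _ => (1 : ℂ))} := by
    have key : ∀ x, (fun τ => τ ^ (n - 1) / f x τ) =O[𝓝[≠] 0] (fun _ => (1 : ℂ)) ↔
        (fun τ : ℂ => τ ^ (n - 1)) =O[𝓝[≠] 0] f x := by
      intro x
      constructor
      · intro h
        have := h.mul (isBigO_refl (f x) (𝓝[≠] 0))
        refine this.congr' ?_ (Eventually.of_forall fun τ => by simp)
        filter_upwards [hne x] with τ hτ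
        exact div_mul_cancel₀ _ hτ
      · intro h
        have := h.mul (isBigO_refl (fun τ => (f x τ)⁻¹) (𝓝[≠] 0))
        refine this.congr' (Eventually.of_forall fun τ => by simp [div_eq_mul_inv]) ?_
        filter_upwards [hne x] with τ hτ
        exact mul_inv_cancel₀ hτ
    ext x
    simp only [hA, Set.mem_compl_iff, Set.mem_ofPred_eq]
    rw [key]
    rcases exact_order (f x) (han x) with h1 | ⟨k, u, -, -, -, h2, h3⟩
    · exfalso
      obtain ⟨τ, h4, h5⟩ := ((h1.filter_mono nhdsWithin_le_nhds).and (hne x)).exists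
      exact h5 h4
    · constructor
      · intro h4
        have h5 : k < n := by
          by_contra h6
          exact h4 (h2.trans (powO (not_lt.1 h6)))
        exact (powO (by omega)).trans h3
      · intro h4 h5
        have h6 := not_powO (h3.trans h5)
        have h7 := not_powO (h4.trans h2)
        omega
  have hcl1 : IsClosed A := by
    rw [hA1]
    refine bdd_closed (fun x τ => f x τ / τ ^ n) δ hδ ?_ ?_
    · intro x
      refine ((hd x).mono hsub).fun_div (by fun_prop) ?_
      rintro τ ⟨-, hτ⟩
      exact pow_ne_zero _ hτ
    · refine hc.div (by fun_prop) ?_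
      rintro y ⟨hy, -⟩
      exact pow_ne_zero _ hy
  have hcl2 : IsClosed Aᶜ := by
    rw [hA2]
    refine bdd_closed (fun x τ => τ ^ (n - 1) / f x τ) δ hδ ?_ ?_
    · intro x
      refine DifferentiableOn.fun_div (by fun_prop) ((hd x).mono hsub) ?_
      rintro τ ⟨hτδ, hτ⟩
      exact h0 x τ hτ (by simpa using hτδ)
    · refine ContinuousOn.div (by fun_prop) hc ?_
      rintro y ⟨hy, hy2⟩
      exact h0 _ _ hy hy2
  have hclo : IsClopen A := ⟨hcl1, isClosed_compl_iff.1 hcl2⟩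
  have := hclo.eq_univ ⟨x, h⟩
  have h2 : x' ∈ A := this ▸ Set.mem_univ x'
  exact h2

lemma cont_zero (f : ℝ → ℂ → ℂ) (δ : ℝ) (hδ : 0 < δ)
    (hd : ∀ x, DifferentiableOn ℂ (f x) (Metric.ball 0 δ))
    (hc : ContinuousOn (fun y : ℝ × ℂ => f y.1 y.2) {y | y.2 ≠ 0 ∧ ‖y.2‖ < δ}) :
    Continuous (fun x => f x 0) := by
  rw [continuous_iff_continuousAt]
  intro x0
  rw [Metric.continuousAt_iff']
  intro η hη
  have hr : 0 < δ / 2 := half_pos hδ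
  have hrδ : δ / 2 < δ := half_lt_self hδ
  filter_upwards [circle_close f δ (δ / 2) hr hrδ hc x0 (η / 2) (half_pos hη)] with x hx
  rw [dist_eq_norm]
  have : ‖(fun τ => f x τ - f x0 τ) 0‖ ≤ η / 2 := by
    refine Complex.norm_le_of_forall_mem_frontier_norm_le (f := fun τ => f x τ - f x0 τ)
      (U := Metric.ball (0 : ℂ) (δ / 2)) (z := 0) Metric.isBounded_ball ?_ ?_ ?_
    · refine (((hd x).fun_sub (hd x0)).mono ?_).diffContOnCl
      rw [closure_ball _ hr.ne']
      exact Metric.closedBall_subset_ball hrδ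
    · intro z hz
      rw [frontier_ball _ hr.ne'] at hz
      exact (hx z (by simpa using hz)).le
    · exact subset_closure (Metric.mem_ball_self hr)
  simp only at this
  linarith

lemma rot_order (g : ℂ → ℂ) (hg : AnalyticAt ℂ g 0) (N : ℕ) (hN : 0 < N) (δ : ℝ) (hδ : 0 < δ)
    (hω : ∀ τ, ‖τ‖ < δ → g (Complex.exp (2 * Real.pi * Complex.I / N) * τ) = g τ) (h0 : g 0 = 0) :
    g =O[𝓝[≠] 0] fun τ => τ ^ N := by
  set ω := Complex.exp (2 * Real.pi * Complex.I / N) with hωd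
  have hprim := Complex.isPrimitiveRoot_exp N hN.ne'
  rcases exact_order g hg with h1 | ⟨k, u, hu, hu0, hfu, h2, h3⟩
  · refine IsBigO.of_bound 0 ?_
    filter_upwards [h1.filter_mono nhdsWithin_le_nhds] with τ hτ
    simp [hτ]
  · have hωt : Tendsto (fun τ => ω * τ) (𝓝 0) (𝓝 0) := by
      have : Tendsto (fun τ => ω * τ) (𝓝 0) (𝓝 (ω * 0)) := (continuous_const_mul ω).tendsto 0
      simpa using this
    have hev : ∀ᶠ τ in 𝓝[≠] (0 : ℂ), ω ^ k * u (ω * τ) = u τ := by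
      have hb : Metric.ball (0 : ℂ) δ ∈ 𝓝[≠] 0 := nhdsWithin_le_nhds (Metric.ball_mem_nhds 0 hδ)
      filter_upwards [hfu.filter_mono nhdsWithin_le_nhds,
        (hωt.eventually hfu).filter_mono nhdsWithin_le_nhds, hb, self_mem_nhdsWithin] with τ a1 a2 a3 a4
      have h5 := hω τ (by simpa using a3)
      rw [a1, a2, mul_pow] at h5
      have a5 : τ ^ k ≠ 0 := pow_ne_zero _ a4
      apply mul_left_cancel₀ a5
      rw [← h5]; ring
    have ht1 : Tendsto (fun τ => ω ^ k * u (ω * τ)) (𝓝[≠] 0) (𝓝 (ω ^ k * u 0)) :=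
      ((hu.continuousAt.tendsto.comp hωt).mono_left nhdsWithin_le_nhds).const_mul _
    have ht2 : Tendsto u (𝓝[≠] 0) (𝓝 (u 0)) := hu.continuousAt.tendsto.mono_left nhdsWithin_le_nhds
    have heq := tendsto_nhds_unique (ht1.congr' hev) ht2
    have hk1 : ω ^ k = 1 := by
      have : ω ^ k * u 0 = 1 * u 0 := by rw [heq, one_mul]
      exact mul_right_cancel₀ hu0 this
    have hdvd : N ∣ k := (hprim.pow_eq_one_iff_dvd k).1 hk1
    have hk0 : k ≠ 0 := by
      rintro rfl
      have := hfu.self_of_nhds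
      rw [h0] at this
      simp at this
      exact hu0 this.symm
    exact h2.trans (powO (Nat.le_of_dvd (Nat.pos_of_ne_zero hk0) hdvd))

lemma trunc_order (g : ℂ → ℂ) (hg : AnalyticAt ℂ g 0) (N : ℕ) :
    ∃ n ≤ N, g =O[𝓝[≠] 0] (fun τ => τ ^ n) ∧
      (fun τ : ℂ => τ ^ n) =O[𝓝[≠] 0] (fun τ => ‖g τ‖ + ‖τ‖ ^ N) := by
  have hNle : (fun τ : ℂ => τ ^ N) =O[𝓝[≠] 0] (fun τ => ‖g τ‖ + ‖τ‖ ^ N) := by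
    refine IsBigO.of_bound' (Eventually.of_forall fun τ => ?_)
    rw [norm_pow, Real.norm_of_nonneg (by positivity)]
    linarith [norm_nonneg (g τ)]
  rcases exact_order g hg with h1 | ⟨k, u, -, -, -, h2, h3⟩
  · refine ⟨N, le_rfl, ?_, hNle⟩
    refine IsBigO.of_bound 0 ?_
    filter_upwards [h1.filter_mono nhdsWithin_le_nhds] with τ hτ
    simp [hτ]
  · by_cases hk : k ≤ N
    · refine ⟨k, hk, h2, h3.trans ?_⟩
      refine IsBigO.of_bound' (Eventually.of_forall fun τ => ?_)
      rw [Real.norm_of_nonneg (by positivity)]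
      linarith [pow_nonneg (norm_nonneg τ) N]
    · exact ⟨N, le_rfl, h2.trans (powO (by omega)), hNle⟩

end LPD


namespace LPD
open Polynomial Filter Topology Asymptotics

def BB (q : ℂ → ℂ[X]) (ζ : ℂ) (μ : ℕ) : Prop :=
  (fun t : ℝ => ((q t).roots.map (fun z => ‖z - ζ‖ + t)).prod) =O[𝓝[>] 0] fun t => t ^ μ

lemma roots_prod_eq {d : ℕ} (Z : Fin d → ℂ) : (∏ i, (X - C (Z i))).roots = Finset.univ.val.map Z := by
  rw [Polynomial.roots_prod _ _ (Finset.prod_ne_zero_iff.2 fun i _ => X_sub_C_ne_zero _)]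
  simp only [roots_X_sub_C, Multiset.bind_singleton]

lemma tendsto_ofReal_pos : Tendsto (fun τ : ℝ => (τ : ℂ)) (𝓝[>] 0) (𝓝[≠] 0) := by
  rw [tendsto_nhdsWithin_iff]
  constructor
  · have : Tendsto (fun τ : ℝ => (τ : ℂ)) (𝓝 0) (𝓝 ((0 : ℝ) : ℂ)) := Complex.continuous_ofReal.tendsto 0
    rw [Complex.ofReal_zero] at this
    exact this.mono_left nhdsWithin_le_nhds
  · filter_upwards [self_mem_nhdsWithin] with τ hτ
    have : (0 : ℝ) < τ := hτ
    simpa using this.ne'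

lemma BB_iff (q : ℂ → ℂ[X]) (d N : ℕ) (hN : 0 < N) (δ : ℝ) (hδ : 0 < δ) (Z : Fin d → ℂ → ℂ)
    (hq : ∀ τ, ‖τ‖ < δ → q (τ ^ N) = ∏ i, (X - C (Z i τ))) (ζ : ℂ) (μ : ℕ) :
    BB q ζ μ ↔ (fun τ : ℝ => ∏ i, (‖Z i τ - ζ‖ + ‖(τ : ℂ)‖ ^ N)) =O[𝓝[>] 0] fun τ : ℝ => τ ^ (N * μ) := by
  have hsmall : ∀ᶠ τ : ℝ in 𝓝[>] 0, 0 < τ ∧ τ < δ := by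
    filter_upwards [Ioo_mem_nhdsGT hδ] with τ hτ
    exact hτ
  have hexpr : ∀ τ : ℝ, 0 < τ → τ < δ →
      ((q ((τ ^ N : ℝ) : ℂ)).roots.map (fun z => ‖z - ζ‖ + τ ^ N)).prod =
        ∏ i, (‖Z i τ - ζ‖ + ‖(τ : ℂ)‖ ^ N) := by
    intro τ h0 h1
    have h2 : ‖(τ : ℂ)‖ = τ := by rw [Complex.norm_real, Real.norm_of_nonneg h0.le]
    rw [Complex.ofReal_pow, hq τ (by rw [h2]; exact h1), roots_prod_eq, Multiset.map_map, h2]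
    rfl
  constructor
  · intro h
    have ht : Tendsto (fun τ : ℝ => τ ^ N) (𝓝[>] 0) (𝓝[>] 0) := by
      rw [tendsto_nhdsWithin_iff]
      constructor
      · have : Tendsto (fun τ : ℝ => τ ^ N) (𝓝 0) (𝓝 (0 ^ N)) := (continuous_pow N).tendsto 0
        rw [zero_pow hN.ne'] at this
        exact this.mono_left nhdsWithin_le_nhds
      · filter_upwards [self_mem_nhdsWithin] with τ hτ
        have h3 : (0 : ℝ) < τ := hτ
        exact Set.mem_Ioi.2 (pow_pos h3 N)
    refine (h.comp_tendsto ht).congr' ?_ ?_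
    · filter_upwards [hsmall] with τ hτ
      exact hexpr τ hτ.1 hτ.2
    · exact Eventually.of_forall fun τ => by simp [pow_mul]
  · intro h
    have ht : Tendsto (fun t : ℝ => t ^ ((N : ℝ)⁻¹)) (𝓝[>] 0) (𝓝[>] 0) := by
      rw [tendsto_nhdsWithin_iff]
      constructor
      · have : Tendsto (fun t : ℝ => t ^ ((N : ℝ)⁻¹)) (𝓝 0) (𝓝 (0 ^ ((N : ℝ)⁻¹))) :=
          (Real.continuousAt_rpow_const 0 _ (Or.inr (by positivity))).tendsto
        rw [Real.zero_rpow (by positivity)] at this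
        exact this.mono_left nhdsWithin_le_nhds
      · filter_upwards [self_mem_nhdsWithin] with τ hτ
        exact Real.rpow_pos_of_pos hτ _
    have hpow : ∀ t : ℝ, 0 < t → (t ^ ((N : ℝ)⁻¹)) ^ N = t := fun t h0 =>
      Real.rpow_inv_natCast_pow h0.le hN.ne'
    refine (h.comp_tendsto ht).congr' ?_ ?_
    · filter_upwards [ht.eventually hsmall, self_mem_nhdsWithin] with t h1 h2
      have := hexpr _ h1.1 h1.2
      rw [hpow t h2] at this
      exact this.symm
    · filter_upwards [self_mem_nhdsWithin] with t h2
      simp only [Function.comp, pow_mul]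
      rw [hpow t h2]

lemma not_powO_real {a b : ℕ} (h : (fun τ : ℝ => τ ^ a) =O[𝓝[>] 0] (fun τ => τ ^ b)) : b ≤ a := by
  by_contra hc
  push Not at hc
  have h1 : (fun τ : ℝ => τ ^ b) =o[𝓝[>] 0] fun τ => τ ^ a := (isLittleO_pow_pow hc).mono nhdsWithin_le_nhds
  have h2 := h.trans_isLittleO h1
  have h3 := isLittleO_irrefl (l := 𝓝[>] (0 : ℝ)) (f'' := fun τ : ℝ => τ ^ a) ?_
  · exact h3 h2
  · have : ∀ᶠ τ : ℝ in 𝓝[>] 0, τ ^ a ≠ 0 := by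
      filter_upwards [self_mem_nhdsWithin] with τ hτ
      exact pow_ne_zero _ (ne_of_gt hτ)
    exact this.frequently

lemma zero_of_O (g : ℂ → ℂ) (hg : ContinuousAt g 0) (n : ℕ) (hn : 0 < n)
    (h : g =O[𝓝[≠] 0] fun τ => τ ^ n) : g 0 = 0 := by
  have h1 : Tendsto (fun τ : ℂ => τ ^ n) (𝓝[≠] 0) (𝓝 0) := by
    have : Tendsto (fun τ : ℂ => τ ^ n) (𝓝 0) (𝓝 (0 ^ n)) := (continuous_pow n).tendsto 0
    rw [zero_pow hn.ne'] at this
    exact this.mono_left nhdsWithin_le_nhds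
  exact tendsto_nhds_unique (hg.tendsto.mono_left nhdsWithin_le_nhds) (h.trans_tendsto h1)

lemma transfer (q : ℝ → ℂ → ℂ[X]) (d : ℕ) (ε : ℝ) (hε : 0 < ε)
    (hm : ∀ x t, ‖t‖ < ε → (q x t).Monic ∧ (q x t).natDegree = d)
    (hs : ∀ x t, t ≠ 0 → ‖t‖ < ε → (q x t).roots.Nodup)
    (hcoef : ∀ k, ContinuousOn (fun y : ℝ × ℂ => (q y.1 y.2).coeff k) {y | ‖y.2‖ < ε})
    (hdiff : ∀ k x, DifferentiableOn ℂ (fun t => (q x t).coeff k) {t | ‖t‖ < ε}) :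
    ∃ Y : Fin d → ℝ → ℂ, (∀ i, Continuous (Y i)) ∧ (∀ x, q x 0 = ∏ i, (X - C (Y i x))) ∧
      (∀ i j x x', Y i x = Y j x → Y i x' = Y j x') ∧
      (∀ i x x' μ, BB (q x) (Y i x) μ → BB (q x') (Y i x') μ) := by
  obtain ⟨N, δ, Z, σ, hN, hδ, hδ1, hδε, hZp, hZd, hZc, hZσ⟩ := puiseux q d ε hε hm hs hcoef hdiff
  have hZan : ∀ i x, AnalyticAt ℂ (Z i x) 0 := fun i x =>
    (hZd i x).analyticAt (Metric.ball_mem_nhds 0 hδ)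
  have hinj : ∀ x τ, τ ≠ 0 → ‖τ‖ < δ → Function.Injective (fun i => Z i x τ) := by
    intro x τ h0 h1
    refine inj_of_nodup _ _ (hZp x τ h1) (hs x _ (pow_ne_zero _ h0) ?_)
    rw [norm_pow]
    exact ((pow_le_of_le_one (norm_nonneg _) (h1.le.trans hδ1) hN.ne').trans_lt h1).trans_le hδε
  have htr : ∀ i j n x x', (fun τ => Z i x τ - Z j x τ) =O[𝓝[≠] 0] (fun τ => τ ^ n) →
      (fun τ => Z i x' τ - Z j x' τ) =O[𝓝[≠] 0] (fun τ => τ ^ n) := by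
    intro i j n x x' h
    by_cases hij : i = j
    · subst hij
      simp only [sub_self]
      exact isBigO_zero _ _
    · refine order_const (fun x τ => Z i x τ - Z j x τ) δ hδ (fun x => (hZd i x).fun_sub (hZd j x))
        ((hZc i).sub (hZc j)) ?_ n x x' h
      intro x τ h0 h1 h2
      exact hij (hinj x τ h0 h1 (sub_eq_zero.1 h2))
  have hYeq : ∀ i j x x', Z i x 0 = Z j x 0 → Z i x' 0 = Z j x' 0 := by
    intro i j x x' h
    have hO : (fun τ => Z i x τ - Z j x τ) =O[𝓝[≠] 0] (fun τ => τ ^ 1) := by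
      have han := (hZan i x).sub (hZan j x)
      have h1 := han.differentiableAt.isBigO_sub.mono (nhdsWithin_le_nhds (s := {0}ᶜ))
      simpa [h] using h1
    have h2 := zero_of_O (fun τ => Z i x' τ - Z j x' τ)
      ((hZan i x').continuousAt.sub (hZan j x').continuousAt) 1 one_pos (htr i j 1 x x' hO)
    exact sub_eq_zero.1 h2
  refine ⟨fun i x => Z i x 0, fun i => cont_zero (Z i) δ hδ (hZd i) (hZc i), ?_, hYeq, ?_⟩
  · intro x
    have := hZp x 0 (by simpa using hδ)
    rwa [zero_pow hN.ne'] at this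
  · intro i0 x x' μ hB
    rw [BB_iff (q x) d N hN δ hδ (fun i => Z i x) (hZp x)] at hB
    rw [BB_iff (q x') d N hN δ hδ (fun i => Z i x') (hZp x')]
    set α := Z i0 x 0 with hα
    set β := Z i0 x' 0 with hβ
    have hex : ∀ i, ∃ n ≤ N, (fun τ => Z i x τ - α) =O[𝓝[≠] 0] (fun τ => τ ^ n) ∧
      (fun τ : ℂ => τ ^ n) =O[𝓝[≠] 0] (fun τ => ‖Z i x τ - α‖ + ‖τ‖ ^ N) := fun i =>
      trunc_order (fun τ => Z i x τ - α) ((hZan i x).sub analyticAt_const) N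
    choose n hnN hnO hnO' using hex
    have hsum : N * μ ≤ ∑ i, n i := by
      apply not_powO_real
      refine IsBigO.trans ?_ hB
      have h1 : ∀ i ∈ Finset.univ, (fun τ : ℝ => τ ^ n i) =O[𝓝[>] 0]
          (fun τ : ℝ => ‖Z i x τ - α‖ + ‖(τ : ℂ)‖ ^ N) := by
        intro i _
        have h2 := (hnO' i).comp_tendsto tendsto_ofReal_pos
        refine IsBigO.trans (IsBigO.of_bound' (Eventually.of_forall fun τ => ?_)) h2
        simp
      have h3 := IsBigO.finsetProd h1
      simpa [Finset.prod_pow_eq_pow_sum] using h3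
    have hrot : ∀ (x : ℝ) i τ, ‖τ‖ < δ →
        Z i x (Complex.exp (2 * Real.pi * Complex.I / N) * τ) = Z (σ i) x τ := fun x i τ => hZσ i x τ
    set ω := Complex.exp (2 * Real.pi * Complex.I / N) with hω
    have hωn : ‖ω‖ = 1 := Complex.norm_eq_one_of_pow_eq_one
      (Complex.isPrimitiveRoot_exp N hN.ne').pow_eq_one hN.ne'
    have hω0 : ω ≠ 0 := Complex.exp_ne_zero _
    have hωt : Tendsto (fun τ => ω * τ) (𝓝[≠] 0) (𝓝[≠] 0) := by
      rw [tendsto_nhdsWithin_iff]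
      constructor
      · have : Tendsto (fun τ => ω * τ) (𝓝 0) (𝓝 (ω * 0)) := (continuous_const_mul ω).tendsto 0
        rw [mul_zero] at this
        exact this.mono_left nhdsWithin_le_nhds
      · filter_upwards [self_mem_nhdsWithin] with τ hτ
        exact mul_ne_zero hω0 hτ
    have hmain : ∀ i, (fun τ => Z i x' τ - β) =O[𝓝[≠] 0] (fun τ => τ ^ n i) := by
      intro i
      rcases Nat.eq_zero_or_pos (n i) with h0 | hpos
      · rw [h0]
        simpa using (((hZan i x').continuousAt.sub continuousAt_const).tendsto.isBigO_one ℂ).mono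
          nhdsWithin_le_nhds
      classical
      set K : Finset (Fin d) := Finset.univ.filter
        (fun j => (fun τ => Z j x τ - α) =O[𝓝[≠] 0] (fun τ => τ ^ n i)) with hK
      have hiK : i ∈ K := by simp [hK, hnO i]
      have hKσ : ∀ j ∈ K, σ j ∈ K := by
        intro j hj
        simp only [hK, Finset.mem_filter, Finset.mem_univ, true_and] at hj ⊢
        have h1 := hj.comp_tendsto hωt
        have hb : Metric.ball (0 : ℂ) δ ∈ 𝓝[≠] 0 := nhdsWithin_le_nhds (Metric.ball_mem_nhds 0 hδ)
        have h2 : (fun τ => Z (σ j) x τ - α) =ᶠ[𝓝[≠] 0] (fun τ => Z j x τ - α) ∘ (fun τ => ω * τ) := by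
          filter_upwards [hb] with τ hτ
          simp only [Function.comp]
          rw [hrot x j τ (by simpa using hτ)]
        refine h2.trans_isBigO (h1.trans (IsBigO.of_bound' (Eventually.of_forall fun τ => ?_)))
        simp [hωn]
      have hKimg : K.image σ = K := by
        apply Finset.eq_of_subset_of_card_le
        · intro j hj
          obtain ⟨j', h1, rfl⟩ := Finset.mem_image.1 hj
          exact hKσ j' h1
        · rw [Finset.card_image_of_injective _ σ.injective]
      have hcard : (K.card : ℂ) ≠ 0 := by
        exact_mod_cast (Finset.card_pos.2 ⟨i, hiK⟩).ne'
      have hdiffO : ∀ j ∈ K, (fun τ => Z i x' τ - Z j x' τ) =O[𝓝[≠] 0] (fun τ => τ ^ n i) := by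
        intro j hj
        apply htr i j (n i) x x'
        simp only [hK, Finset.mem_filter, Finset.mem_univ, true_and] at hj
        have := (hnO i).sub hj
        simpa using this
      have hi0 : Z i x' 0 = β := by
        apply hYeq i i0 x x'
        have := zero_of_O (fun τ => Z i x τ - α) ((hZan i x).continuousAt.sub continuousAt_const)
          (n i) hpos (hnO i)
        exact sub_eq_zero.1 this
      have hj0 : ∀ j ∈ K, Z j x' 0 = β := by
        intro j hj
        have := zero_of_O (fun τ => Z i x' τ - Z j x' τ)
          ((hZan i x').continuousAt.sub (hZan j x').continuousAt)
          (n i) hpos (hdiffO j hj)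
        rw [← hi0]
        exact (sub_eq_zero.1 this).symm
      have hS : (fun τ => ∑ j ∈ K, (Z j x' τ - β)) =O[𝓝[≠] 0] (fun τ => τ ^ N) := by
        refine rot_order _ ?_ N hN δ hδ ?_ ?_
        · refine Finset.analyticAt_fun_sum _ fun j _ => (hZan j x').sub analyticAt_const
        · intro τ hτ
          rw [← hω]
          conv_rhs => rw [← hKimg]
          rw [Finset.sum_image (fun a _ b _ h => σ.injective h)]
          exact Finset.sum_congr rfl fun j _ => by rw [hrot x' j τ hτ]
        · exact Finset.sum_eq_zero fun j hj => by rw [hj0 j hj, sub_self]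
      have hT : (fun τ => ∑ j ∈ K, (Z i x' τ - Z j x' τ)) =O[𝓝[≠] 0] (fun τ => τ ^ n i) := by
        exact IsBigO.fun_sum hdiffO
      have hfin := ((hS.trans (powO (hnN i))).add hT).const_mul_left ((K.card : ℂ)⁻¹)
      refine hfin.congr_left fun τ => ?_
      rw [← Finset.sum_add_distrib]
      have : ∀ j ∈ K, (Z j x' τ - β + (Z i x' τ - Z j x' τ)) = Z i x' τ - β := fun j _ => by ring
      rw [Finset.sum_congr rfl this, Finset.sum_const, nsmul_eq_mul]
      field_simp
    have h1 : ∀ i ∈ Finset.univ, (fun τ : ℝ => ‖Z i x' τ - β‖ + ‖(τ : ℂ)‖ ^ N) =O[𝓝[>] 0]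
        (fun τ : ℝ => τ ^ n i) := by
      intro i _
      have h2 := ((hmain i).norm_left.add (powO (hnN i)).norm_left).comp_tendsto tendsto_ofReal_pos
      refine IsBigO.trans (IsBigO.of_bound' (Eventually.of_forall fun τ => ?_))
        (h2.trans (IsBigO.of_bound' (Eventually.of_forall fun τ => ?_)))
      · simp
      · simp
    have h3 := IsBigO.finsetProd h1
    simp only [Finset.prod_pow_eq_pow_sum] at h3
    refine h3.trans ?_
    rcases hsum.eq_or_lt with h4 | h4
    · rw [h4]; exact isBigO_refl _ _
    · exact (isLittleO_pow_pow h4).isBigO.mono nhdsWithin_le_nhds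

end LPD


namespace LPD
open Polynomial Filter Topology Asymptotics

lemma le_ordAt_iff {E : Type*} [NormedAddCommGroup E] [NormedSpace ℝ E] (f : E → ℝ) (v : E) (μ : ℕ) :
    (μ : ℕ∞) ≤ ordAt f v ↔ ∀ k < μ, iteratedFDeriv ℝ k f v = 0 := by
  unfold ordAt
  rw [le_sInf_iff]
  constructor
  · intro h k hk
    by_contra hne
    have := h k ⟨k, rfl, hne⟩
    exact absurd (Nat.cast_le.1 this) (not_le.2 hk)
  · rintro h b ⟨n, rfl, hn⟩
    rw [Nat.cast_le]
    by_contra hc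
    exact hn (h n (not_le.1 hc))

lemma tendsto_smul_zero {E : Type*} [NormedAddCommGroup E] [NormedSpace ℝ E] (h : E) :
    Tendsto (fun t : ℝ => t • h) (𝓝[>] 0) (𝓝 0) := by
  have : Tendsto (fun t : ℝ => t • h) (𝓝 0) (𝓝 ((0 : ℝ) • h)) :=
    (by fun_prop : Continuous (fun t : ℝ => t • h)).tendsto 0
  rw [zero_smul] at this
  exact this.mono_left nhdsWithin_le_nhds

lemma ord_O1 {E : Type*} [NormedAddCommGroup E] [NormedSpace ℝ E] (f : E → ℝ) (x : E)
    (hf : AnalyticAt ℝ f x) (μ : ℕ) (hμ : (μ : ℕ∞) ≤ ordAt f x) (h : E) :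
    (fun t : ℝ => f (x + t • h)) =O[𝓝[>] 0] fun t => t ^ μ := by
  rw [le_ordAt_iff] at hμ
  obtain ⟨p, r, hp⟩ := hf
  have h1 : ∀ k < μ, ∀ y, p k (fun _ => y) = 0 := by
    intro k hk y
    have := hp.factorial_smul y k
    rw [hμ k hk] at this
    simpa [Nat.factorial_ne_zero] using this
  have h2 := (hp.hasFPowerSeriesAt.isBigO_sub_partialSum_pow μ).comp_tendsto (tendsto_smul_zero h)
  have h3 : ∀ y, p.partialSum μ y = 0 := by
    intro y
    exact Finset.sum_eq_zero fun k hk => h1 k (Finset.mem_range.1 hk) y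
  simp only [h3, sub_zero] at h2
  refine IsBigO.trans h2 ?_
  refine IsBigO.of_bound (‖h‖ ^ μ) (Eventually.of_forall fun t => ?_)
  simp [norm_smul, mul_pow, mul_comm]

lemma ord_O2 {E : Type*} [NormedAddCommGroup E] [NormedSpace ℝ E] (f : E → ℝ) (x : E)
    (hf : AnalyticAt ℝ f x) (μ : ℕ) (W : Set E) (hW : IsOpen W) (hWne : W.Nonempty)
    (hO : ∀ h ∈ W, (fun t : ℝ => f (x + t • h)) =O[𝓝[>] 0] fun t => t ^ μ) :
    (μ : ℕ∞) ≤ ordAt f x := by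
  rw [le_ordAt_iff]
  obtain ⟨p, r, hp⟩ := hf
  intro k
  induction k using Nat.strong_induction_on with
  | _ k ih =>
  intro hk
  have h1 : ∀ j < k, ∀ y, p j (fun _ => y) = 0 := by
    intro j hj y
    have := hp.factorial_smul y j
    rw [ih j hj (hj.trans hk)] at this
    simpa [Nat.factorial_ne_zero] using this
  have h3 : ∀ y, p.partialSum (k + 1) y = p k (fun _ => y) := by
    intro y
    unfold FormalMultilinearSeries.partialSum
    rw [Finset.sum_range_succ, Finset.sum_eq_zero (fun j hj => h1 j (Finset.mem_range.1 hj) y), zero_add]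
  have hdiag : ∀ h ∈ W, p k (fun _ => h) = 0 := by
    intro h hh
    have h2 := (hp.hasFPowerSeriesAt.isBigO_sub_partialSum_pow (k + 1)).comp_tendsto (tendsto_smul_zero h)
    simp only [h3] at h2
    have h4 : (fun t : ℝ => f (x + t • h) - p k (fun _ => t • h)) =O[𝓝[>] 0] fun t => t ^ (k + 1) := by
      refine IsBigO.trans h2 ?_
      refine IsBigO.of_bound (‖h‖ ^ (k + 1)) (Eventually.of_forall fun t => ?_)
      simp [norm_smul, mul_pow, mul_comm]
    have h5 : (fun t : ℝ => f (x + t • h)) =O[𝓝[>] 0] fun t => t ^ (k + 1) := by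
      refine (hO h hh).trans ?_
      rcases (Nat.succ_le_of_lt hk).eq_or_lt with h6 | h6
      · rw [← h6]; exact isBigO_refl _ _
      · exact (isLittleO_pow_pow h6).isBigO.mono nhdsWithin_le_nhds
    have h6 := h5.sub h4
    have h7 : (fun t : ℝ => t ^ k * p k (fun _ => h)) =O[𝓝[>] 0] fun t => t ^ (k + 1) := by
      refine h6.congr_left fun t => ?_
      have := (p k).map_smul_univ (fun _ => t) (fun _ => h)
      simp only [Finset.prod_const, Finset.card_univ, Fintype.card_fin, smul_eq_mul] at this
      rw [this]; ring
    by_contra hne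
    have h8 := h7.mul (isBigO_refl (fun _ : ℝ => (p k (fun _ => h))⁻¹) (𝓝[>] 0))
    have h9 : (fun t : ℝ => t ^ k) =O[𝓝[>] 0] fun t => t ^ (k + 1) := by
      refine (h8.congr_left fun t => mul_inv_cancel_right₀ hne _).trans ?_
      refine IsBigO.of_bound ‖(p k (fun _ => h))⁻¹‖ (Eventually.of_forall fun t => ?_)
      rw [norm_mul, mul_comm]
    have := not_powO_real h9
    omega
  have hall : (fun h : E => p k (fun _ => h)) = 0 := by
    obtain ⟨h0, hh0⟩ := hWne
    refine AnalyticOnNhd.eq_of_eventuallyEq (𝕜 := ℝ) (z₀ := h0) ?_ ?_ ?_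
    · intro y _
      exact (p k).analyticAt.comp (f := fun h : E => fun _ : Fin k => h)
        ((ContinuousLinearMap.pi fun _ : Fin k => ContinuousLinearMap.id ℝ E).analyticAt y)
    · exact analyticOnNhd_const
    · filter_upwards [hW.mem_nhds hh0] with h hh
      exact hdiag h hh
  ext v
  rw [hp.iteratedFDeriv_eq_sum_of_completeSpace, ← ContinuousMultilinearMap.iteratedFDeriv_comp_diagonal (p k) 0 v,
    hall]
  simp

end LPD


namespace LPD
open Polynomial Filter Topology Asymptotics

noncomputable def coefC {m : ℕ} (P : Polynomial (MvPolynomial (Fin m) ℝ)) (k : ℕ) (x : Fin m → ℂ) : ℂ :=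
  MvPolynomial.aeval x (P.coeff k)

noncomputable def FC {m : ℕ} (P : Polynomial (MvPolynomial (Fin m) ℝ)) (d : ℕ) (x : Fin m → ℂ) (v0 v1 : ℂ) : ℂ :=
  ∑ k ∈ Finset.range (d + 1), coefC P k x * v0 ^ k * v1 ^ (d - k)

noncomputable def QC {m : ℕ} (P : Polynomial (MvPolynomial (Fin m) ℝ)) (d : ℕ) (a b : ℝ) (x : Fin m → ℂ) : ℂ[X] :=
  ∑ k ∈ Finset.range (d + 1),
    C (coefC P k x) * (C (a : ℂ) * X - C (b : ℂ)) ^ k * (C (b : ℂ) * X + C (a : ℂ)) ^ (d - k)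

variable {m : ℕ} (P : Polynomial (MvPolynomial (Fin m) ℝ)) (d : ℕ) (a b : ℝ) (x : Fin m → ℂ)

lemma FC_smul (c v0 v1 : ℂ) : FC P d x (c * v0) (c * v1) = c ^ d * FC P d x v0 v1 := by
  unfold FC
  rw [Finset.mul_sum]
  refine Finset.sum_congr rfl fun k hk => ?_
  have : d = k + (d - k) := by have := Finset.mem_range.1 hk; omega
  rw [mul_pow, mul_pow]
  conv_rhs => rw [this, pow_add]
  rw [← this]
  ring

lemma QC_eval (z : ℂ) : (QC P d a b x).eval z = FC P d x (a * z - b) (b * z + a) := by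
  unfold QC FC
  simp [eval_finsetSum]

lemma QC_natDegree_le : (QC P d a b x).natDegree ≤ d := by
  unfold QC
  refine natDegree_sum_le_of_forall_le _ _ fun k hk => ?_
  have hk := Finset.mem_range.1 hk
  have h1 : ((C (a : ℂ) * X - C (b : ℂ)) ^ k).natDegree ≤ k := by
    refine natDegree_pow_le.trans ?_
    have : (C (a : ℂ) * X - C (b : ℂ)).natDegree ≤ 1 := by compute_degree
    nlinarith
  have h2 : ((C (b : ℂ) * X + C (a : ℂ)) ^ (d - k)).natDegree ≤ d - k := by
    refine natDegree_pow_le.trans ?_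
    have : (C (b : ℂ) * X + C (a : ℂ)).natDegree ≤ 1 := by compute_degree
    nlinarith
  refine natDegree_mul_le.trans ?_
  have h3 := natDegree_mul_le (p := C (coefC P k x)) (q := (C (a : ℂ) * X - C (b : ℂ)) ^ k)
  rw [natDegree_C] at h3
  omega

lemma QC_coeff (j : ℕ) : (QC P d a b x).coeff j = ∑ k ∈ Finset.range (d + 1),
    coefC P k x * ((C (a : ℂ) * X - C (b : ℂ)) ^ k * (C (b : ℂ) * X + C (a : ℂ)) ^ (d - k)).coeff j := by
  unfold QC
  rw [finsetSum_coeff]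
  refine Finset.sum_congr rfl fun k _ => ?_
  rw [mul_assoc, coeff_C_mul]

lemma coeff_lin_pow (α β : ℂ) (k : ℕ) : ((C α * X + C β) ^ k).coeff k = α ^ k := by
  have h : (C α * X + C β).natDegree ≤ 1 := by compute_degree
  have := coeff_pow_of_natDegree_le (m := k) h
  rw [mul_one] at this
  rw [this]
  simp

lemma QC_coeff_d : (QC P d a b x).coeff d = FC P d x a b := by
  rw [QC_coeff]
  unfold FC
  refine Finset.sum_congr rfl fun k hk => ?_
  have hk := Finset.mem_range.1 hk
  rw [mul_assoc]
  congr 1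
  have h1 : ((C (a : ℂ) * X - C (b : ℂ)) ^ k).natDegree ≤ k := by
    refine natDegree_pow_le.trans ?_
    have : (C (a : ℂ) * X - C (b : ℂ)).natDegree ≤ 1 := by compute_degree
    nlinarith
  have h2 : ((C (b : ℂ) * X + C (a : ℂ)) ^ (d - k)).natDegree ≤ d - k := by
    refine natDegree_pow_le.trans ?_
    have : (C (b : ℂ) * X + C (a : ℂ)).natDegree ≤ 1 := by compute_degree
    nlinarith
  have h3 := coeff_mul_add_eq_of_natDegree_le h1 h2
  have h4 : k + (d - k) = d := by omega
  rw [h4] at h3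
  rw [h3, coeff_lin_pow]
  have h5 : C (a : ℂ) * X - C (b : ℂ) = C (a : ℂ) * X + C (-(b : ℂ)) := by simp [sub_eq_add_neg]
  rw [h5, coeff_lin_pow]

noncomputable def qn : ℂ[X] := C (FC P d x a b)⁻¹ * QC P d a b x

lemma qn_monic (h : FC P d x a b ≠ 0) : (qn P d a b x).Monic ∧ (qn P d a b x).natDegree = d := by
  have h1 : (qn P d a b x).natDegree ≤ d := (natDegree_C_mul_le _ _).trans (QC_natDegree_le P d a b x)
  have h2 : (qn P d a b x).coeff d = 1 := by
    unfold qn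
    rw [coeff_C_mul, QC_coeff_d, inv_mul_cancel₀ h]
  refine ⟨monic_of_natDegree_le_of_coeff_eq_one d h1 h2, ?_⟩
  refine le_antisymm h1 (le_natDegree_of_ne_zero (by rw [h2]; exact one_ne_zero))

lemma sylv_map {R S : Type*} [CommRing R] [CommRing S] (f : R →+* S) (p q : ℕ) (A B : Polynomial R) :
    f (resFixed p q A B) = resFixed p q (A.map f) (B.map f) := by
  unfold resFixed
  rw [RingHom.map_det]
  congr 1
  ext i j
  simp only [_root_.sylvester, RingHom.mapMatrix_apply, Matrix.map_apply, coeff_map]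
  split_ifs <;> simp

lemma sylv_row {R : Type*} [CommRing R] (e i : ℕ) (hi : i < e) (A : ℕ → R) (v0 v1 : R) :
    ∑ j : Fin (e + e), (if i ≤ (j : ℕ) ∧ (j : ℕ) ≤ i + e then A (e + i - j) else 0) *
      (v0 ^ (e + e - 1 - (j : ℕ)) * v1 ^ (j : ℕ)) =
    v0 ^ (e - 1 - i) * v1 ^ i * ∑ l ∈ Finset.range (e + 1), A l * v0 ^ l * v1 ^ (e - l) := by
  rw [Fin.sum_univ_eq_sum_range (fun j => (if i ≤ j ∧ j ≤ i + e then A (e + i - j) else 0) *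
      (v0 ^ (e + e - 1 - j) * v1 ^ j)) (e + e)]
  have h1 : ∀ j ∈ Finset.range (e + e), (if i ≤ j ∧ j ≤ i + e then A (e + i - j) else 0) *
      (v0 ^ (e + e - 1 - j) * v1 ^ j) = if i ≤ j ∧ j ≤ i + e then A (e + i - j) *
      (v0 ^ (e + e - 1 - j) * v1 ^ j) else 0 := by
    intro j _; split_ifs <;> simp
  rw [Finset.sum_congr rfl h1, ← Finset.sum_filter, Finset.mul_sum]
  refine Finset.sum_bij' (fun j _ => e + i - j) (fun l _ => e + i - l) ?_ ?_ ?_ ?_ ?_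
  · intro j hj
    simp only [Finset.mem_filter, Finset.mem_range] at hj ⊢; omega
  · intro j hj
    simp only [Finset.mem_filter, Finset.mem_range] at hj ⊢; omega
  · intro j hj
    simp only [Finset.mem_filter, Finset.mem_range] at hj ⊢; omega
  · intro j hj
    simp only [Finset.mem_range] at hj ⊢; omega
  · intro j hj
    simp only [Finset.mem_filter, Finset.mem_range] at hj
    obtain ⟨l, hl⟩ : ∃ l, l = e + i - j := ⟨_, rfl⟩
    rw [← hl]
    have e1 : e + e - 1 - j = (e - 1 - i) + l := by omega
    have e2 : j = i + (e - l) := by omega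
    rw [e1, pow_add]
    conv_lhs => rw [e2, pow_add]
    ring

lemma res_zero (e : ℕ) (he : 0 < e) (A B : ℂ[X]) (v0 v1 : ℂ) (hv : v0 ≠ 0 ∨ v1 ≠ 0)
    (hA : ∑ l ∈ Finset.range (e + 1), A.coeff l * v0 ^ l * v1 ^ (e - l) = 0)
    (hB : ∑ l ∈ Finset.range (e + 1), B.coeff l * v0 ^ l * v1 ^ (e - l) = 0) :
    resFixed e e A B = 0 := by
  unfold resFixed
  rw [← Matrix.exists_mulVec_eq_zero_iff]
  refine ⟨fun j => v0 ^ (e + e - 1 - (j : ℕ)) * v1 ^ (j : ℕ), ?_, ?_⟩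
  · intro h
    rcases hv with h0 | h0
    · have := congrFun h ⟨0, by omega⟩
      simp at this
      exact h0 this.1
    · have := congrFun h ⟨e + e - 1, by omega⟩
      simp at this
      exact h0 this.1
  · ext i
    simp only [Matrix.mulVec, dotProduct, _root_.sylvester, Pi.zero_apply]
    by_cases hi : (i : ℕ) < e
    · simp only [hi, if_true]
      rw [sylv_row e i hi (fun l => A.coeff l), hA, mul_zero]
    · simp only [hi, if_false]
      have := sylv_row e ((i : ℕ) - e) (by omega) (fun l => B.coeff l) v0 v1
      rw [hB, mul_zero] at this
      refine Eq.trans (Finset.sum_congr rfl fun j _ => ?_) this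
      have h5 : (i : ℕ) - e + e = i := by omega
      rw [h5]

/-- pure algebra: double root implies both partials vanish -/
lemma disc_zero (e : ℕ) (he : 0 < e) (hab : a ^ 2 + b ^ 2 ≠ 0) (z : ℂ)
    (h1 : (QC P (e + 1) a b x).eval z = 0) (h2 : (derivative (QC P (e + 1) a b x)).eval z = 0) :
    MvPolynomial.aeval x (discFixed (e + 1) P) = 0 := by
  set f : MvPolynomial (Fin m) ℝ →+* ℂ := (MvPolynomial.aeval x : MvPolynomial (Fin m) ℝ →ₐ[ℝ] ℂ).toRingHom with hf
  change f (discFixed (e + 1) P) = 0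
  unfold discFixed
  rw [map_mul, sylv_map]
  have hab' : (a : ℂ) ^ 2 + (b : ℂ) ^ 2 ≠ 0 := by exact_mod_cast hab
  set v0 : ℂ := a * z - b with hv0
  set v1 : ℂ := b * z + a with hv1
  set c : ℕ → ℂ := fun k => coefC P k x with hc
  set F0 : ℂ := ∑ l ∈ Finset.range (e + 1), ((l + 1 : ℂ) * c (l + 1)) * v0 ^ l * v1 ^ (e - l) with hF0
  set F1 : ℂ := ∑ l ∈ Finset.range (e + 1), (((e : ℂ) + 1 - l) * c l) * v0 ^ l * v1 ^ (e - l) with hF1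
  have hQ' : (derivative (QC P (e + 1) a b x)).eval z = a * F0 + b * F1 := by
    unfold QC
    simp only [derivative_sum, eval_finsetSum, derivative_mul, derivative_C, derivative_pow, derivative_sub,
      derivative_add, derivative_X, eval_add, eval_mul, eval_C, eval_pow, eval_sub, eval_X, eval_natCast, zero_mul,
      zero_add, mul_one, add_zero, sub_zero, eval_zero]
    rw [Finset.sum_add_distrib, hF0, hF1, Finset.mul_sum, Finset.mul_sum]
    congr 1
    · rw [Finset.sum_range_succ']
      simp only [Nat.cast_zero, zero_mul, mul_zero, add_zero]
      refine Finset.sum_congr rfl fun l hl => ?_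
      have hl := Finset.mem_range.1 hl
      have e1 : e + 1 - (l + 1) = e - l := by omega
      rw [e1]
      simp only [Nat.add_sub_cancel, hc]
      push_cast
      ring
    · rw [Finset.sum_range_succ]
      simp only [Nat.sub_self, Nat.cast_zero, zero_mul, mul_zero, add_zero]
      refine Finset.sum_congr rfl fun l hl => ?_
      have hl := Finset.mem_range.1 hl
      have e1 : e + 1 - l - 1 = e - l := by omega
      rw [e1, Nat.cast_sub (by omega)]
      simp only [hc]
      push_cast
      ring
  have hE : v0 * F0 + v1 * F1 = (e + 1) * (QC P (e + 1) a b x).eval z := by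
    rw [QC_eval]
    unfold FC
    have h3 : v0 * F0 = ∑ k ∈ Finset.range (e + 1 + 1), (k : ℂ) * (c k * v0 ^ k * v1 ^ (e + 1 - k)) := by
      rw [Finset.sum_range_succ', hF0, Finset.mul_sum]
      simp only [Nat.cast_zero, zero_mul, add_zero]
      refine Finset.sum_congr rfl fun l hl => ?_
      have e1 : e + 1 - (l + 1) = e - l := by omega
      rw [e1]; push_cast; ring
    have h4 : v1 * F1 = ∑ k ∈ Finset.range (e + 1 + 1), ((e : ℂ) + 1 - k) * (c k * v0 ^ k * v1 ^ (e + 1 - k)) := by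
      rw [Finset.sum_range_succ, hF1, Finset.mul_sum]
      push_cast
      simp only [sub_self, zero_mul, add_zero]
      refine Finset.sum_congr rfl fun l hl => ?_
      have hl := Finset.mem_range.1 hl
      have e1 : e + 1 - l = (e - l) + 1 := by omega
      rw [e1]; ring
    rw [h3, h4, ← Finset.sum_add_distrib, Finset.mul_sum]
    refine Finset.sum_congr rfl fun l hl => ?_
    ring
  rw [h1, mul_zero] at hE
  rw [h2] at hQ'
  have hF0z : F0 = 0 := by
    have : (((a : ℂ) ^ 2 + (b : ℂ) ^ 2)) * F0 = 0 := by
      simp only [hv0, hv1] at hE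
      linear_combination (-(b * z + a)) * hQ' - b * hE
    exact (mul_eq_zero.1 this).resolve_left hab'
  have hF1z : F1 = 0 := by
    have : (((a : ℂ) ^ 2 + (b : ℂ) ^ 2)) * F1 = 0 := by
      simp only [hv0, hv1] at hE
      linear_combination ((a * z - b)) * hQ' + a * hE
    exact (mul_eq_zero.1 this).resolve_left hab'
  rw [Nat.add_sub_cancel, res_zero e he _ _ v0 v1, mul_zero]
  · by_contra hcon
    push Not at hcon
    obtain ⟨hx, hy⟩ := hcon
    apply hab'
    simp only [hv0, hv1] at hx hy
    linear_combination (-b) * hx + a * hy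
  · rw [← hF0z, hF0]
    refine Finset.sum_congr rfl fun l hl => ?_
    rw [coeff_map, coeff_derivative, map_mul]
    simp only [hc, coefC, map_add, map_natCast, map_one]
    simp only [hf]
    congr 2
    exact mul_comm _ _
  · rw [← hF1z, hF1]
    refine Finset.sum_congr rfl fun l hl => ?_
    congr 2
    rw [coeff_map, coeff_sub, coeff_C_mul, map_sub, map_mul]
    cases l with
    | zero =>
      simp only [mul_coeff_zero, coeff_X_zero, zero_mul, hc, coefC, map_natCast, map_zero]
      simp [hf]
    | succ l =>
      rw [coeff_X_mul, coeff_derivative, map_mul]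
      simp only [hc, coefC, map_natCast, map_add, map_one]
      simp only [hf]
      push_cast
      simp
      ring

lemma qn_nodup (hab : a ^ 2 + b ^ 2 ≠ 0) (h : FC P d x a b ≠ 0)
    (hD : MvPolynomial.aeval x (discFixed d P) ≠ 0) : (qn P d a b x).roots.Nodup := by
  classical
  obtain ⟨hm, hdeg⟩ := qn_monic P d a b x h
  rw [Multiset.nodup_iff_count_le_one]
  intro z
  by_contra hc
  push Not at hc
  have hcard : 2 ≤ d := by
    have h1 := (qn P d a b x).card_roots'
    have h2 := Multiset.count_le_card z (qn P d a b x).roots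
    omega
  obtain ⟨e, rfl⟩ : ∃ e, d = e + 1 := ⟨d - 1, by omega⟩
  rw [count_roots, one_lt_rootMultiplicity_iff_isRoot hm.ne_zero] at hc
  obtain ⟨h1, h2⟩ := hc
  apply hD
  refine disc_zero P a b x e (by omega) hab z ?_ ?_
  · unfold qn at h2
    simp only [IsRoot, derivative_mul, derivative_C, zero_mul, zero_add, eval_mul, eval_C] at h2
    have h1' : eval z (qn P (e + 1) a b x) = 0 := h1
    unfold qn at h1'
    rw [eval_mul, eval_C] at h1'
    exact (mul_eq_zero.1 h1').resolve_left (inv_ne_zero h)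
  · unfold qn at h2
    simp only [IsRoot, derivative_mul, derivative_C, zero_mul, zero_add, eval_mul, eval_C] at h2
    exact (mul_eq_zero.1 h2).resolve_left (inv_ne_zero h)

end LPD


namespace LPD
open Polynomial Filter Topology Asymptotics

noncomputable def pt {m : ℕ} (p u : Fin m → ℝ) (t : ℂ) : Fin m → ℂ := fun i => (p i : ℂ) + t * (u i : ℂ)

lemma pt_real {m : ℕ} (p u : Fin m → ℝ) (t : ℝ) :
    pt p u (t : ℂ) = fun i => (((p + t • u) i : ℝ) : ℂ) := by
  ext i; simp [pt]

lemma pt_zero {m : ℕ} (p u : Fin m → ℝ) : pt p u 0 = fun i => ((p i : ℝ) : ℂ) := by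
  ext i; simp [pt]

lemma pt_cont {m : ℕ} : Continuous fun y : (Fin m → ℝ) × (Fin m → ℝ) × ℂ => pt y.1 y.2.1 y.2.2 := by
  unfold pt; fun_prop

lemma aeval_cont {m : ℕ} (D : MvPolynomial (Fin m) ℝ) :
    Continuous fun x : Fin m → ℂ => MvPolynomial.aeval x D := by
  simp only [MvPolynomial.aeval_def, MvPolynomial.eval₂_eq_eval_map]
  exact MvPolynomial.continuous_eval _

lemma aeval_diff {m : ℕ} (D : MvPolynomial (Fin m) ℝ) (p u : Fin m → ℝ) :
    Differentiable ℂ fun t : ℂ => MvPolynomial.aeval (pt p u t) D := by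
  induction D using MvPolynomial.induction_on with
  | C r => simp
  | add f g hf hg => simp only [map_add]; exact hf.add hg
  | mul_X f i hf =>
    simp only [map_mul, MvPolynomial.aeval_X]
    refine hf.mul ?_
    unfold pt; fun_prop

lemma aeval_real {m : ℕ} (D : MvPolynomial (Fin m) ℝ) (p : Fin m → ℝ) :
    MvPolynomial.aeval (fun i => ((p i : ℝ) : ℂ)) D = ((MvPolynomial.eval p D : ℝ) : ℂ) := by
  induction D using MvPolynomial.induction_on with
  | C r => simp
  | add f g hf hg => simp [hf, hg]
  | mul_X f i hf => simp [hf]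

/-! the polynomial along a line -/
noncomputable def gl {m : ℕ} (D : MvPolynomial (Fin m) ℝ) (p u : Fin m → ℝ) : ℂ[X] :=
  MvPolynomial.aeval (fun i => C ((p i : ℝ) : ℂ) + C ((u i : ℝ) : ℂ) * X) D

lemma gl_eval {m : ℕ} (D : MvPolynomial (Fin m) ℝ) (p u : Fin m → ℝ) (t : ℂ) :
    (gl D p u).eval t = MvPolynomial.aeval (pt p u t) D := by
  unfold gl
  induction D using MvPolynomial.induction_on with
  | C r => simp [MvPolynomial.aeval_C, IsScalarTower.algebraMap_apply ℝ ℂ ℂ[X]]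
  | add f g hf hg => simp [hf, hg]
  | mul_X f i hf => simp only [map_mul, MvPolynomial.aeval_X, eval_mul, hf, eval_add, eval_C, eval_X, pt]; ring

lemma gl_coeff_cont {m : ℕ} (D : MvPolynomial (Fin m) ℝ) (k : ℕ) :
    Continuous fun y : (Fin m → ℝ) × (Fin m → ℝ) => (gl D y.1 y.2).coeff k := by
  unfold gl
  induction D using MvPolynomial.induction_on generalizing k with
  | C r => simp only [MvPolynomial.aeval_C]; exact continuous_const
  | add f g hf hg => simp only [map_add, coeff_add]; exact (hf k).add (hg k)
  | mul_X f i hf =>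
    simp only [map_mul, MvPolynomial.aeval_X, mul_add, coeff_add, coeff_mul_C, ← mul_assoc]
    refine ((hf k).mul (by fun_prop)).add ?_
    cases k with
    | zero => simp only [coeff_mul_X_zero]; exact continuous_const
    | succ k =>
      simp only [coeff_mul_X, coeff_mul_C]
      exact (hf k).mul (by fun_prop)

lemma gl_deg {m : ℕ} (D : MvPolynomial (Fin m) ℝ) : ∃ n, ∀ p u, (gl D p u).natDegree ≤ n := by
  unfold gl
  induction D using MvPolynomial.induction_on with
  | C r =>
    refine ⟨0, fun p u => ?_⟩
    simp [MvPolynomial.aeval_C, IsScalarTower.algebraMap_apply ℝ ℂ ℂ[X]]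
  | add f g hf hg =>
    obtain ⟨n1, h1⟩ := hf
    obtain ⟨n2, h2⟩ := hg
    refine ⟨max n1 n2, fun p u => ?_⟩
    rw [map_add]
    exact (natDegree_add_le _ _).trans (max_le_max (h1 p u) (h2 p u))
  | mul_X f i hf =>
    obtain ⟨n1, h1⟩ := hf
    refine ⟨n1 + 1, fun p u => ?_⟩
    rw [map_mul, MvPolynomial.aeval_X]
    refine natDegree_mul_le.trans (add_le_add (h1 p u) ?_)
    compute_degree

lemma poly_O (q : ℂ[X]) (e : ℕ) (h : (fun t : ℝ => q.eval (t : ℂ)) =O[𝓝[>] 0] fun t => t ^ e) :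
    X ^ e ∣ q := by
  by_cases hq : q = 0
  · rw [hq]; exact dvd_zero _
  obtain ⟨r, hr, hr0⟩ := exists_eq_pow_rootMultiplicity_mul_and_not_dvd q hq 0
  set j := q.rootMultiplicity 0
  simp only [map_zero, sub_zero] at hr hr0
  by_cases hj : e ≤ j
  · rw [hr]; exact (pow_dvd_pow _ hj).mul_right _
  exfalso
  push Not at hj
  apply hr0
  rw [X_dvd_iff, coeff_zero_eq_eval_zero]
  have h1 : Tendsto (fun t : ℝ => r.eval (t : ℂ)) (𝓝[>] 0) (𝓝 (r.eval 0)) := by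
    have : Continuous (fun t : ℝ => r.eval (t : ℂ)) := r.continuous.comp Complex.continuous_ofReal
    have := this.tendsto 0
    simp only [Complex.ofReal_zero] at this
    exact this.mono_left nhdsWithin_le_nhds
  have h2 : (fun t : ℝ => r.eval (t : ℂ)) =O[𝓝[>] 0] fun t => t ^ (e - j) := by
    obtain ⟨c, hc⟩ := h.bound
    refine IsBigO.of_bound c ?_
    filter_upwards [hc, self_mem_nhdsWithin] with t ht htp
    have htp : 0 < t := htp
    rw [hr] at ht
    simp only [eval_mul, eval_pow, eval_X, norm_mul, norm_pow, Complex.norm_real, Real.norm_eq_abs, abs_of_pos htp] at ht ⊢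
    have : t ^ e = t ^ j * t ^ (e - j) := by rw [← pow_add]; congr 1; omega
    rw [this] at ht
    have h3 : 0 < t ^ j := by positivity
    refine le_of_mul_le_mul_left ?_ h3
    linarith
  have h3 : Tendsto (fun t : ℝ => t ^ (e - j)) (𝓝[>] 0) (𝓝 0) := by
    have : Continuous (fun t : ℝ => t ^ (e - j)) := by fun_prop
    have := this.tendsto 0
    rw [zero_pow (by omega)] at this
    exact this.mono_left nhdsWithin_le_nhds
  exact tendsto_nhds_unique h1 (h2.trans_tendsto h3)

lemma O_poly (q : ℂ[X]) (e : ℕ) (h : X ^ e ∣ q) :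
    (fun t : ℝ => q.eval (t : ℂ)) =O[𝓝[>] 0] fun t => t ^ e := by
  obtain ⟨r, rfl⟩ := h
  simp only [eval_mul, eval_pow, eval_X]
  have h1 : (fun t : ℝ => r.eval (t : ℂ)) =O[𝓝[>] 0] fun t => (1 : ℝ) := by
    have : Continuous (fun t : ℝ => r.eval (t : ℂ)) := r.continuous.comp Complex.continuous_ofReal
    exact ((this.tendsto 0).isBigO_one ℝ).mono nhdsWithin_le_nhds
  have h2 : (fun t : ℝ => (t : ℂ) ^ e) =O[𝓝[>] 0] fun t : ℝ => t ^ e :=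
    IsBigO.of_bound 1 (Eventually.of_forall fun t => by simp)
  simpa using h2.mul h1

lemma gl_ord {m : ℕ} (D : MvPolynomial (Fin m) ℝ) (p : Fin m → ℝ) (μ : ℕ) :
    (μ : ℕ∞) ≤ ordAt (fun x => MvPolynomial.eval x D) p ↔ ∀ u, X ^ μ ∣ gl D p u := by
  have hf : AnalyticAt ℝ (fun x : Fin m → ℝ => MvPolynomial.eval x D) p :=
    AnalyticOnNhd.eval_mvPolynomial D p trivial
  have key : ∀ u, (fun t : ℝ => (gl D p u).eval (t : ℂ)) =
      fun t : ℝ => ((MvPolynomial.eval (p + t • u) D : ℝ) : ℂ) := by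
    intro u; ext t
    rw [gl_eval, pt_real, aeval_real]
  constructor
  · intro h u
    refine poly_O _ _ ?_
    rw [key]
    have := ord_O1 _ p hf μ h u
    refine IsBigO.trans (IsBigO.of_bound 1 (Eventually.of_forall fun t => ?_)) this
    rw [one_mul, Complex.norm_real]
  · intro h
    refine ord_O2 _ p hf μ Set.univ isOpen_univ Set.univ_nonempty fun u _ => ?_
    have := O_poly _ _ (h u)
    rw [key] at this
    refine IsBigO.trans (IsBigO.of_bound 1 (Eventually.of_forall fun t => ?_)) this
    rw [one_mul, Complex.norm_real]

lemma nonvan {m : ℕ} (D : MvPolynomial (Fin m) ℝ) (hD : D ≠ 0) (S : Set (Fin m → ℝ))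
    (hinv : OrderInvariantOn (fun x => MvPolynomial.eval x D) S) (s : Fin m → ℝ) (hs : s ∈ S) :
    ∃ u0 : Fin m → ℝ, ∀ᶠ y in 𝓝 (s, u0, (0 : ℂ)), y.1 ∈ S → y.2.2 ≠ 0 →
      MvPolynomial.aeval (pt y.1 y.2.1 y.2.2) D ≠ 0 := by
  have hfin : ordAt (fun x => MvPolynomial.eval x D) s ≠ ⊤ := by
    intro htop
    apply hD
    refine MvPolynomial.funext fun x => ?_
    have h0 : gl D s (x - s) = 0 := by
      by_contra h
      have h1 := (gl_ord D s ((gl D s (x - s)).natDegree + 1)).1 (by rw [htop]; exact le_top) (x - s)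
      have := natDegree_le_of_dvd h1 h
      rw [natDegree_X_pow] at this
      omega
    have h1 := gl_eval D s (x - s) ((1 : ℝ) : ℂ)
    rw [h0, eval_zero, pt_real, aeval_real] at h1
    have h2 : s + (1 : ℝ) • (x - s) = x := by simp
    rw [h2] at h1
    rw [map_zero]
    exact_mod_cast h1.symm
  obtain ⟨e, he⟩ := ENat.ne_top_iff_exists.1 hfin
  have hdvd : ∀ p ∈ S, ∀ u, X ^ e ∣ gl D p u := by
    intro p hp
    rw [← gl_ord, he, hinv s hs p hp]
  have hu0 : ∃ u0, (gl D s u0).coeff e ≠ 0 := by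
    by_contra h
    push Not at h
    have : ((e + 1 : ℕ) : ℕ∞) ≤ ordAt (fun x => MvPolynomial.eval x D) s := by
      rw [gl_ord]
      intro u
      rw [X_pow_dvd_iff]
      intro k hk
      rcases Nat.lt_succ_iff_lt_or_eq.1 hk with h1 | h1
      · exact X_pow_dvd_iff.1 (hdvd s hs u) k h1
      · rw [h1]; exact h u
    rw [← he] at this
    have := ENat.natCast_le_natCast.1 this
    omega
  obtain ⟨u0, hu0⟩ := hu0
  obtain ⟨n, hn⟩ := gl_deg D
  have hcc : ∀ k, Continuous fun y : (Fin m → ℝ) × (Fin m → ℝ) × ℂ => (gl D y.1 y.2.1).coeff k := fun k =>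
    (gl_coeff_cont D k).comp (f := fun y : (Fin m → ℝ) × (Fin m → ℝ) × ℂ => (y.1, y.2.1))
      (continuous_fst.prodMk (continuous_fst.comp continuous_snd))
  set K : (Fin m → ℝ) × (Fin m → ℝ) × ℂ → ℂ := fun y =>
    ∑ k ∈ Finset.range (n + 1), if e ≤ k then (gl D y.1 y.2.1).coeff k * y.2.2 ^ (k - e) else 0 with hK
  have hKc : Continuous K := by
    refine continuous_finsetSum _ fun k _ => ?_
    split_ifs
    · exact Continuous.mul (hcc k) ((continuous_snd.comp continuous_snd).pow _)
    · exact continuous_const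
  have hK0 : K (s, u0, 0) ≠ 0 := by
    have hen : e ∈ Finset.range (n + 1) := by
      have := le_natDegree_of_ne_zero hu0
      have := hn s u0
      rw [Finset.mem_range]; omega
    have : K (s, u0, 0) = (gl D s u0).coeff e := by
      simp only [hK]
      rw [Finset.sum_eq_single_of_mem e hen]
      · simp
      · intro k _ hk
        split_ifs with h
        · rw [zero_pow (by omega), mul_zero]
        · rfl
    rw [this]; exact hu0
  refine ⟨u0, ?_⟩
  filter_upwards [hKc.continuousAt.eventually_ne hK0] with y hy hyS hyt
  have : MvPolynomial.aeval (pt y.1 y.2.1 y.2.2) D = y.2.2 ^ e * K y := by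
    rw [← gl_eval, eval_eq_sum_range' (n := n + 1) (by have := hn y.1 y.2.1; omega), hK]
    simp only
    rw [Finset.mul_sum]
    refine Finset.sum_congr rfl fun k _ => ?_
    split_ifs with h
    · have : y.2.2 ^ k = y.2.2 ^ e * y.2.2 ^ (k - e) := by rw [← pow_add]; congr 1; omega
      rw [this]; ring
    · rw [X_pow_dvd_iff.1 (hdvd y.1 hyS y.2.1) k (by omega)]; simp
  rw [this]
  exact mul_ne_zero (pow_ne_zero _ hyt) hy

end LPD


namespace LPD
open Polynomial Filter Topology Asymptotics

noncomputable def FR {m : ℕ} (P : Polynomial (MvPolynomial (Fin m) ℝ)) (d : ℕ) :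
    (Fin m → ℝ) × (Fin 2 → ℝ) → ℝ := fun y => MvPolynomial.eval y.2 (homog d (evalP P y.1))

variable {m : ℕ} (P : Polynomial (MvPolynomial (Fin m) ℝ)) (d : ℕ) (a b : ℝ)

lemma FR_eq (y : (Fin m → ℝ) × (Fin 2 → ℝ)) : FR P d y =
    ∑ k ∈ Finset.range (d + 1), MvPolynomial.eval y.1 (P.coeff k) * y.2 0 ^ k * y.2 1 ^ (d - k) := by
  simp [FR, homog, evalP]

lemma FR_FC (p : Fin m → ℝ) (v : Fin 2 → ℝ) : ((FR P d (p, v) : ℝ) : ℂ) =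
    FC P d (fun i => ((p i : ℝ) : ℂ)) (v 0) (v 1) := by
  rw [FR_eq]
  simp [FC, coefC, aeval_real]

lemma FR_analytic (y : (Fin m → ℝ) × (Fin 2 → ℝ)) : AnalyticAt ℝ (FR P d) y := by
  have : FR P d = fun y => ∑ k ∈ Finset.range (d + 1),
      MvPolynomial.eval y.1 (P.coeff k) * y.2 0 ^ k * y.2 1 ^ (d - k) := funext (FR_eq P d)
  rw [this]
  refine Finset.analyticAt_fun_sum _ fun k _ => ?_
  have h2 : ∀ i : Fin 2, AnalyticAt ℝ (fun y : (Fin m → ℝ) × (Fin 2 → ℝ) => y.2 i) y := fun i =>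
    ((ContinuousLinearMap.proj (R := ℝ) (φ := fun _ : Fin 2 => ℝ) i).comp
      (ContinuousLinearMap.snd ℝ (Fin m → ℝ) (Fin 2 → ℝ))).analyticAt y
  have h1 : AnalyticAt ℝ (fun y : (Fin m → ℝ) × (Fin 2 → ℝ) => MvPolynomial.eval y.1 (P.coeff k)) y :=
    AnalyticAt.comp (g := fun x : Fin m → ℝ => MvPolynomial.eval x (P.coeff k))
      (AnalyticOnNhd.eval_mvPolynomial (P.coeff k) y.1 trivial)
      ((ContinuousLinearMap.fst ℝ (Fin m → ℝ) (Fin 2 → ℝ)).analyticAt y)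
  exact (h1.mul ((h2 0).pow k)).mul ((h2 1).pow (d - k))

lemma coefC_cont (k : ℕ) : Continuous fun x : Fin m → ℂ => coefC P k x := aeval_cont _

lemma FC_cont (v0 v1 : ℂ) : Continuous fun x : Fin m → ℂ => FC P d x v0 v1 := by
  unfold FC
  refine continuous_finsetSum _ fun k _ => ?_
  exact ((coefC_cont P k).mul continuous_const).mul continuous_const

lemma FC_diff (p u : Fin m → ℝ) (v0 v1 : ℂ) : Differentiable ℂ fun t : ℂ => FC P d (pt p u t) v0 v1 := by
  unfold FC
  refine Differentiable.fun_sum fun k _ => ?_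
  exact ((aeval_diff (P.coeff k) p u).mul (differentiable_const _)).mul (differentiable_const _)

lemma QC_coeff_cont (j : ℕ) : Continuous fun x : Fin m → ℂ => (QC P d a b x).coeff j := by
  simp only [QC_coeff]
  refine continuous_finsetSum _ fun k _ => ?_
  exact (coefC_cont P k).mul continuous_const

lemma QC_coeff_diff (p u : Fin m → ℝ) (j : ℕ) :
    Differentiable ℂ fun t : ℂ => (QC P d a b (pt p u t)).coeff j := by
  simp only [QC_coeff]
  refine Differentiable.fun_sum fun k _ => ?_
  exact (aeval_diff (P.coeff k) p u).mul (differentiable_const _)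

lemma qn_coeff (x : Fin m → ℂ) (j : ℕ) :
    (qn P d a b x).coeff j = (FC P d x a b)⁻¹ * (QC P d a b x).coeff j := by
  unfold qn; rw [coeff_C_mul]

lemma qn_eval_cont (x : Fin m → ℂ) (h : FC P d x a b ≠ 0) (z : ℂ) :
    ContinuousAt (fun x : Fin m → ℂ => (qn P d a b x).eval z) x := by
  have : (fun x : Fin m → ℂ => (qn P d a b x).eval z) =
      fun x => (FC P d x a b)⁻¹ * FC P d x (a * z - b) (b * z + a) := by
    ext x; unfold qn; rw [eval_C_mul, QC_eval]
  rw [this]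
  exact ((FC_cont P d a b).continuousAt.inv₀ h).mul (FC_cont P d _ _).continuousAt

lemma FC_lin (x : Fin m → ℂ) (h : FC P d x a b ≠ 0) (α β : ℂ) (hβ : β ≠ 0) :
    FC P d x (α * a - β * b) (α * b + β * a) = β ^ d * FC P d x a b * (qn P d a b x).eval (α / β) := by
  unfold qn
  rw [eval_C_mul, QC_eval]
  have h1 : α * a - β * b = β * (a * (α / β) - b) := by field_simp
  have h2 : α * b + β * a = β * (b * (α / β) + a) := by field_simp
  rw [h1, h2, FC_smul]
  field_simp

lemma qn_eval_roots (x : Fin m → ℂ) (h : FC P d x a b ≠ 0) (w : ℂ) :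
    (qn P d a b x).eval w = ((qn P d a b x).roots.map (fun z => w - z)).prod := by
  have h1 := IsAlgClosed.splits (qn P d a b x)
  conv_lhs => rw [h1.eq_prod_roots_of_monic (qn_monic P d a b x h).1]
  rw [eval_multiset_prod, Multiset.map_map]
  simp

lemma roots_card (x : Fin m → ℂ) (h : FC P d x a b ≠ 0) : Multiset.card (qn P d a b x).roots = d := by
  have h1 := IsAlgClosed.splits (qn P d a b x)
  rw [← h1.natDegree_eq_card_roots, (qn_monic P d a b x h).2]

lemma prod_le (s : Multiset ℂ) (f g : ℂ → ℝ) (c : ℝ) (hf : ∀ z ∈ s, 0 ≤ f z) (h : ∀ z ∈ s, f z ≤ c * g z) :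
    (s.map f).prod ≤ c ^ Multiset.card s * (s.map g).prod := by
  have : c ^ Multiset.card s * (s.map g).prod = (s.map fun z => c * g z).prod := by
    rw [Multiset.prod_map_mul]; simp
  rw [this]
  exact Multiset.prod_map_le_prod_map₀ _ _ hf h

lemma norm_prod (s : Multiset ℂ) (w : ℂ) : ‖(s.map (fun z => w - z)).prod‖ = (s.map (fun z => ‖w - z‖)).prod := by
  exact (Multiset.prod_hom' s (normHom : ℂ →*₀ ℝ) (fun z => w - z)).symm

lemma pigeon (s : Multiset ℂ) (hs : Multiset.card s = d) (ζ : ℂ) (t : ℝ) (ht : 0 < t) :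
    ∃ β ∈ Finset.range (d + 1), ∀ z ∈ s, t / 2 ≤ ‖ζ + t * (β : ℂ) - z‖ := by
  classical
  by_contra hcon
  push Not at hcon
  choose! f hf using hcon
  have hcard : s.toFinset.card < (Finset.range (d + 1)).card := by
    rw [Finset.card_range]
    have := Multiset.toFinset_card_le s
    omega
  obtain ⟨x, hx, y, hy, hxy, hfxy⟩ := Finset.exists_ne_map_eq_of_card_lt_of_maps_to (f := f) hcard
    (fun β hβ => by simpa using (hf β hβ).1)
  have h1 := (hf x hx).2
  have h2 := (hf y hy).2
  rw [hfxy] at h1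
  have h3 : ‖(t : ℂ) * ((x : ℂ) - y)‖ < t := by
    calc ‖(t : ℂ) * ((x : ℂ) - y)‖ = ‖(ζ + t * (x : ℂ) - f y) - (ζ + t * (y : ℂ) - f y)‖ := by congr 1; ring
      _ ≤ _ := norm_sub_le _ _
      _ < t := by linarith
  rw [norm_mul, Complex.norm_real, Real.norm_of_nonneg ht.le] at h3
  have h4 : (1 : ℝ) ≤ ‖((x : ℂ) - y)‖ := by
    have : ((x : ℂ) - y) = (((x : ℤ) - (y : ℤ) : ℤ) : ℂ) := by push_cast; rfl
    rw [this, Complex.norm_intCast]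
    have h5 : (1 : ℤ) ≤ |(x : ℤ) - y| := Int.one_le_abs (by omega)
    exact_mod_cast h5
  nlinarith

lemma pt_tendsto (p u : Fin m → ℝ) :
    Tendsto (fun t : ℝ => pt p u (t : ℂ)) (𝓝[>] 0) (𝓝 fun i => ((p i : ℝ) : ℂ)) := by
  have : Continuous fun t : ℝ => pt p u (t : ℂ) := by unfold pt; fun_prop
  have := this.tendsto 0
  simp only [Complex.ofReal_zero, pt_zero] at this
  exact this.mono_left nhdsWithin_le_nhds

lemma claimA (p u : Fin m → ℝ) (h0 : FC P d (fun i => ((p i : ℝ) : ℂ)) a b ≠ 0) (ζ c : ℝ) (hc : c ≠ 0) (μ : ℕ)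
    (hμ : (μ : ℕ∞) ≤ ordAt (FR P d) (p, ![c * (ζ * a - b), c * (ζ * b + a)])) :
    BB (fun t => qn P d a b (pt p u t)) ζ μ := by
  have hF : Tendsto (fun t : ℝ => FC P d (pt p u t) a b) (𝓝[>] 0)
      (𝓝 (FC P d (fun i => ((p i : ℝ) : ℂ)) a b)) := ((FC_cont P d a b).tendsto _).comp (pt_tendsto p u)
  have hne := hF.eventually_ne h0
  have hinv : (fun t : ℝ => (FC P d (pt p u t) a b)⁻¹) =O[𝓝[>] 0] fun _ => (1 : ℝ) :=
    (hF.inv₀ h0).isBigO_one ℝ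
  have key : ∀ β : ℕ, (fun t : ℝ => (qn P d a b (pt p u t)).eval (ζ + t * (β : ℂ))) =O[𝓝[>] 0] fun t => t ^ μ := by
    intro β
    have h1 := ord_O1 _ _ (FR_analytic P d _) μ hμ (u, ![c * β * a, c * β * b])
    have h1' : (fun t : ℝ => ((FR P d ((p, ![c * (ζ * a - b), c * (ζ * b + a)]) +
        t • (u, ![c * β * a, c * β * b])) : ℝ) : ℂ)) =O[𝓝[>] 0] fun t => t ^ μ := by
      refine IsBigO.trans (IsBigO.of_bound 1 (Eventually.of_forall fun t => ?_)) h1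
      rw [one_mul, Complex.norm_real]
    have h2 := (hinv.mul h1').const_mul_left ((c : ℂ) ^ d)⁻¹
    refine h2.congr' ?_ (by simp)
    filter_upwards [hne] with t ht
    have hc' : (c : ℂ) ≠ 0 := by exact_mod_cast hc
    have e1 : ((p, ![c * (ζ * a - b), c * (ζ * b + a)]) + t • (u, ![c * β * a, c * β * b]) :
      (Fin m → ℝ) × (Fin 2 → ℝ)) = (p + t • u, ![c * (ζ * a - b) + t * (c * β * a), c * (ζ * b + a) + t * (c * β * b)]) := by
      simp
    rw [e1, FR_FC, ← pt_real]
    have e2 := FC_lin P d a b (pt p u t) ht (c * (ζ + t * (β : ℂ))) c hc'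
    have e3 : c * (ζ + t * (β : ℂ)) / c = (ζ + t * (β : ℂ)) := by field_simp
    rw [e3] at e2
    have e4 : (((![c * (ζ * a - b) + t * (c * β * a), c * (ζ * b + a) + t * (c * β * b)] : Fin 2 → ℝ) 0 : ℝ) : ℂ) =
      c * (ζ + t * (β : ℂ)) * a - c * b := by simp; ring
    have e5 : (((![c * (ζ * a - b) + t * (c * β * a), c * (ζ * b + a) + t * (c * β * b)] : Fin 2 → ℝ) 1 : ℝ) : ℂ) =
      c * (ζ + t * (β : ℂ)) * b + c * a := by simp; ring
    rw [e4, e5, e2]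
    field_simp
  have hsum : (fun t : ℝ => ∑ β ∈ Finset.range (d + 1),
      ‖(qn P d a b (pt p u t)).eval (ζ + t * (β : ℂ))‖) =O[𝓝[>] 0] fun t => t ^ μ :=
    IsBigO.fun_sum fun β _ => (key β).norm_left
  unfold BB
  refine IsBigO.trans (IsBigO.of_bound ((2 * d + 3 : ℝ) ^ d) ?_) hsum
  filter_upwards [hne, self_mem_nhdsWithin] with t ht htp
  have htp : 0 < t := htp
  have hcard := roots_card P d a b _ ht
  obtain ⟨β, hβ, hpig⟩ := pigeon d _ hcard (ζ : ℂ) t htp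
  have hβd : (β : ℝ) ≤ d := by exact_mod_cast Nat.lt_succ_iff.1 (Finset.mem_range.1 hβ)
  have h1 := prod_le (qn P d a b (pt p u t)).roots (fun z => ‖z - ζ‖ + t)
    (fun z => ‖ζ + t * (β : ℂ) - z‖) (2 * d + 3) (fun z _ => by positivity) (fun z hz => by
      have h2 := hpig z hz
      have h3 : ‖z - ζ‖ ≤ ‖ζ + t * (β : ℂ) - z‖ + t * β := by
        calc ‖z - ζ‖ = ‖(t * (β : ℂ)) - (ζ + t * (β : ℂ) - z)‖ := by congr 1; ring
          _ ≤ ‖(t * (β : ℂ))‖ + _ := norm_sub_le _ _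
          _ = _ := by rw [norm_mul, Complex.norm_real, Complex.norm_natCast, Real.norm_of_nonneg htp.le, add_comm]
      have h5 : t * β ≤ t * d := by gcongr
      have h6 : t * (d + 1) ≤ 2 * ‖ζ + t * (β : ℂ) - z‖ * (d + 1) := by gcongr; linarith
      nlinarith)
  rw [hcard, ← norm_prod, ← qn_eval_roots P d a b _ ht] at h1
  have hnn : 0 ≤ ((qn P d a b (pt p u t)).roots.map (fun z : ℂ => ‖z - ζ‖ + t)).prod := by
    refine Multiset.prod_nonneg fun x hx => ?_
    obtain ⟨z, _, rfl⟩ := Multiset.mem_map.1 hx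
    positivity
  rw [Real.norm_of_nonneg hnn, Real.norm_of_nonneg (Finset.sum_nonneg fun _ _ => norm_nonneg _)]
  refine h1.trans ?_
  gcongr
  exact Finset.single_le_sum (f := fun β : ℕ => ‖(qn P d a b (pt p u t)).eval (ζ + t * (β : ℂ))‖)
    (fun _ _ => norm_nonneg _) hβ

lemma claimB (p : Fin m → ℝ) (W : Set (Fin m → ℝ)) (hW : IsOpen W) (hWne : W.Nonempty)
    (hab : a ^ 2 + b ^ 2 ≠ 0)
    (h0 : FC P d (fun i => ((p i : ℝ) : ℂ)) a b ≠ 0) (ζ c : ℝ) (hc : c ≠ 0) (μ : ℕ)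
    (hB : ∀ u ∈ W, BB (fun t => qn P d a b (pt p u t)) ζ μ) :
    (μ : ℕ∞) ≤ ordAt (FR P d) (p, ![c * (ζ * a - b), c * (ζ * b + a)]) := by
  refine ord_O2 _ _ (FR_analytic P d _) μ (W ×ˢ Set.univ) (hW.prod isOpen_univ)
    (hWne.prod Set.univ_nonempty) ?_
  rintro ⟨u, v⟩ ⟨hu, -⟩
  have hB := hB u hu
  have hF : Tendsto (fun t : ℝ => FC P d (pt p u t) a b) (𝓝[>] 0)
      (𝓝 (FC P d (fun i => ((p i : ℝ) : ℂ)) a b)) := ((FC_cont P d a b).tendsto _).comp (pt_tendsto p u)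
  have hne := hF.eventually_ne h0
  have hFO : (fun t : ℝ => FC P d (pt p u t) a b) =O[𝓝[>] 0] fun _ => (1 : ℝ) := hF.isBigO_one ℝ
  obtain ⟨α, hα⟩ : ∃ α, α = (v 0 * a + v 1 * b) / (a ^ 2 + b ^ 2) := ⟨_, rfl⟩
  obtain ⟨β, hβ⟩ : ∃ β, β = (v 1 * a - v 0 * b) / (a ^ 2 + b ^ 2) := ⟨_, rfl⟩
  have hv0 : v 0 = α * a - β * b := by rw [hα, hβ]; field_simp; ring
  have hv1 : v 1 = α * b + β * a := by rw [hα, hβ]; field_simp; ring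
  have hct : Tendsto (fun t : ℝ => c + t * β) (𝓝[>] 0) (𝓝 c) := by
    have : Continuous (fun t : ℝ => c + t * β) := by fun_prop
    have := this.tendsto 0
    simp only [zero_mul, add_zero] at this
    exact this.mono_left nhdsWithin_le_nhds
  have hcne := hct.eventually_ne hc
  have hcO : (fun t : ℝ => (((c + t * β : ℝ) : ℂ)) ^ d) =O[𝓝[>] 0] fun _ => (1 : ℝ) := by
    refine Tendsto.isBigO_one ℝ (c := (c : ℂ) ^ d) ?_
    exact ((Complex.continuous_ofReal.tendsto c).comp hct).pow d
  have hlim : Tendsto (fun t : ℝ => (α - β * ζ) / (c + t * β)) (𝓝[>] 0) (𝓝 ((α - β * ζ) / c)) :=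
    tendsto_const_nhds.div hct hc
  set M : ℝ := |(α - β * ζ) / c| + 1 with hM
  have hM1 : 1 ≤ M := by rw [hM]; linarith [abs_nonneg ((α - β * ζ) / c)]
  have hbd : ∀ᶠ t in 𝓝[>] (0 : ℝ), |(α - β * ζ) / (c + t * β)| < M :=
    hlim.abs.eventually_lt_const (by rw [hM]; linarith)
  have hq : (fun t : ℝ => (qn P d a b (pt p u t)).eval (((c * ζ + t * α) / (c + t * β) : ℝ) : ℂ))
      =O[𝓝[>] 0] fun t => t ^ μ := by
    refine IsBigO.trans (IsBigO.of_bound (M ^ d) ?_) hB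
    filter_upwards [hne, hcne, hbd, self_mem_nhdsWithin] with t ht hct hb htp
    have htp : 0 < t := htp
    have hcard := roots_card P d a b _ ht
    rw [qn_eval_roots P d a b _ ht, norm_prod]
    have hnn : 0 ≤ ((qn P d a b (pt p u t)).roots.map (fun z : ℂ => ‖z - ζ‖ + t)).prod := by
      refine Multiset.prod_nonneg fun x hx => ?_
      obtain ⟨z, _, rfl⟩ := Multiset.mem_map.1 hx
      positivity
    rw [Real.norm_of_nonneg hnn]
    have h1 := prod_le (qn P d a b (pt p u t)).roots
      (fun z => ‖(((c * ζ + t * α) / (c + t * β) : ℝ) : ℂ) - z‖) (fun z => ‖z - ζ‖ + t) M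
      (fun z _ => norm_nonneg _) (fun z _ => by
        have e1 : (c * ζ + t * α) / (c + t * β) - ζ = t * ((α - β * ζ) / (c + t * β)) := by
          field_simp; ring
        have e2 : ‖(((c * ζ + t * α) / (c + t * β) : ℝ) : ℂ) - ζ‖ ≤ t * M := by
          rw [← Complex.ofReal_sub, Complex.norm_real, e1, norm_mul, Real.norm_of_nonneg htp.le, Real.norm_eq_abs]
          gcongr
        have e3 : ‖(((c * ζ + t * α) / (c + t * β) : ℝ) : ℂ) - z‖ ≤
            ‖(((c * ζ + t * α) / (c + t * β) : ℝ) : ℂ) - ζ‖ + ‖z - ζ‖ := by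
          rw [norm_sub_rev z]; exact norm_sub_le_norm_sub_add_norm_sub _ _ _
        have := norm_nonneg (z - ζ)
        nlinarith)
    rw [hcard] at h1
    have hnn2 : 0 ≤ ((qn P d a b (pt p u t)).roots.map (fun z => ‖(((c * ζ + t * α) / (c + t * β) : ℝ) : ℂ) - z‖)).prod := by
      refine Multiset.prod_nonneg fun x hx => ?_
      obtain ⟨z, _, rfl⟩ := Multiset.mem_map.1 hx
      positivity
    exact h1
  have h3 := (hcO.mul hFO).mul hq
  simp only [one_mul] at h3
  refine IsBigO.trans (IsBigO.of_bound 1 ?_) h3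
  filter_upwards [hne, hcne] with t ht hct
  have e1 : ((p, ![c * (ζ * a - b), c * (ζ * b + a)]) + t • (u, v) :
      (Fin m → ℝ) × (Fin 2 → ℝ)) = (p + t • u, ![c * (ζ * a - b), c * (ζ * b + a)] + t • v) := by
      simp
  rw [one_mul, e1, ← Complex.norm_real, FR_FC, ← pt_real]
  have hct' : ((c + t * β : ℝ) : ℂ) ≠ 0 := by exact_mod_cast hct
  have e2 := FC_lin P d a b (pt p u t) ht ((c * ζ + t * α : ℝ) : ℂ) ((c + t * β : ℝ) : ℂ) hct'
  rw [Complex.ofReal_div, ← e2]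
  refine le_of_eq ?_
  congr 2
  · simp [hv0]; ring
  · simp [hv1]; ring

end LPD


namespace LPD
open Polynomial Filter Topology Asymptotics

lemma track {d : ℕ} (Y : Fin d → ℝ → ℂ) (hY : ∀ i, Continuous (Y i))
    (hsep : ∀ i j x x', Y i x = Y j x → Y i x' = Y j x') (r : ℝ) (hr : 0 < r)
    (hdis : ∀ i j, Y i 0 ≠ Y j 0 → ∀ z, ‖z - Y i 0‖ < r → ‖z - Y j 0‖ < r → False)
    (hnear : ∀ x i, ∃ j, ‖Y j x - Y i 0‖ < r) : ∀ i x, ‖Y i x - Y i 0‖ < r := by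
  classical
  have hall : ∀ x i, ∃ j, ‖Y i x - Y j 0‖ < r := by
    intro x i
    set A0 := Finset.univ.image (fun i => Y i 0) with hA0
    set A1 := Finset.univ.image (fun i => Y i x) with hA1
    have hcard : A1.card ≤ A0.card := by
      have : ∀ β ∈ A1, ∃ i, Y i x = β := fun β hβ => by simpa [hA1] using hβ
      have : Nonempty (Fin d) := ⟨i⟩
      rename_i hh
      choose! ι hι using hh
      refine Finset.card_le_card_of_injOn (fun β => Y (ι β) 0) (fun β hβ => ?_) ?_
      · simp [hA0]
      · intro β hβ β' hβ' h
        rw [← hι β hβ, ← hι β' hβ']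
        exact hsep _ _ 0 x h
    have : ∀ α ∈ A0, ∃ z ∈ A1, ‖z - α‖ < r := by
      intro α hα
      obtain ⟨i, -, rfl⟩ := Finset.mem_image.1 hα
      obtain ⟨j, hj⟩ := hnear x i
      exact ⟨Y j x, Finset.mem_image_of_mem _ (Finset.mem_univ _), hj⟩
    choose! f hf1 hf2 using this
    have hinj : Set.InjOn f A0 := by
      intro α hα β hβ h
      by_contra hne
      have h1 := hf2 α hα
      have h2 := hf2 β hβ
      rw [h] at h1
      obtain ⟨i, -, rfl⟩ := Finset.mem_image.1 hα
      obtain ⟨j, -, rfl⟩ := Finset.mem_image.1 hβ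
      exact hdis i j hne _ h1 h2
    have him : A0.image f = A1 := by
      refine Finset.eq_of_subset_of_card_le (fun z hz => ?_) ?_
      · obtain ⟨α, hα, rfl⟩ := Finset.mem_image.1 hz
        exact hf1 α hα
      · rw [Finset.card_image_of_injOn hinj]; exact hcard
    have hi : Y i x ∈ A0.image f := by
      rw [him]; exact Finset.mem_image_of_mem _ (Finset.mem_univ _)
    obtain ⟨α, hα, h⟩ := Finset.mem_image.1 hi
    have h2 := hf2 α hα
    obtain ⟨j, -, rfl⟩ := Finset.mem_image.1 hα
    exact ⟨j, by rw [← h]; exact h2⟩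
  intro i
  have hopen : ∀ j, IsOpen {x | ‖Y i x - Y j 0‖ < r} := fun j =>
    isOpen_lt ((hY i).sub continuous_const).norm continuous_const
  have hcl : IsClosed {x | ‖Y i x - Y i 0‖ < r} := by
    rw [← isOpen_compl_iff]
    have : {x | ‖Y i x - Y i 0‖ < r}ᶜ = ⋃ j ∈ {j | Y i 0 ≠ Y j 0}, {x | ‖Y i x - Y j 0‖ < r} := by
      ext x
      simp only [Set.mem_compl_iff, Set.mem_iUnion, Set.mem_ofPred_eq, exists_prop]
      constructor
      · intro h
        obtain ⟨j, hj⟩ := hall x i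
        refine ⟨j, fun he => h ?_, hj⟩
        rw [he]; exact hj
      · rintro ⟨j, hj, h⟩ h'
        exact hdis i j hj _ h' h
    rw [this]
    exact isOpen_biUnion fun j _ => hopen j
  have huniv := IsClopen.eq_univ ⟨hcl, hopen i⟩ ⟨0, by simpa using hr⟩
  intro x
  have : x ∈ {x | ‖Y i x - Y i 0‖ < r} := by rw [huniv]; trivial
  exact this

noncomputable def cm {m : ℕ} (p : Fin m → ℝ) : Fin m → ℂ := fun i => ((p i : ℝ) : ℂ)

variable {m : ℕ} (P : Polynomial (MvPolynomial (Fin m) ℝ)) (d : ℕ) (a b : ℝ)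

theorem key (hab : a ^ 2 + b ^ 2 ≠ 0) (N W : Set (Fin m → ℝ)) (ε : ℝ) (hε : 0 < ε)
    (hFC : ∀ p ∈ N, ∀ u ∈ W, ∀ t : ℂ, ‖t‖ < ε → FC P d (pt p u t) a b ≠ 0)
    (hD : ∀ p ∈ N, ∀ u ∈ W, ∀ t : ℂ, t ≠ 0 → ‖t‖ < ε → MvPolynomial.aeval (pt p u t) (discFixed d P) ≠ 0)
    (s p : Fin m → ℝ) (hsp : JoinedIn N s p) (r : ℝ) (hr : 0 < r)
    (hdis : ∀ α β, (qn P d a b (cm s)).eval α = 0 → (qn P d a b (cm s)).eval β = 0 → α ≠ β →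
      ∀ z, ‖z - α‖ < r → ‖z - β‖ < r → False)
    (hnear : ∀ x ∈ N, ∀ α, (qn P d a b (cm s)).eval α = 0 → ∃ z, (qn P d a b (cm x)).eval z = 0 ∧ ‖z - α‖ < r)
    (u : Fin m → ℝ) (hu : u ∈ W) :
    (∀ z, (qn P d a b (cm p)).eval z = 0 → ∃ α, (qn P d a b (cm s)).eval α = 0 ∧ ‖z - α‖ < r) ∧
    (∀ α z z', (qn P d a b (cm s)).eval α = 0 → (qn P d a b (cm p)).eval z = 0 → (qn P d a b (cm p)).eval z' = 0 →
      ‖z - α‖ < r → ‖z' - α‖ < r → z = z') ∧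
    (∀ α z, (qn P d a b (cm s)).eval α = 0 → (qn P d a b (cm p)).eval z = 0 → ‖z - α‖ < r →
      (qn P d a b (cm s)).rootMultiplicity α = (qn P d a b (cm p)).rootMultiplicity z) ∧
    (∀ α z, (qn P d a b (cm s)).eval α = 0 → (qn P d a b (cm p)).eval z = 0 → ‖z - α‖ < r →
      ∀ μ, BB (fun t => qn P d a b (pt s u t)) α μ ↔ BB (fun t => qn P d a b (pt p u t)) z μ) := by
  classical
  set γ := hsp.somePath.extend with hγ
  have hγN : ∀ x, γ x ∈ N := by
    intro x
    have : γ x ∈ Set.range γ := ⟨x, rfl⟩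
    rw [hγ, Path.extend_range] at this
    obtain ⟨y, hy⟩ := this
    rw [hγ, ← hy]
    exact hsp.somePath_mem y
  have hγc : Continuous γ := hsp.somePath.continuous_extend
  have hγ0 : γ 0 = s := hsp.somePath.extend_zero
  have hγ1 : γ 1 = p := hsp.somePath.extend_one
  have hptc : Continuous fun y : ℝ × ℂ => pt (γ y.1) u y.2 :=
    pt_cont.comp ((hγc.comp continuous_fst).prodMk (continuous_const.prodMk continuous_snd))
  obtain ⟨Y, hYc, hYprod, hYsep, hYBB⟩ := transfer (fun x t => qn P d a b (pt (γ x) u t)) d ε hε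
    (fun x t ht => qn_monic P d a b _ (hFC _ (hγN x) u hu t ht))
    (fun x t ht0 ht => qn_nodup P d a b _ hab (hFC _ (hγN x) u hu t ht) (hD _ (hγN x) u hu t ht0 ht))
    (fun k => by
      simp only [qn_coeff]
      refine ContinuousOn.mul (ContinuousOn.inv₀ ?_ ?_) ?_
      · exact ((FC_cont P d a b).comp hptc).continuousOn
      · intro y hy; exact hFC _ (hγN _) u hu _ hy
      · exact ((QC_coeff_cont P d a b k).comp hptc).continuousOn)
    (fun k x => by
      simp only [qn_coeff]
      refine DifferentiableOn.fun_mul (DifferentiableOn.fun_inv ?_ ?_) ?_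
      · exact (FC_diff P d (γ x) u a b).differentiableOn
      · intro y hy; exact hFC _ (hγN _) u hu _ hy
      · exact (QC_coeff_diff P d a b (γ x) u k).differentiableOn)
  have hq : ∀ x, qn P d a b (cm (γ x)) = ∏ i, (X - C (Y i x)) := by
    intro x; rw [← hYprod x, pt_zero]; rfl
  have hqs := hq 0
  have hqp := hq 1
  rw [hγ0] at hqs
  rw [hγ1] at hqp
  have hroot : ∀ x z, (qn P d a b (cm (γ x))).eval z = 0 ↔ ∃ i, Y i x = z := by
    intro x z
    rw [hq, eval_prod_roots, Finset.prod_eq_zero_iff]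
    simp only [Finset.mem_univ, true_and, sub_eq_zero]
    exact ⟨fun ⟨i, h⟩ => ⟨i, h.symm⟩, fun ⟨i, h⟩ => ⟨i, h.symm⟩⟩
  have hroots := hroot 0
  have hrootp := hroot 1
  rw [hγ0] at hroots
  rw [hγ1] at hrootp
  have htr := track Y hYc hYsep r hr
    (fun i j hij => hdis _ _ ((hroots _).2 ⟨i, rfl⟩) ((hroots _).2 ⟨j, rfl⟩) hij)
    (fun x i => by
      obtain ⟨z, hz, hz2⟩ := hnear _ (hγN x) _ ((hroots _).2 ⟨i, rfl⟩)
      obtain ⟨j, rfl⟩ := (hroot x z).1 hz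
      exact ⟨j, hz2⟩)
  have hback : ∀ α i, (qn P d a b (cm s)).eval α = 0 → ‖Y i 1 - α‖ < r → Y i 0 = α := by
    intro α i hα h
    by_contra hne
    exact hdis _ _ ((hroots _).2 ⟨i, rfl⟩) hα hne _ (htr i 1) h
  refine ⟨?_, ?_, ?_, ?_⟩
  · intro z hz
    obtain ⟨i, rfl⟩ := (hrootp z).1 hz
    exact ⟨Y i 0, (hroots _).2 ⟨i, rfl⟩, htr i 1⟩
  · intro α z z' hα hz hz' h h'
    obtain ⟨i, rfl⟩ := (hrootp z).1 hz
    obtain ⟨j, rfl⟩ := (hrootp z').1 hz'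
    refine hYsep i j 0 1 ?_
    rw [hback α i hα h, hback α j hα h']
  · intro α z hα hz h
    obtain ⟨i, rfl⟩ := (hrootp z).1 hz
    have hα' := hback α i hα h
    rw [← count_roots, ← count_roots, hqs, hqp, roots_prod_eq, roots_prod_eq, Multiset.count_map, Multiset.count_map]
    congr 1
    refine Multiset.filter_congr fun j _ => ?_
    rw [← hα']
    exact ⟨fun h => hYsep i j 0 1 h, fun h => hYsep i j 1 0 h⟩
  · intro α z hα hz h μ
    obtain ⟨i, rfl⟩ := (hrootp z).1 hz
    have hα' := hback α i hα h
    rw [← hα']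
    have h1 := hYBB i 0 1 μ
    have h2 := hYBB i 1 0 μ
    simp only [hγ0, hγ1] at h1 h2
    exact ⟨h1, h2⟩

end LPD


namespace LPD
open Polynomial Filter Topology Asymptotics

variable {m : ℕ} (P : Polynomial (MvPolynomial (Fin m) ℝ)) (d : ℕ) (a b : ℝ)

lemma FC_conj (p : Fin m → ℝ) (v0 v1 : ℂ) : FC P d (cm p) (starRingEnd ℂ v0) (starRingEnd ℂ v1) =
    starRingEnd ℂ (FC P d (cm p) v0 v1) := by
  unfold FC coefC cm
  simp only [aeval_real, map_sum, map_mul, map_pow, Complex.conj_ofReal]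

lemma qn_conj (p : Fin m → ℝ) (z : ℂ) (h : (qn P d a b (cm p)).eval z = 0) :
    (qn P d a b (cm p)).eval (starRingEnd ℂ z) = 0 := by
  unfold qn at *
  rw [eval_C_mul, QC_eval] at *
  have h1 : (a : ℂ) * starRingEnd ℂ z - b = starRingEnd ℂ (a * z - b) := by simp
  have h2 : (b : ℂ) * starRingEnd ℂ z + a = starRingEnd ℂ (b * z + a) := by simp
  rw [h1, h2, FC_conj]
  rcases mul_eq_zero.1 h with h | h
  · rw [h, zero_mul]
  · rw [h]; simp

noncomputable def vec (ζ : ℝ) : Fin 2 → ℝ := ![ζ * a - b, ζ * b + a]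

lemma vec_ne (hab : a ^ 2 + b ^ 2 ≠ 0) (ζ : ℝ) : vec a b ζ ≠ 0 := by
  intro h
  have h0 := congrFun h 0
  have h1 := congrFun h 1
  simp [vec] at h0 h1
  apply hab
  linear_combination (-b) * h0 + a * h1

noncomputable def pv (hab : a ^ 2 + b ^ 2 ≠ 0) (ζ : ℝ) : RP1 := Projectivization.mk ℝ (vec a b ζ) (vec_ne a b hab ζ)

lemma pv_inj (hab : a ^ 2 + b ^ 2 ≠ 0) (ζ ζ' : ℝ) (h : pv a b hab ζ = pv a b hab ζ') : ζ = ζ' := by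
  obtain ⟨c, hc⟩ := (Projectivization.mk_eq_mk_iff' ℝ _ _ _ _).1 h
  have h0 := congrFun hc 0
  have h1 := congrFun hc 1
  simp [vec] at h0 h1
  have hc1 : c = 1 := by
    have : (c - 1) * (a ^ 2 + b ^ 2) = 0 := by linear_combination (-b) * h0 + a * h1
    rcases mul_eq_zero.1 this with h | h
    · linarith
    · exact absurd h hab
  subst hc1
  have : (ζ' - ζ) * (a ^ 2 + b ^ 2) = 0 := by linear_combination a * h0 + b * h1
  rcases mul_eq_zero.1 this with h | h
  · linarith
  · exact absurd h hab

lemma pv_cont (hab : a ^ 2 + b ^ 2 ≠ 0) : Continuous (pv a b hab) := by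
  have h1 : Continuous fun ζ : ℝ => (⟨vec a b ζ, vec_ne a b hab ζ⟩ : {v : Fin 2 → ℝ // v ≠ 0}) := by
    refine Continuous.subtype_mk ?_ _
    unfold vec
    refine continuous_pi fun i => ?_
    fin_cases i
    · simp; fun_prop
    · simp; fun_prop
  exact (continuous_quotient_mk' (s := projectivizationSetoid ℝ (Fin 2 → ℝ))).comp h1

lemma pv_eq (hab : a ^ 2 + b ^ 2 ≠ 0) (ζ : ℝ) (v : Fin 2 → ℝ) (hv : v ≠ 0)
    (h : pv a b hab ζ = Projectivization.mk ℝ v hv) :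
    ∃ c : ℝ, c ≠ 0 ∧ v = ![c * (ζ * a - b), c * (ζ * b + a)] := by
  obtain ⟨c, hc⟩ := (Projectivization.mk_eq_mk_iff' ℝ _ _ _ _).1 h.symm
  refine ⟨c, ?_, ?_⟩
  · rintro rfl; apply hv; rw [← hc]; simp
  · rw [← hc]; ext i; fin_cases i <;> simp [vec]

/-! zero set -/
lemma zero_iff (hab : a ^ 2 + b ^ 2 ≠ 0) (p : Fin m → ℝ) (h0 : FC P d (cm p) a b ≠ 0) (v : Fin 2 → ℝ) (hv : v ≠ 0) :
    FR P d (p, v) = 0 ↔ ∃ ζ : ℝ, (qn P d a b (cm p)).eval (ζ : ℂ) = 0 ∧ pv a b hab ζ = Projectivization.mk ℝ v hv := by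
  have hcast : FR P d (p, v) = 0 ↔ FC P d (cm p) (v 0) (v 1) = 0 := by
    unfold cm; rw [← FR_FC]; exact Complex.ofReal_eq_zero.symm
  rw [hcast]
  constructor
  · intro h
    obtain ⟨α, hα⟩ : ∃ α, α = (v 0 * a + v 1 * b) / (a ^ 2 + b ^ 2) := ⟨_, rfl⟩
    obtain ⟨β, hβ⟩ : ∃ β, β = (v 1 * a - v 0 * b) / (a ^ 2 + b ^ 2) := ⟨_, rfl⟩
    have hv0 : v 0 = α * a - β * b := by rw [hα, hβ]; field_simp; ring
    have hv1 : v 1 = α * b + β * a := by rw [hα, hβ]; field_simp; ring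
    by_cases hβ0 : β = 0
    · exfalso
      rw [hβ0] at hv0 hv1
      rw [hv0, hv1] at h
      have hα0 : α ≠ 0 := by
        intro hα0
        apply hv
        ext i; fin_cases i
        · simp [hv0, hα0]
        · simp [hv1, hα0]
      have := FC_smul P d (cm p) α a b
      push_cast at h
      rw [zero_mul, sub_zero, zero_mul, add_zero, this] at h
      have hα1 : (α : ℂ) ≠ 0 := by exact_mod_cast hα0
      exact mul_ne_zero (pow_ne_zero _ hα1) h0 h
    · have hβ1 : (β : ℂ) ≠ 0 := by exact_mod_cast hβ0
      have := FC_lin P d a b (cm p) h0 α β hβ1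
      refine ⟨α / β, ?_, ?_⟩
      · rw [hv0, hv1] at h
        push_cast at h ⊢
        rw [this] at h
        rcases mul_eq_zero.1 h with h | h
        · exact absurd h (mul_ne_zero (pow_ne_zero _ hβ1) h0)
        · exact h
      · refine (Projectivization.mk_eq_mk_iff' ℝ _ _ _ _).2 ⟨β⁻¹, ?_⟩
        ext i; fin_cases i
        · simp [vec, hv0]; field_simp
        · simp [vec, hv1]; field_simp
  · rintro ⟨ζ, hζ, h⟩
    obtain ⟨c, hc, rfl⟩ := pv_eq a b hab ζ v hv h
    have hc' : (c : ℂ) ≠ 0 := by exact_mod_cast hc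
    have := FC_lin P d a b (cm p) h0 (c * ζ) c hc'
    rw [mul_div_cancel_left₀ _ hc', hζ, mul_zero] at this
    rw [← this]
    congr 1
    · simp; ring
    · simp; ring

lemma homog_eval (e : ℕ) (R : ℝ[X]) (hR : R.natDegree ≤ e) (y : Fin 2 → ℝ) (hy : y 1 ≠ 0) :
    MvPolynomial.eval y (homog e R) = y 1 ^ e * R.eval (y 0 / y 1) := by
  rw [eval_eq_sum_range' (n := e + 1) (by omega), Finset.mul_sum]
  simp only [homog, map_sum, map_mul, map_pow, MvPolynomial.eval_C, MvPolynomial.eval_X]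
  refine Finset.sum_congr rfl fun k hk => ?_
  have : e = k + (e - k) := by have := Finset.mem_range.1 hk; omega
  have h2 : y 1 ^ e = y 1 ^ k * y 1 ^ (e - k) := by rw [← pow_add, ← this]
  rw [h2, div_pow]
  field_simp

lemma mult_real (hab : a ^ 2 + b ^ 2 ≠ 0) (p : Fin m → ℝ) (h0 : FC P d (cm p) a b ≠ 0) (ζ c : ℝ) (hc : c ≠ 0) :
    HasProjRootOfMult (homog d (evalP P p)) ![c * (ζ * a - b), c * (ζ * b + a)]
      ((qn P d a b (cm p)).rootMultiplicity (ζ : ℂ)) := by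
  classical
  set QR : ℝ[X] := ∑ k ∈ Finset.range (d + 1),
    C (MvPolynomial.eval p (P.coeff k)) * (C a * X - C b) ^ k * (C b * X + C a) ^ (d - k) with hQR
  have hmap : QR.map Complex.ofRealHom = QC P d a b (cm p) := by
    have hk : ∀ k, coefC P k (cm p) = ((MvPolynomial.eval p (P.coeff k) : ℝ) : ℂ) := fun k => aeval_real _ _
    rw [hQR, QC]
    simp [Polynomial.map_sum, hk]
  have hQC0 : QC P d a b (cm p) ≠ 0 := by
    intro h
    have := QC_coeff_d P d a b (cm p)
    rw [h, coeff_zero] at this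
    exact h0 this.symm
  have hQR0 : QR ≠ 0 := by
    rintro h; rw [h, Polynomial.map_zero] at hmap; exact hQC0 hmap.symm
  have hmult : (qn P d a b (cm p)).rootMultiplicity (ζ : ℂ) = QR.rootMultiplicity ζ := by
    rw [← count_roots, qn, roots_C_mul _ (inv_ne_zero h0), count_roots, ← hmap]
    exact (eq_rootMultiplicity_map (f := Complex.ofRealHom) Complex.ofReal_injective ζ).symm
  rw [hmult]
  obtain ⟨R, hR, hR0⟩ := exists_eq_pow_rootMultiplicity_mul_and_not_dvd QR hQR0 ζ
  set μ := QR.rootMultiplicity ζ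
  have hRne : R ≠ 0 := by rintro rfl; exact hR0 (dvd_zero _)
  have hdeg : QR.natDegree ≤ d := by
    have := QC_natDegree_le P d a b (cm p)
    rw [← hmap, natDegree_map_eq_of_injective Complex.ofReal_injective] at this
    exact this
  have hdeg2 : QR.natDegree = μ + R.natDegree := by
    rw [hR, natDegree_mul (pow_ne_zero _ (X_sub_C_ne_zero ζ)) hRne, natDegree_pow, natDegree_X_sub_C, mul_one]
  have hRζ : R.eval ζ ≠ 0 := fun h => hR0 (dvd_iff_isRoot.2 h)
  set Δ := a ^ 2 + b ^ 2 with hΔ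
  set y0 : MvPolynomial (Fin 2) ℝ := MvPolynomial.C (a / Δ) * MvPolynomial.X 0 + MvPolynomial.C (b / Δ) * MvPolynomial.X 1 with hy0
  set y1 : MvPolynomial (Fin 2) ℝ := MvPolynomial.C (a / Δ) * MvPolynomial.X 1 - MvPolynomial.C (b / Δ) * MvPolynomial.X 0 with hy1
  have ey0 : ∀ w, MvPolynomial.eval w y0 = a / Δ * w 0 + b / Δ * w 1 := by intro w; simp [hy0]
  have ey1 : ∀ w, MvPolynomial.eval w y1 = a / Δ * w 1 - b / Δ * w 0 := by intro w; simp [hy1]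
  set G := MvPolynomial.aeval ![y0, y1] (homog (d - μ) R) with hG
  have eG : ∀ w, MvPolynomial.eval w G = MvPolynomial.eval ![MvPolynomial.eval w y0, MvPolynomial.eval w y1] (homog (d - μ) R) := by
    intro w
    simp [hG, homog]
  have hdm : R.natDegree ≤ d - μ := by omega
  have hy1ne : y1 ≠ 0 := by
    intro h
    have := ey1 ![-b, a]
    rw [h] at this
    simp at this
    have h2 : a / Δ * a + b / Δ * b = 1 := by rw [hΔ]; rw [hΔ] at hab; field_simp
    linarith
  refine ⟨MvPolynomial.C ((c * Δ)⁻¹ ^ μ) * G, ?_, ?_⟩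
  · refine mul_right_cancel₀ hy1ne ?_
    refine MvPolynomial.funext fun w => ?_
    rw [map_mul, map_mul]
    by_cases hw : MvPolynomial.eval w y1 = 0
    · rw [hw, mul_zero, mul_zero]
    refine (mul_left_inj' hw).2 ?_
    rw [map_mul, map_mul, eG, homog_eval _ _ hdm _ (by simpa using hw)]
    obtain ⟨α, hα⟩ : ∃ α, α = MvPolynomial.eval w y0 := ⟨_, rfl⟩
    obtain ⟨β, hβ⟩ : ∃ β, β = MvPolynomial.eval w y1 := ⟨_, rfl⟩
    rw [← hα, ← hβ]
    rw [← hβ] at hw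
    rw [ey0] at hα
    rw [ey1] at hβ
    have hw0 : w 0 = β * (a * (α / β) - b) := by
      have : w 0 = α * a - β * b := by rw [hα, hβ, hΔ]; rw [hΔ] at hab; field_simp; ring
      rw [this]; field_simp
    have hw1 : w 1 = β * (b * (α / β) + a) := by
      have : w 1 = α * b + β * a := by rw [hα, hβ, hΔ]; rw [hΔ] at hab; field_simp; ring
      rw [this]; field_simp
    have hF : MvPolynomial.eval w (homog d (evalP P p)) = β ^ d * QR.eval (α / β) := by
      have h1 := FR_FC P d p w
      rw [hw0, hw1] at h1
      push_cast at h1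
      rw [FC_smul] at h1
      have h2 := QC_eval P d a b (cm p) ((α / β : ℝ) : ℂ)
      rw [← hmap] at h2
      have h3 : (QR.map Complex.ofRealHom).eval ((α / β : ℝ) : ℂ) = ((QR.eval (α / β) : ℝ) : ℂ) := by
        have := eval_map_apply (f := Complex.ofRealHom) (p := QR) (α / β)
        exact this
      rw [h3] at h2
      push_cast at h2
      unfold cm at h2
      rw [← h2] at h1
      have h4 : FR P d (p, w) = β ^ d * QR.eval (α / β) := by exact_mod_cast h1
      exact h4
    rw [hF, hR]
    simp only [eval_mul, eval_pow, eval_sub, eval_X, eval_C, MvPolynomial.eval_C, map_pow, map_sub, map_mul,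
      MvPolynomial.eval_X, Matrix.cons_val_zero, Matrix.cons_val_one]
    have hβd : β ^ d = β ^ μ * β ^ (d - μ) := by rw [← pow_add]; congr 1; omega
    have hlin : c * (ζ * b + a) * w 0 - c * (ζ * a - b) * w 1 = (c * Δ) * (β * (α / β - ζ)) := by
      rw [hw0, hw1, hΔ]; field_simp; ring
    rw [hlin, hβd, mul_pow (c * Δ), inv_pow, mul_pow β]
    have hcΔ : (c * Δ) ^ μ ≠ 0 := pow_ne_zero _ (mul_ne_zero hc hab)
    generalize (c * Δ) ^ μ = q at *
    generalize R.eval (α / β) = q2 at *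
    generalize (α / β - ζ) ^ μ = q3 at *
    field_simp
  · have e0 : MvPolynomial.eval ![c * (ζ * a - b), c * (ζ * b + a)] y0 = c * ζ := by
      rw [ey0]; simp [hΔ]; rw [hΔ] at hab; field_simp; ring
    have e1 : MvPolynomial.eval ![c * (ζ * a - b), c * (ζ * b + a)] y1 = c := by
      rw [ey1]; simp [hΔ]; rw [hΔ] at hab; field_simp; ring
    rw [map_mul, eG, e0, e1, homog_eval _ _ hdm _ (by simpa using hc), MvPolynomial.eval_C]
    have : (![c * ζ, c] : Fin 2 → ℝ) 0 / (![c * ζ, c] : Fin 2 → ℝ) 1 = ζ := by simp; field_simp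
    rw [this]
    refine mul_ne_zero (pow_ne_zero _ (inv_ne_zero (mul_ne_zero hc hab))) (mul_ne_zero (pow_ne_zero _ (by simpa using hc)) hRζ)

end LPD


namespace LPD
open Polynomial Filter Topology Asymptotics

lemma cm_cont {m : ℕ} : Continuous (cm : (Fin m → ℝ) → Fin m → ℂ) := by
  unfold cm; fun_prop

lemma submanifold_nhd {m : ℕ} (S : Set (Fin m → ℝ)) (hsub : IsAnalyticSubmanifold S) (s : Fin m → ℝ) (hs : s ∈ S)
    (V0 : Set (Fin m → ℝ)) (hV0 : V0 ∈ 𝓝 s) :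
    ∃ N : Set (Fin m → ℝ), N ⊆ S ∧ N ⊆ V0 ∧ s ∈ N ∧ N ∈ 𝓝[S] s ∧ IsPathConnected N := by
  obtain ⟨U, V, φ, ψ, L, hU, hV, hsU, hφ, hψ, hφm, hψm, hψφ, hφψ, him⟩ := hsub s hs
  have hφs : φ s ∈ V := hφm hsU
  have hψφs : ψ (φ s) = s := hψφ hsU
  have hψc : ContinuousAt ψ (φ s) := (hψ _ hφs).continuousAt
  have hφc : ContinuousAt φ s := (hφ _ hsU).continuousAt
  have h1 : ψ ⁻¹' V0 ∈ 𝓝 (φ s) := hψc (by rw [hψφs]; exact hV0)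
  obtain ⟨ρ, hρ, hball⟩ := Metric.mem_nhds_iff.1 (Filter.inter_mem h1 (hV.mem_nhds hφs))
  have hφsL : φ s ∈ (L : Set (Fin m → ℝ)) := by
    have : φ s ∈ V ∩ (L : Set (Fin m → ℝ)) := by rw [← him]; exact ⟨s, ⟨hsU, hs⟩, rfl⟩
    exact this.2
  have hmem : φ s ∈ Metric.ball (φ s) ρ ∩ (L : Set (Fin m → ℝ)) := ⟨Metric.mem_ball_self hρ, hφsL⟩
  refine ⟨ψ '' (Metric.ball (φ s) ρ ∩ L), ?_, ?_, ?_, ?_, ?_⟩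
  · rintro _ ⟨y, ⟨hy, hyL⟩, rfl⟩
    have : y ∈ φ '' (U ∩ S) := by rw [him]; exact ⟨(hball hy).2, hyL⟩
    obtain ⟨x, ⟨hxU, hxS⟩, rfl⟩ := this
    have : ψ (φ x) = x := hψφ hxU
    rw [this]; exact hxS
  · rintro _ ⟨y, ⟨hy, hyL⟩, rfl⟩
    exact (hball hy).1
  · exact ⟨φ s, hmem, hψφs⟩
  · rw [mem_nhdsWithin_iff_eventually]
    filter_upwards [hφc (Metric.ball_mem_nhds _ hρ), hU.mem_nhds hsU] with x hx hxU hxS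
    have hL : φ x ∈ V ∩ (L : Set (Fin m → ℝ)) := by rw [← him]; exact ⟨x, ⟨hxU, hxS⟩, rfl⟩
    exact ⟨φ x, ⟨hx, hL.2⟩, hψφ hxU⟩
  · have hconv : Convex ℝ (Metric.ball (φ s) ρ ∩ (L : Set (Fin m → ℝ))) := (convex_ball _ _).inter L.convex
    refine (hconv.isPathConnected ⟨_, hmem⟩).image' ?_
    intro y hy
    exact (hψ y (hball hy.1).2).continuousAt.continuousWithinAt

theorem main_local {m : ℕ} (P : Polynomial (MvPolynomial (Fin m) ℝ)) (d : ℕ) (a b : ℝ)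
    (hab : a ^ 2 + b ^ 2 ≠ 0) (N W : Set (Fin m → ℝ)) (hW : IsOpen W) (hWne : W.Nonempty) (ε : ℝ) (hε : 0 < ε)
    (hFC : ∀ p ∈ N, ∀ u ∈ W, ∀ t : ℂ, ‖t‖ < ε → FC P d (pt p u t) a b ≠ 0)
    (hD : ∀ p ∈ N, ∀ u ∈ W, ∀ t : ℂ, t ≠ 0 → ‖t‖ < ε → MvPolynomial.aeval (pt p u t) (discFixed d P) ≠ 0)
    (s : Fin m → ℝ) (hsp : ∀ p ∈ N, JoinedIn N s p) (r : ℝ) (hr : 0 < r)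
    (hdis : ∀ α β, (qn P d a b (cm s)).eval α = 0 → (qn P d a b (cm s)).eval β = 0 → α ≠ β →
      ∀ z, ‖z - α‖ < r → ‖z - β‖ < r → False)
    (hnear : ∀ x ∈ N, ∀ α, (qn P d a b (cm s)).eval α = 0 → ∃ z, (qn P d a b (cm x)).eval z = 0 ∧ ‖z - α‖ < r)
    (him : ∀ α, (qn P d a b (cm s)).eval α = 0 → α.im ≠ 0 → r ≤ |α.im|) (hqs : qn P d a b (cm s) ≠ 0) :
    ∃ (k : ℕ) (θ : Fin k → (Fin m → ℝ) → RP1), IsProjRootFunctions d P N θ ∧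
        ∀ l : Fin k, ∀ x ∈ N, ∀ y ∈ N, ∀ (v w : Fin 2 → ℝ) (hv : v ≠ 0) (hw : w ≠ 0),
          θ l x = Projectivization.mk ℝ v hv → θ l y = Projectivization.mk ℝ w hw →
          ordAt (FR P d) (x, v) = ordAt (FR P d) (y, w) := by
  classical
  obtain ⟨u0, hu0⟩ := hWne
  have hFC0 : ∀ p ∈ N, FC P d (cm p) a b ≠ 0 := by
    intro p hp
    have := hFC p hp u0 hu0 0 (by simpa using hε)
    rw [pt_zero] at this
    exact this
  have hk := fun p hp => key P d a b hab N W ε hε hFC hD s p (hsp p hp) r hr hdis hnear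
  set A : Finset ℝ := ((qn P d a b (cm s)).roots.toFinset.filter (fun z => z.im = 0)).image Complex.re with hA
  have hAm : ∀ x : ℝ, x ∈ A ↔ (qn P d a b (cm s)).eval (x : ℂ) = 0 := by
    intro x
    simp only [hA, Finset.mem_image, Finset.mem_filter, Multiset.mem_toFinset, mem_roots hqs, IsRoot.def]
    constructor
    · rintro ⟨z, ⟨hz, hz2⟩, rfl⟩
      have : ((z.re : ℝ) : ℂ) = z := Complex.ext (by simp) (by simp [hz2])
      rw [this]; exact hz
    · intro h
      exact ⟨x, ⟨h, by simp⟩, by simp⟩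
  -- real root near real centre
  have hex : ∀ x ∈ A, ∀ p ∈ N, ∃ ζ : ℝ, (qn P d a b (cm p)).eval (ζ : ℂ) = 0 ∧ ‖(ζ : ℂ) - x‖ < r := by
    intro x hx p hp
    have hx' := (hAm x).1 hx
    obtain ⟨z, hz, hzr⟩ := hnear p hp x hx'
    have hz' := qn_conj P d a b p z hz
    have hzr' : ‖starRingEnd ℂ z - x‖ < r := by
      have : starRingEnd ℂ z - x = starRingEnd ℂ (z - x) := by simp
      rw [this, RCLike.norm_conj]; exact hzr
    have heq := (hk p hp u0 hu0).2.1 x z _ hx' hz hz' hzr hzr'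
    have hre : ((z.re : ℝ) : ℂ) = z := (Complex.conj_eq_iff_re.1 heq.symm)
    exact ⟨z.re, by rw [hre]; exact hz, by rw [hre]; exact hzr⟩
  choose! ζ hζ0 hζr using hex
  have hζu : ∀ x ∈ A, ∀ p ∈ N, ∀ z : ℂ, (qn P d a b (cm p)).eval z = 0 → ‖z - x‖ < r → z = ζ x p := by
    intro x hx p hp z hz hzr
    exact (hk p hp u0 hu0).2.1 x z _ ((hAm x).1 hx) hz (hζ0 x hx p hp) hzr (hζr x hx p hp)
  have hζc : ∀ x ∈ A, ContinuousOn (ζ x) N := by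
    intro x hx p hp
    rw [ContinuousWithinAt, Metric.tendsto_nhds]
    intro η hη
    have hd0 : d ≠ 0 := by
      rintro rfl
      have h1 := (qn_monic P 0 a b (cm p) (hFC0 p hp))
      have h2 := hζ0 x hx p hp
      rw [eq_one_of_monic_natDegree_zero h1.1 h1.2] at h2
      simp at h2
    have hpos : 0 < min η (r - ‖((ζ x p : ℝ) : ℂ) - x‖) := lt_min hη (by linarith [hζr x hx p hp])
    have hev := eventually_root_near (𝓝[N] p) (fun y => qn P d a b (cm y)) d
      (by filter_upwards [self_mem_nhdsWithin] with y hy using qn_monic P d a b _ (hFC0 y hy)) hd0 (ζ x p)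
      (by
        have h1 := (qn_eval_cont P d a b (cm p) (hFC0 p hp) (ζ x p)).tendsto
        rw [hζ0 x hx p hp] at h1
        exact (h1.comp (cm_cont.tendsto p)).mono_left nhdsWithin_le_nhds) _ hpos
    filter_upwards [hev, self_mem_nhdsWithin] with y hy hyN
    obtain ⟨z, hz, hzr⟩ := hy
    have h1 := lt_of_lt_of_le hzr (min_le_left _ _)
    have h2 := lt_of_lt_of_le hzr (min_le_right _ _)
    have h3 : ‖z - x‖ < r := by
      have := norm_sub_le_norm_sub_add_norm_sub z (ζ x p : ℂ) x
      linarith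
    have h4 := hζu x hx y hyN z hz h3
    rw [h4, ← Complex.ofReal_sub, Complex.norm_real] at h1
    rw [dist_eq_norm]; exact h1
  have hζall : ∀ p ∈ N, ∀ ξ : ℝ, (qn P d a b (cm p)).eval (ξ : ℂ) = 0 → ∃ x ∈ A, ζ x p = ξ := by
    intro p hp ξ hξ
    obtain ⟨α, hα, hαr⟩ := (hk p hp u0 hu0).1 ξ hξ
    have hαim : α.im = 0 := by
      by_contra h
      have h1 := him α hα h
      have h2 := Complex.abs_im_le_norm ((ξ : ℂ) - α)
      simp at h2
      linarith
    have hre : ((α.re : ℝ) : ℂ) = α := Complex.ext (by simp) (by simp [hαim])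
    rw [← hre] at hα hαr
    refine ⟨α.re, (hAm _).2 hα, ?_⟩
    have := hζu α.re ((hAm _).2 hα) p hp ξ hξ hαr
    exact_mod_cast this.symm
  have hζinj : ∀ p ∈ N, ∀ x ∈ A, ∀ y ∈ A, ζ x p = ζ y p → x = y := by
    intro p hp x hx y hy h
    by_contra hne
    have h1 := hζr x hx p hp
    rw [h] at h1
    exact hdis x y ((hAm x).1 hx) ((hAm y).1 hy) (by exact_mod_cast hne) _ h1 (hζr y hy p hp)
  have hAl : ∀ l : Fin A.card, ((A.equivFin.symm l : A) : ℝ) ∈ A := fun l => (A.equivFin.symm l).2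
  refine ⟨A.card, fun l p => pv a b hab (ζ (A.equivFin.symm l : A) p), ⟨?_, ?_, ?_, ?_⟩, ?_⟩
  · intro l
    exact (pv_cont a b hab).comp_continuousOn (hζc _ (hAl l))
  · intro p hp l l' hne h
    have h1 := hζinj p hp _ (hAl l) _ (hAl l') (pv_inj a b hab _ _ h)
    exact hne (A.equivFin.symm.injective (Subtype.ext h1))
  · intro p hp v hv
    have := zero_iff P d a b hab p (hFC0 p hp) v hv
    refine this.trans ?_
    constructor
    · rintro ⟨ξ, hξ, h⟩
      obtain ⟨x, hx, hxξ⟩ := hζall p hp ξ hξ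
      refine ⟨A.equivFin ⟨x, hx⟩, ?_⟩
      simp only [Equiv.symm_apply_apply]
      rw [hxξ, h]
    · rintro ⟨l, h⟩
      exact ⟨_, hζ0 _ (hAl l) p hp, h⟩
  · intro l
    have hx' := (hAm _).1 (hAl l)
    refine ⟨(qn P d a b (cm s)).rootMultiplicity (((A.equivFin.symm l : A) : ℝ) : ℂ),
      (rootMultiplicity_pos hqs).2 hx', ?_⟩
    intro p hp v hv h
    obtain ⟨c, hc, rfl⟩ := pv_eq a b hab _ v hv h
    rw [(hk p hp u0 hu0).2.2.1 _ _ hx' (hζ0 _ (hAl l) p hp) (hζr _ (hAl l) p hp)]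
    exact mult_real P d a b hab p (hFC0 p hp) _ c hc
  · intro l
    have hx' := (hAm _).1 (hAl l)
    have hle : ∀ x ∈ N, ∀ y ∈ N, ∀ (v w : Fin 2 → ℝ) (hv : v ≠ 0) (hw : w ≠ 0),
          pv a b hab (ζ (A.equivFin.symm l : A) x) = Projectivization.mk ℝ v hv →
          pv a b hab (ζ (A.equivFin.symm l : A) y) = Projectivization.mk ℝ w hw →
          ordAt (FR P d) (x, v) ≤ ordAt (FR P d) (y, w) := by
      intro x hx y hy v w hv hw h h'
      obtain ⟨c, hc, rfl⟩ := pv_eq a b hab _ v hv h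
      obtain ⟨c', hc', rfl⟩ := pv_eq a b hab _ w hw h'
      refine ENat.forall_natCast_le_iff_le.1 fun μ hμ => ?_
      refine claimB P d a b y W hW ⟨u0, hu0⟩ hab (hFC0 y hy) _ c' hc' μ fun u hu => ?_
      have h1 := claimA P d a b x u (hFC0 x hx) _ c hc μ hμ
      have h2 := ((hk x hx u hu).2.2.2 _ _ hx' (hζ0 _ (hAl l) x hx) (hζr _ (hAl l) x hx) μ).2 h1
      exact ((hk y hy u hu).2.2.2 _ _ hx' (hζ0 _ (hAl l) y hy) (hζr _ (hAl l) y hy) μ).1 h2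
    intro x hx y hy v w hv hw h h'
    exact le_antisymm (hle x hx y hy v w hv hw h h') (hle y hy x hx w v hw hv h' h)

end LPD

open LPD Polynomial Filter Topology in
theorem LPD.main_thm (m dn : ℕ)
    (P : Polynomial (MvPolynomial (Fin m) ℝ)) (hdeg : P.natDegree = dn)
    (S : Set (Fin m → ℝ)) (hsub : IsAnalyticSubmanifold S) (hconn : IsConnected S)
    (hnn : ∀ x ∈ S, evalP P x ≠ 0)
    (hd0 : discFixed dn P ≠ 0)
    (hdinv : OrderInvariantOn (fun x => MvPolynomial.eval x (discFixed dn P)) S) :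
    ∀ s ∈ S, ∃ N : Set (Fin m → ℝ), N ⊆ S ∧ s ∈ N ∧ N ∈ nhdsWithin s S ∧ IsConnected N ∧
      ∃ (k : ℕ) (θ : Fin k → (Fin m → ℝ) → RP1), IsProjRootFunctions dn P N θ ∧
        ∀ l : Fin k, ∀ x ∈ N, ∀ y ∈ N, ∀ (v w : Fin 2 → ℝ) (hv : v ≠ 0) (hw : w ≠ 0),
          θ l x = Projectivization.mk ℝ v hv → θ l y = Projectivization.mk ℝ w hw →
          ordAt (fun p : (Fin m → ℝ) × (Fin 2 → ℝ) =>
              MvPolynomial.eval p.2 (homog dn (evalP P p.1))) (x, v)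
            = ordAt (fun p : (Fin m → ℝ) × (Fin 2 → ℝ) =>
                MvPolynomial.eval p.2 (homog dn (evalP P p.1))) (y, w) := by
  classical
  intro s hs
  -- a point where the form does not vanish
  obtain ⟨a, ha⟩ : ∃ a : ℝ, (evalP P s).eval a ≠ 0 := by
    by_contra h
    push Not at h
    exact hnn s hs (Polynomial.funext fun x => by rw [h x, eval_zero])
  have hdeg' : (evalP P s).natDegree ≤ dn := by
    rw [← hdeg]; exact natDegree_map_le
  have hab : a ^ 2 + (1 : ℝ) ^ 2 ≠ 0 := by positivity
  have hF0 : FC P dn (cm s) (a : ℝ) (1 : ℝ) ≠ 0 := by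
    have h1 := FR_FC P dn s ![a, 1]
    have h2 : FR P dn (s, ![a, 1]) = (evalP P s).eval a := by
      have := homog_eval dn (evalP P s) hdeg' ![a, 1] (by simp)
      simp at this
      exact this
    rw [h2] at h1
    have h3 : FC P dn (cm s) (a : ℝ) (1 : ℝ) = (((evalP P s).eval a : ℝ) : ℂ) := h1.symm
    rw [h3]
    exact_mod_cast ha
  obtain ⟨hqm, hqd⟩ := qn_monic P dn a 1 (cm s) hF0
  have hqs : qn P dn a 1 (cm s) ≠ 0 := hqm.ne_zero
  obtain ⟨u0, hu0⟩ := nonvan (discFixed dn P) hd0 S hdinv s hs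
  have hFe : ∀ᶠ y in 𝓝 (s, u0, (0 : ℂ)), FC P dn (pt y.1 y.2.1 y.2.2) (a : ℝ) (1 : ℝ) ≠ 0 := by
    have hc : Continuous fun y : (Fin m → ℝ) × (Fin m → ℝ) × ℂ =>
        FC P dn (pt y.1 y.2.1 y.2.2) (a : ℝ) (1 : ℝ) := (FC_cont P dn _ _).comp pt_cont
    refine hc.continuousAt.eventually_ne ?_
    simp only [pt_zero]
    exact hF0
  have hev := hu0.and hFe
  rw [nhds_prod_eq, nhds_prod_eq] at hev
  obtain ⟨p1, hp1, p2, hp2, h12⟩ := Filter.eventually_prod_iff.1 hev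
  obtain ⟨p3, hp3, p4, hp4, h34⟩ := Filter.eventually_prod_iff.1 hp2
  obtain ⟨W, hWsub, hW, hWu0⟩ := eventually_nhds_iff.1 hp3
  obtain ⟨ε, hε, hεsub⟩ := Metric.eventually_nhds_iff.1 hp4
  -- separation radius
  obtain ⟨r1, hr1, hsep⟩ := exists_sep_radius (qn P dn a 1 (cm s)).roots.toFinset
  have hmr : ∀ α, (qn P dn a 1 (cm s)).eval α = 0 → α ∈ (qn P dn a 1 (cm s)).roots.toFinset := by
    intro α hα
    rw [Multiset.mem_toFinset, mem_roots hqs]; exact hα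
  obtain ⟨r2, hr2, him⟩ : ∃ r2 > 0, ∀ α ∈ (qn P dn a 1 (cm s)).roots.toFinset, α.im ≠ 0 → r2 ≤ |α.im| := by
    have : ∀ T : Finset ℂ, ∃ r2 > (0 : ℝ), ∀ α ∈ T, α.im ≠ 0 → r2 ≤ |α.im| := by
      intro T
      induction T using Finset.induction_on with
      | empty => exact ⟨1, one_pos, by simp⟩
      | insert β T _ ih =>
        obtain ⟨r, hr, h⟩ := ih
        by_cases hβ : β.im = 0
        · refine ⟨r, hr, fun α hα hα0 => ?_⟩
          rcases Finset.mem_insert.1 hα with rfl | h1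
          · exact absurd hβ hα0
          · exact h α h1 hα0
        · refine ⟨min r |β.im|, lt_min hr (abs_pos.2 hβ), fun α hα hα0 => ?_⟩
          rcases Finset.mem_insert.1 hα with rfl | h1
          · exact min_le_right _ _
          · exact (min_le_left _ _).trans (h α h1 hα0)
    exact this _
  set r := min r1 r2 with hr
  have hrpos : 0 < r := lt_min hr1 hr2
  have hnearE : ∀ᶠ x in 𝓝 s, ∀ α ∈ (qn P dn a 1 (cm s)).roots.toFinset,
      ∃ z, (qn P dn a 1 (cm x)).eval z = 0 ∧ ‖z - α‖ < r := by
    rw [Filter.eventually_all_finset]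
    intro α hα
    have hα0 : (qn P dn a 1 (cm s)).eval α = 0 := by
      rw [Multiset.mem_toFinset, mem_roots hqs] at hα; exact hα
    have hdn : dn ≠ 0 := by
      rintro h
      rw [eq_one_of_monic_natDegree_zero hqm (hqd.trans h)] at hα0
      simp at hα0
    refine eventually_root_near (𝓝 s) (fun y => qn P dn a 1 (cm y)) dn ?_ hdn α ?_ r hrpos
    · have hc : Continuous fun y : Fin m → ℝ => FC P dn (cm y) (a : ℝ) (1 : ℝ) := (FC_cont P dn _ _).comp cm_cont
      filter_upwards [hc.continuousAt.eventually_ne hF0] with y hy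
      exact qn_monic P dn a 1 _ hy
    · have h1 := (qn_eval_cont P dn a 1 (cm s) hF0 α).tendsto
      rw [hα0] at h1
      exact h1.comp (cm_cont.tendsto s)
  obtain ⟨N, hNS, hNV, hsN, hNn, hNpc⟩ := submanifold_nhd S hsub s hs _ (Filter.inter_mem hp1 hnearE)
  refine ⟨N, hNS, hsN, hNn, hNpc.isConnected, ?_⟩
  refine main_local P dn a 1 hab N W hW ⟨u0, hWu0⟩ ε hε ?_ ?_ s (fun p hp => hNpc.joinedIn s hsN p hp) r hrpos ?_ ?_ ?_ hqs
  · intro p hp u hu t ht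
    exact (h12 (hNV hp).1 (h34 (hWsub u hu) (hεsub (by rw [dist_zero_right]; exact ht)))).2
  · intro p hp u hu t ht0 ht
    exact (h12 (hNV hp).1 (h34 (hWsub u hu) (hεsub (by rw [dist_zero_right]; exact ht)))).1 (hNS hp) ht0
  · intro α β hα hβ hne z h1 h2
    exact hsep α (hmr α hα) β (hmr β hβ) hne z (lt_of_lt_of_le h1 (min_le_left _ _)) (lt_of_lt_of_le h2 (min_le_left _ _))
  · intro x hx α hα
    exact (hNV hx).2 α (hmr α hα)
  · intro α hα h
    exact (min_le_right _ _).trans (him α (hmr α hα) h)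

/-- **local theorem.** Let `S` be a connected analytic submanifold of `ℝ^m`
and `P` of degree `d_n` in `x_n`, never nullifying on `S`, such that `Disc^{d_n}_{x_n}(P)`
is not the zero polynomial and is order-invariant on `S`. Then each `s ∈ S` has a connected
neighbourhood `N` of `s` in `S` on which `P` is projectively delineable and such that
`H^{d_n}(P)` is order-invariant on each projective `P`-section over `N`. -/
theorem local_projective_delineability (m dn : ℕ)
    (P : Polynomial (MvPolynomial (Fin m) ℝ)) (hdeg : P.natDegree = dn)
    (S : Set (Fin m → ℝ)) (hsub : IsAnalyticSubmanifold S) (hconn : IsConnected S)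
    (hnn : ∀ x ∈ S, evalP P x ≠ 0)
    (hd0 : discFixed dn P ≠ 0)
    (hdinv : OrderInvariantOn (fun x => MvPolynomial.eval x (discFixed dn P)) S) :
    ∀ s ∈ S, ∃ N : Set (Fin m → ℝ), N ⊆ S ∧ s ∈ N ∧ N ∈ nhdsWithin s S ∧ IsConnected N ∧
      ∃ (k : ℕ) (θ : Fin k → (Fin m → ℝ) → RP1), IsProjRootFunctions dn P N θ ∧
        ∀ l : Fin k, ∀ x ∈ N, ∀ y ∈ N, ∀ (v w : Fin 2 → ℝ) (hv : v ≠ 0) (hw : w ≠ 0),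
          θ l x = Projectivization.mk ℝ v hv → θ l y = Projectivization.mk ℝ w hw →
          ordAt (fun p : (Fin m → ℝ) × (Fin 2 → ℝ) =>
              MvPolynomial.eval p.2 (homog dn (evalP P p.1))) (x, v)
            = ordAt (fun p : (Fin m → ℝ) × (Fin 2 → ℝ) =>
                MvPolynomial.eval p.2 (homog dn (evalP P p.1))) (y, w) := by
  exact LPD.main_thm m dn P hdeg S hsub hconn hnn hd0 hdinv
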